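/- arXiv:2307.16775 — 2 statements merged into one kernel-verified Lean document; each statement's English description precedes it below -/
import Mathlib

section
/- For an odd prime $p \ge 7$ with $p \equiv 3 \pmod 4$ and $g$ a primitive root modulo $p$, the class number of $\mathbb{Q}(\sqrt{-p})$ satisfies $h_{\mathbb{Q}(\sqrt{-p})} = \frac{1}{g+1}\sum_{k=1}^{p-1}(-1)^k x_k$, where $(x_1, \ldots, x_{p-1})$ are the digits of the periodic base-$g$ expansion of $1/p$, i.e., $x_k$ is the $k$-th digit in the expansion $1/p = \sum_{k \ge 1} x_k g^{-k}$ with period $p-1$. -/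
section AbelDirichlet

open Filter Topology MeasureTheory

/-- Abel's theorem for Dirichlet series: a series `∑ f n / n` with bounded coefficient sums
converges, and its sum is the limit of `∑ f n / n ^ s` as `s → 1⁺`. -/
theorem exists_tendsto_sum_div_and_tendsto_LSeries (f : ℕ → ℂ) (hf0 : f 0 = 0) {C : ℝ}
    (hC : ∀ n, ‖∑ k ∈ Finset.Icc 0 n, f k‖ ≤ C)
    (hs : ∀ s : ℝ, 1 < s → LSeriesSummable f s) :
    ∃ l : ℂ, Tendsto (fun n : ℕ ↦ ∑ k ∈ Finset.Icc 0 n, (k : ℂ)⁻¹ * f k) atTop (𝓝 l) ∧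
      Tendsto (fun s : ℝ ↦ LSeries f s) (𝓝[>] 1) (𝓝 l) := by
  have hC0 : 0 ≤ C := (norm_nonneg _).trans (hC 0)
  have hder (t : ℝ) (ht : t ∈ Set.Ici (1 : ℝ)) :
      HasDerivAt (fun x : ℝ ↦ (x : ℂ)⁻¹) (-((t : ℂ) ^ 2)⁻¹) t := by
    have ht' : (t : ℂ) ≠ 0 := by
      have : (1 : ℝ) ≤ t := ht
      exact_mod_cast (by linarith : t ≠ 0)
    exact (hasDerivAt_inv ht').comp_ofReal
  have hcont : ContinuousOn (deriv fun x : ℝ ↦ (x : ℂ)⁻¹) (Set.Ici 1) := by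
    have : ContinuousOn (fun t : ℝ ↦ -((t : ℂ) ^ 2)⁻¹) (Set.Ici 1) := by
      refine ContinuousOn.neg (ContinuousOn.inv₀ (by fun_prop) fun t ht ↦ ?_)
      have : (1 : ℝ) ≤ t := ht
      exact_mod_cast (by positivity : t ^ 2 ≠ 0)
    exact this.congr fun t ht ↦ (hder t ht).deriv
  have hmeas : Measurable fun t : ℝ ↦ ∑ k ∈ Finset.Icc 0 ⌊t⌋₊, f k :=
    (measurable_from_nat (f := fun n : ℕ ↦ ∑ k ∈ Finset.Icc 0 n, f k)).comp Nat.measurable_floor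
  have hint : IntegrableOn (fun t : ℝ ↦ C * t ^ (-2 : ℝ)) (Set.Ioi 1) :=
    (integrableOn_Ioi_rpow_of_lt (by norm_num) one_pos).const_mul C
  have h1 := tendsto_sum_mul_atTop_nhds_one_sub_integral₀ (𝕜 := ℂ) f (f := fun x : ℝ ↦ (x : ℂ)⁻¹)
    hf0 (fun t ht ↦ (hder t ht).differentiableAt)
    (hcont.locallyIntegrableOn measurableSet_Ici) (l := 0) (g := fun t ↦ C * t ^ (-2 : ℝ)) ?_ ?_ ?_
  · refine ⟨_, by simpa using h1, ?_⟩
    have hL (s : ℝ) (h : s ∈ Set.Ioi (1 : ℝ)) : LSeries f s =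
        s * ∫ t in Set.Ioi (1 : ℝ), (∑ k ∈ Finset.Icc 0 ⌊t⌋₊, f k) * (t : ℂ) ^ (-((s : ℂ) + 1)) := by
      have h' : (1 : ℝ) < s := h
      have hI (n : ℕ) : ∑ k ∈ Finset.Icc 0 n, f k = ∑ k ∈ Finset.Icc 1 n, f k := by
        rw [← Finset.insert_Icc_add_one_left_eq_Icc n.zero_le, Finset.sum_insert (by simp), hf0,
          zero_add, zero_add]
      simp_rw [hI]
      refine LSeries_eq_mul_integral f le_rfl (by simpa using by linarith) (hs s h') ?_
      refine Asymptotics.IsBigO.of_bound C (Eventually.of_forall fun n ↦ ?_)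
      simpa [← hI] using hC n
    refine Tendsto.congr' (f₁ := fun s : ℝ ↦ (s : ℂ) *
      ∫ t in Set.Ioi (1 : ℝ), (∑ k ∈ Finset.Icc 0 ⌊t⌋₊, f k) * (t : ℂ) ^ (-((s : ℂ) + 1))) ?_ ?_
    · filter_upwards [self_mem_nhdsWithin] with s h using (hL s h).symm
    have key : Tendsto (fun s : ℝ ↦ ∫ t in Set.Ioi (1 : ℝ),
        (∑ k ∈ Finset.Icc 0 ⌊t⌋₊, f k) * (t : ℂ) ^ (-((s : ℂ) + 1))) (𝓝[>] 1)
        (𝓝 (∫ t in Set.Ioi (1 : ℝ),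
          (∑ k ∈ Finset.Icc 0 ⌊t⌋₊, f k) * (t : ℂ) ^ (-(((1 : ℝ) : ℂ) + 1)))) := by
      refine tendsto_integral_filter_of_dominated_convergence (fun t ↦ C * t ^ (-2 : ℝ)) ?_ ?_
        hint ?_
      · refine Eventually.of_forall fun s ↦ ?_
        refine hmeas.aestronglyMeasurable.mul
          (ContinuousOn.aestronglyMeasurable ?_ measurableSet_Ioi)
        intro t ht
        have ht1 : (1 : ℝ) < t := ht
        refine ContinuousAt.continuousWithinAt ?_
        exact Complex.continuous_ofReal.continuousAt.cpow continuousAt_const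
          (Complex.ofReal_mem_slitPlane.2 (by linarith))
      · filter_upwards [self_mem_nhdsWithin] with s h
        refine (ae_restrict_iff' measurableSet_Ioi).2 (Eventually.of_forall fun t ht ↦ ?_)
        have ht1 : (1 : ℝ) < t := ht
        have h' : (1 : ℝ) < s := h
        rw [norm_mul, Complex.norm_cpow_eq_rpow_re_of_pos (by linarith)]
        refine mul_le_mul (hC _) (Real.rpow_le_rpow_of_exponent_le ht1.le ?_) (by positivity) hC0
        simp
        linarith
      · refine (ae_restrict_iff' measurableSet_Ioi).2 (Eventually.of_forall fun t ht ↦ ?_)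
        have ht1 : (1 : ℝ) < t := ht
        refine Tendsto.const_mul _ (Tendsto.mono_left ?_ nhdsWithin_le_nhds)
        have ht0 : (t : ℂ) ≠ 0 := by exact_mod_cast (by linarith : t ≠ 0)
        have : Continuous fun s : ℝ ↦ (t : ℂ) ^ (-((s : ℂ) + 1)) :=
          Continuous.const_cpow (by fun_prop) (Or.inl ht0)
        exact this.tendsto 1
    have h2 := ((Complex.continuous_ofReal.tendsto 1).mono_left
      (nhdsWithin_le_nhds (s := Set.Ioi (1 : ℝ)))).mul key
    convert h2 using 2
    rw [Complex.ofReal_one, one_mul, ← integral_neg]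
    refine setIntegral_congr_fun measurableSet_Ioi fun t ht ↦ ?_
    have ht1 : (1 : ℝ) < t := ht
    rw [(hder t ht1.le).deriv, mul_comm, neg_mul_eq_mul_neg, neg_neg,
      show (-((1 : ℂ) + 1)) = -((2 : ℕ) : ℂ) by norm_num, Complex.cpow_neg, Complex.cpow_natCast]
  · have hinv : Tendsto (fun n : ℕ ↦ (((n : ℝ) : ℂ))⁻¹) atTop (𝓝 0) := by
      simpa using tendsto_inv_atTop_nhds_zero_nat (𝕜 := ℂ)
    refine hinv.zero_mul_isBoundedUnder_le ?_
    exact isBoundedUnder_of ⟨C, fun n ↦ hC n⟩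
  · refine Asymptotics.IsBigO.of_bound 1 ?_
    filter_upwards [eventually_ge_atTop 1] with t ht
    rw [(hder t ht).deriv, norm_mul, one_mul, norm_neg, norm_inv, norm_pow, Complex.norm_real,
      Real.norm_of_nonneg (by linarith), Real.norm_of_nonneg (by positivity),
      Real.rpow_neg (by linarith), Real.rpow_two, mul_comm]
    exact mul_le_mul_of_nonneg_right (hC _) (by positivity)
  · exact ⟨Set.Ioi 1, Ioi_mem_atTop 1, hint⟩

end AbelDirichlet

section SawtoothSeries

open Filter Topology MeasureTheory

/-- The argument of `1 - e ^ (iθ)` on `(0, 2π)` is the sawtooth `(θ - π) / 2`. -/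
theorem arg_one_sub_exp_mul_I {θ : ℝ} (h0 : 0 < θ) (h1 : θ < 2 * Real.pi) :
    (1 - Complex.exp (θ * Complex.I)).arg = (θ - Real.pi) / 2 := by
  have hsin : 0 < 2 * Real.sin (θ / 2) := by
    have := Real.sin_pos_of_pos_of_lt_pi (x := θ / 2) (by linarith) (by linarith)
    linarith
  have hpi := Real.pi_pos
  rw [← Complex.arg_mul_cos_add_sin_mul_I hsin (θ := (θ - Real.pi) / 2)
    ⟨by linarith, by linarith⟩]
  congr 1
  have hc : Real.cos ((θ - Real.pi) / 2) = Real.sin (θ / 2) := by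
    rw [show (θ - Real.pi) / 2 = θ / 2 - Real.pi / 2 by ring, Real.cos_sub_pi_div_two]
  have hs : Real.sin ((θ - Real.pi) / 2) = -Real.cos (θ / 2) := by
    rw [show (θ - Real.pi) / 2 = θ / 2 - Real.pi / 2 by ring, Real.sin_sub_pi_div_two]
  rw [← Complex.ofReal_cos, ← Complex.ofReal_sin, hc, hs, Complex.exp_mul_I, ← Complex.ofReal_cos,
    ← Complex.ofReal_sin]
  have h2c : Real.cos θ = 1 - 2 * Real.sin (θ / 2) ^ 2 := by
    have := Real.cos_two_mul (θ / 2)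
    rw [show 2 * (θ / 2) = θ by ring] at this
    nlinarith [Real.sin_sq_add_cos_sq (θ / 2)]
  have h2s : Real.sin θ = 2 * Real.sin (θ / 2) * Real.cos (θ / 2) := by
    rw [← Real.sin_two_mul, show 2 * (θ / 2) = θ by ring]
  rw [h2c, h2s]
  push_cast
  ring

theorem one_sub_mem_slitPlane {z : ℂ} (hz : ‖z‖ ≤ 1) (h1 : z ≠ 1) : 1 - z ∈ Complex.slitPlane := by
  by_contra h
  rw [Complex.mem_slitPlane_iff, not_or, not_lt, not_not] at h
  simp only [Complex.sub_re, Complex.one_re, Complex.sub_im, Complex.one_im, zero_sub,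
    neg_eq_zero] at h
  have h2 : z = (z.re : ℂ) := Complex.ext rfl (by simpa using h.2)
  have h3 := (Complex.re_le_norm z).trans hz
  apply h1
  rw [h2, le_antisymm h3 (by linarith [h.1]), Complex.ofReal_one]

variable {p : ℕ} [Fact p.Prime]

theorem sum_mul_stdAddChar_mul_natCast {χ : MulChar (ZMod p) ℂ} (hχ : χ.IsQuadratic) (h1 : χ ≠ 1)
    (n : ℕ) : ∑ a, χ a * ZMod.stdAddChar a ^ n = χ n * gaussSum χ ZMod.stdAddChar := by
  have hpow (a : ZMod p) : ZMod.stdAddChar a ^ n = (ZMod.stdAddChar ((n : ZMod p) * a) : ℂ) := by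
    rw [← nsmul_eq_mul, AddChar.map_nsmul_eq_pow]
  by_cases hn : (n : ZMod p) = 0
  · simp [hpow, hn, MulChar.map_zero χ, MulChar.sum_eq_zero_of_ne_one h1]
  · have := gaussSum_mulShift_eq χ ZMod.stdAddChar (Units.mk0 _ hn)
    rw [hχ.inv] at this
    simpa [gaussSum, hpow, AddChar.mulShift_apply] using this

/-- The value at `1` of the `L`-function of an odd quadratic character, in terms of its Gauss
sum. -/
theorem gaussSum_mul_eq_of_tendsto_sum_div {χ : MulChar (ZMod p) ℂ} (hχ : χ.IsQuadratic)
    (hodd : χ (-1) = -1) {l : ℂ}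
    (hl : Tendsto (fun n : ℕ ↦ ∑ k ∈ Finset.Icc 0 n, (k : ℂ)⁻¹ * χ k) atTop (𝓝 l)) :
    gaussSum χ ZMod.stdAddChar * l = -(Real.pi * Complex.I / p) * ∑ a : ZMod p, a.val * χ a := by
  have h1 : χ ≠ 1 := by
    rintro rfl
    rw [MulChar.one_apply (isUnit_one.neg)] at hodd
    norm_num at hodd
  have hp0 : (0 : ℝ) < p := by exact_mod_cast (Fact.out : p.Prime).pos
  have habel : Tendsto (fun x : ℝ ↦ ∑' n : ℕ, ((n : ℂ)⁻¹ * χ n) * (x : ℂ) ^ n) (𝓝[<] 1) (𝓝 l) := by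
    have : Tendsto (fun n : ℕ ↦ ∑ k ∈ Finset.range n, (k : ℂ)⁻¹ * χ k) atTop (𝓝 l) := by
      rw [← tendsto_add_atTop_iff_nat 1]
      refine hl.congr fun n ↦ ?_
      rw [Nat.range_succ_eq_Icc_zero]
    exact (Complex.tendsto_tsum_powerSeries_nhdsWithin_lt this)
  have hnorm (a : ZMod p) : ‖(ZMod.stdAddChar a : ℂ)‖ = 1 := by
    exact AddChar.norm_apply _ _
  have hne (a : ZMod p) (ha : a ≠ 0) : (ZMod.stdAddChar a : ℂ) ≠ 1 := by
    intro h
    apply ha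
    rw [← AddChar.map_zero_eq_one (ZMod.stdAddChar (N := p))] at h
    exact ZMod.injective_stdAddChar h
  have hleft : Tendsto (fun x : ℝ ↦ gaussSum χ ZMod.stdAddChar *
      ∑' n : ℕ, ((n : ℂ)⁻¹ * χ n) * (x : ℂ) ^ n) (𝓝[<] 1)
      (𝓝 (gaussSum χ ZMod.stdAddChar * l)) := habel.const_mul _
  have hright : Tendsto (fun x : ℝ ↦ ∑ a : ZMod p,
      χ a * -Complex.log (1 - ZMod.stdAddChar a * (x : ℂ))) (𝓝[<] 1)
      (𝓝 (∑ a : ZMod p, χ a * -Complex.log (1 - ZMod.stdAddChar a))) := by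
    refine tendsto_finsetSum _ fun a _ ↦ ?_
    by_cases ha : a = 0
    · simp [ha, MulChar.map_zero χ]
    refine Tendsto.const_mul _ (Tendsto.neg (Tendsto.mono_left ?_ nhdsWithin_le_nhds))
    have hc : ContinuousAt (fun x : ℝ ↦ Complex.log (1 - ZMod.stdAddChar a * (x : ℂ))) 1 := by
      refine ContinuousAt.clog (by fun_prop) ?_
      simpa using one_sub_mem_slitPlane (hnorm a).le (hne a ha)
    simpa using hc.tendsto
  have heq : gaussSum χ ZMod.stdAddChar * l =
      ∑ a : ZMod p, χ a * -Complex.log (1 - ZMod.stdAddChar a) := by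
    refine tendsto_nhds_unique (hleft.congr' ?_) hright
    filter_upwards [Ioo_mem_nhdsLT (show (0 : ℝ) < 1 by norm_num)] with x hx
    have hlt (a : ZMod p) : ‖(ZMod.stdAddChar a : ℂ) * x‖ < 1 := by
      rw [norm_mul, hnorm, one_mul, Complex.norm_real, Real.norm_of_nonneg hx.1.le]
      exact hx.2
    have hsum : HasSum (fun n : ℕ ↦ ∑ a : ZMod p, χ a * ((ZMod.stdAddChar a * (x : ℂ)) ^ n / n))
        (∑ a : ZMod p, χ a * -Complex.log (1 - ZMod.stdAddChar a * (x : ℂ))) :=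
      hasSum_sum fun a _ ↦ (Complex.hasSum_taylorSeries_neg_log (hlt a)).mul_left _
    rw [← hsum.tsum_eq, ← tsum_mul_left]
    refine tsum_congr fun n ↦ ?_
    have := sum_mul_stdAddChar_mul_natCast hχ h1 n
    calc _ = (χ n * gaussSum χ ZMod.stdAddChar) * ((n : ℂ)⁻¹ * (x : ℂ) ^ n) := by ring
      _ = _ := by
        rw [← this, Finset.sum_mul]
        refine Finset.sum_congr rfl fun a _ ↦ ?_
        rw [mul_pow]
        ring
  have hχneg (a : ZMod p) : χ (-a) = -χ a := by
    rw [← neg_one_mul, map_mul, hodd, neg_one_mul]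
  have hconj (a : ZMod p) (ha : a ≠ 0) : Complex.log (1 - ZMod.stdAddChar (-a)) =
      (starRingEnd ℂ) (Complex.log (1 - ZMod.stdAddChar a)) := by
    rw [← Complex.log_conj _ (Complex.mem_slitPlane_iff_arg.1
      (one_sub_mem_slitPlane (hnorm a).le (hne a ha))).1, map_sub, map_one,
      AddChar.map_neg_eq_conj]
  have hdiff (a : ZMod p) : χ a * (Complex.log (1 - ZMod.stdAddChar a) -
      Complex.log (1 - ZMod.stdAddChar (-a))) =
      χ a * (2 * Complex.I * (Real.pi * (a.val / p - 1 / 2))) := by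
    by_cases ha : a = 0
    · simp [ha, MulChar.map_zero χ]
    rw [hconj a ha, Complex.sub_conj, Complex.log_im]
    have hval : (ZMod.stdAddChar a : ℂ) =
        Complex.exp ((2 * Real.pi * a.val / p : ℝ) * Complex.I) := by
      have := ZMod.stdAddChar_coe (N := p) (a.val : ℤ)
      rw [Int.cast_natCast, ZMod.natCast_zmod_val] at this
      rw [this]
      congr 1
      push_cast
      ring
    have hv0 : (0 : ℝ) < a.val := by exact_mod_cast ZMod.val_pos.2 ha
    have hv1 : (a.val : ℝ) < p := by exact_mod_cast ZMod.val_lt a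
    rw [hval, arg_one_sub_exp_mul_I]
    · push_cast
      ring
    · have := Real.pi_pos
      positivity
    · rw [div_lt_iff₀ hp0]
      exact mul_lt_mul_of_pos_left hv1 (by positivity)
  have hsymm : ∑ a : ZMod p, χ a * Complex.log (1 - ZMod.stdAddChar (-a)) =
      -∑ a : ZMod p, χ a * Complex.log (1 - ZMod.stdAddChar a) := by
    rw [← Equiv.sum_comp (Equiv.neg (ZMod p)), ← Finset.sum_neg_distrib]
    simp [hχneg]
  have htwo : 2 * ∑ a : ZMod p, χ a * Complex.log (1 - ZMod.stdAddChar a) =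
      2 * (Real.pi * Complex.I / p * ∑ a : ZMod p, a.val * χ a) := by
    calc _ = ∑ a : ZMod p, χ a * (Complex.log (1 - ZMod.stdAddChar a) -
        Complex.log (1 - ZMod.stdAddChar (-a))) := by
          simp_rw [mul_sub]
          rw [Finset.sum_sub_distrib, hsymm]
          ring
      _ = ∑ a : ZMod p, (2 * (Real.pi * Complex.I / p) * (a.val * χ a) -
          Complex.I * Real.pi * χ a) := by
          refine Finset.sum_congr rfl fun a _ ↦ ?_
          rw [hdiff]
          ring
      _ = _ := by
          rw [Finset.sum_sub_distrib, ← Finset.mul_sum, ← Finset.mul_sum,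
            MulChar.sum_eq_zero_of_ne_one h1]
          ring
  rw [heq, neg_mul, ← mul_left_cancel₀ two_ne_zero htwo, ← Finset.sum_neg_distrib]
  simp

end SawtoothSeries

section HalfSystemProduct

open Polynomial

theorem coeff_card_prod_of_coeff_zero {R ι : Type*} [CommRing R] (s : Finset ι) (f : ι → R[X])
    (hf : ∀ i ∈ s, (f i).coeff 0 = 0) : (∏ i ∈ s, f i).coeff s.card = ∏ i ∈ s, (f i).coeff 1 := by
  have h : ∏ i ∈ s, f i = X ^ s.card * ∏ i ∈ s, (f i).divX := by
    rw [← Finset.prod_const, ← Finset.prod_mul_distrib]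
    refine Finset.prod_congr rfl fun i hi ↦ ?_
    conv_lhs => rw [← divX_mul_X_add (f i), hf i hi, C_0, add_zero, mul_comm]
  rw [h, coeff_X_pow_mul', if_pos le_rfl, Nat.sub_self, coeff_zero_prod]
  simp [coeff_divX]

theorem FiniteField.sum_eval_of_monic {F : Type*} [Field F] [Fintype F] {G : F[X]} (hG : G.Monic)
    (hdeg : G.natDegree = Fintype.card F - 1) : ∑ x : F, G.eval x = -1 := by
  classical
  have hcard : 1 < Fintype.card F := Fintype.one_lt_card
  have htop : ∑ x : F, x ^ (Fintype.card F - 1) = -1 := by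
    have h (x : F) : x ^ (Fintype.card F - 1) = 1 - if x = 0 then 1 else 0 := by
      split_ifs with hx
      · rw [hx, zero_pow (by omega), sub_self]
      · rw [FiniteField.pow_card_sub_one_eq_one x hx, sub_zero]
    simp [h]
  rw [hG.as_sum, hdeg]
  simp only [eval_add, eval_pow, eval_X, eval_finsetSum, eval_mul, eval_C]
  rw [Finset.sum_add_distrib, htop, Finset.sum_comm, Finset.sum_eq_zero, add_zero]
  intro i hi
  rw [← Finset.mul_sum, FiniteField.sum_pow_lt_card_sub_one _ i (Finset.mem_range.1 hi), mul_zero]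

variable {p : ℕ} [Fact p.Prime]

theorem ZMod.sum_range_natCast {M : Type*} [AddCommMonoid M] (f : ZMod p → M) :
    ∑ k ∈ Finset.range p, f k = ∑ a : ZMod p, f a := by
  refine Finset.sum_bij' (fun k _ ↦ (k : ZMod p)) (fun a _ ↦ a.val) (by simp)
    (fun a _ ↦ by simpa using ZMod.val_lt a) (fun k hk ↦ ?_) (by simp) (by simp)
  exact ZMod.val_cast_of_lt (Finset.mem_range.1 hk)

theorem factorial_mul_sum_pow_mul_choose {m : ℕ} (hm : p = 2 * m + 1) :
    (m.factorial : ZMod p) * ∑ k ∈ Finset.range p, (k : ZMod p) ^ m * (k.choose m : ZMod p) = -1 := by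
  have hG : (X ^ m * descPochhammer (ZMod p) m).Monic :=
    (monic_X_pow m).mul (monic_descPochhammer _ m)
  rw [← FiniteField.sum_eval_of_monic hG, ← ZMod.sum_range_natCast, Finset.mul_sum]
  · refine Finset.sum_congr rfl fun k _ ↦ ?_
    rw [eval_mul, eval_pow, eval_X, descPochhammer_eval_eq_descFactorial,
      Nat.descFactorial_eq_factorial_mul_choose]
    push_cast
    ring
  · rw [(monic_X_pow m).natDegree_mul (monic_descPochhammer _ m), natDegree_X_pow,
      descPochhammer_natDegree, ZMod.card]
    omega

/-- Comparison of the coefficients of `(X - 1) ^ m` in a congruence between the polynomial of the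
quadratic Gauss sum and the sine product. -/
theorem mul_two_pow_mul_factorial_sq_eq {m : ℕ} (hm : p = 2 * m + 1) {ε : ZMod p}
    (h : (X - 1 : (ZMod p)[X]) ^ (m + 1) ∣ ∑ k ∈ Finset.range p, C ((k : ZMod p) ^ m) * X ^ k -
      C ε * ∏ k ∈ Finset.Icc 1 m, (X ^ k - X ^ (p - k))) :
    ε * 2 ^ m * (m.factorial : ZMod p) ^ 2 = -1 := by
  obtain ⟨Q, hQ⟩ := h
  have h1 := congrArg (fun P : (ZMod p)[X] ↦ (P.comp (X + 1)).coeff m) hQ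
  simp only [mul_comp, sub_comp, pow_comp, X_comp, one_comp, add_sub_cancel_right, C_comp,
    Polynomial.sum_comp, Polynomial.prod_comp, coeff_sub, coeff_C_mul, finsetSum_coeff,
    coeff_X_add_one_pow, coeff_X_pow_mul'] at h1
  rw [if_neg (by omega)] at h1
  have h2 : (∏ k ∈ Finset.Icc 1 m, ((X + 1 : (ZMod p)[X]) ^ k - (X + 1) ^ (p - k))).coeff m =
      (2 : ZMod p) ^ m * (m.factorial : ZMod p) := by
    have := coeff_card_prod_of_coeff_zero (Finset.Icc 1 m)
      (fun k ↦ ((X + 1 : (ZMod p)[X]) ^ k - (X + 1) ^ (p - k))) (fun k _ ↦ by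
        simp [coeff_sub, coeff_X_add_one_pow])
    rw [Nat.card_Icc, Nat.add_sub_cancel] at this
    rw [this, Finset.prod_congr rfl (g := fun k : ℕ ↦ (2 * k : ZMod p)), Finset.prod_mul_distrib]
    · rw [Finset.prod_const, Nat.card_Icc, Nat.add_sub_cancel, ← Finset.prod_Ico_id_eq_factorial,
        Nat.cast_prod, Finset.Ico_add_one_right_eq_Icc]
    · intro k hk
      rw [Finset.mem_Icc] at hk
      rw [coeff_sub, coeff_X_add_one_pow, coeff_X_add_one_pow, Nat.choose_one_right,
        Nat.choose_one_right, Nat.cast_sub (by omega), CharP.cast_eq_zero (ZMod p) p]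
      ring
  rw [h2, sub_eq_zero] at h1
  have h3 := factorial_mul_sum_pow_mul_choose hm
  rw [h1] at h3
  rw [← h3]
  ring

end HalfSystemProduct

section QuadraticGaussSum

open Polynomial

variable {p : ℕ} [Fact p.Prime]

theorem mul_two_pow_mul_factorial_sq_eq_of_isPrimitiveRoot {m : ℕ} (hm : p = 2 * m + 1)
    (hm0 : m ≠ 0) {η : ℂ} (hη : IsPrimitiveRoot η p) (ε : ℤ)
    (h : ∑ k ∈ Finset.range p, (quadraticChar (ZMod p) k : ℂ) * η ^ k =
      ε * ∏ k ∈ Finset.Icc 1 m, (η ^ k - η ^ (p - k))) :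
    (ε : ZMod p) * 2 ^ m * (m.factorial : ZMod p) ^ 2 = -1 := by
  have hp : p.Prime := Fact.out
  set F : ℤ[X] := ∑ k ∈ Finset.range p, C (quadraticChar (ZMod p) k) * X ^ k -
      C ε * ∏ k ∈ Finset.Icc 1 m, (X ^ k - X ^ (p - k)) with hF
  have hroot : aeval η F = 0 := by
    rw [hF]
    simp only [map_sub, map_sum, map_mul, map_prod, aeval_X, map_pow, aeval_C]
    rw [sub_eq_zero]
    simpa using h
  have hdvd : cyclotomic p ℤ ∣ F := by
    rw [cyclotomic_eq_minpoly hη hp.pos]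
    exact minpoly.isIntegrallyClosed_dvd (hη.isIntegral hp.pos) hroot
  have hdvd' := Polynomial.map_dvd (Int.castRingHom (ZMod p)) hdvd
  have hcyc : cyclotomic p (ZMod p) = (X - 1) ^ (p - 1) := by
    have := cyclotomic_mul_prime_eq_pow_of_not_dvd (ZMod p) (n := 1) (p := p) hp.not_dvd_one
    rwa [one_mul, cyclotomic_one] at this
  have h2 : ringChar (ZMod p) ≠ 2 := by
    rw [ZMod.ringChar_zmod_n]; omega
  rw [map_cyclotomic, hcyc] at hdvd'
  refine mul_two_pow_mul_factorial_sq_eq hm (((pow_dvd_pow _ (by omega)).trans hdvd').trans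
    (dvd_of_eq ?_))
  have hχ (k : ℕ) : ((quadraticChar (ZMod p) k : ℤ) : ZMod p) = (k : ZMod p) ^ m := by
    rw [quadraticChar_eq_pow_of_char_ne_two' h2, ZMod.card,
      show p / 2 = m by omega]
  rw [hF]
  simp only [Polynomial.map_sub, Polynomial.map_sum, Polynomial.map_mul, Polynomial.map_prod,
    Polynomial.map_pow, map_X, map_C, eq_intCast (Int.castRingHom (ZMod p)), hχ]

theorem prod_Icc_neg_one_pow_mul_I (j : ℕ) :
    ∏ k ∈ Finset.Icc 1 (2 * j + 1), ((-1) ^ k * Complex.I) = -Complex.I := by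
  induction j with
  | zero => simp
  | succ j ih =>
    rw [show 2 * (j + 1) + 1 = (2 * j + 1 + 1) + 1 by ring, Finset.prod_Icc_succ_top (by omega),
      Finset.prod_Icc_succ_top (by omega), ih]
    have h1 : (-1 : ℂ) ^ (2 * j + 1 + 1) = 1 := Even.neg_one_pow ⟨j + 1, by ring⟩
    have h2 : (-1 : ℂ) ^ (2 * j + 1 + 1 + 1) = -1 := Odd.neg_one_pow ⟨j + 1, by ring⟩
    rw [h1, h2]
    linear_combination (-Complex.I) * -Complex.I_mul_I

theorem IsPrimitiveRoot.prod_pow_sub_pow_sq {m : ℕ} (hm : p = 2 * m + 1) (hodd : Odd m)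
    {η : ℂ} (hη : IsPrimitiveRoot η p) :
    (∏ k ∈ Finset.Icc 1 m, (η ^ k - η ^ (p - k))) ^ 2 = -p := by
  have hp : p.Prime := Fact.out
  have hcop : Nat.Coprime 2 p := (Nat.coprime_primes Nat.prime_two hp).2 (by omega)
  have hζ := hη.pow_of_coprime 2 hcop
  have hprod : ∏ k ∈ Finset.range (2 * m), (1 - (η ^ 2) ^ (k + 1)) = 2 * (m : ℂ) + 1 := by
    have := IsPrimitiveRoot.prod_one_sub_pow_eq_order (hm ▸ hζ)
    simpa using this
  have hpair (k : ℕ) (hk : k ∈ Finset.Icc 1 m) : (1 - (η ^ 2) ^ k) * (1 - (η ^ 2) ^ (p - k)) =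
      -1 * (η ^ k - η ^ (p - k)) ^ 2 := by
    have h1 : η ^ k * η ^ (p - k) = 1 := by
      rw [← pow_add, Nat.add_sub_cancel' (by rw [Finset.mem_Icc] at hk; omega), hη.pow_eq_one]
    rw [← pow_mul, ← pow_mul, mul_comm 2, mul_comm 2, pow_mul, pow_mul]
    linear_combination (η ^ k * η ^ (p - k) - 1) * h1
  have hsplit : ∏ k ∈ Finset.range (2 * m), (1 - (η ^ 2) ^ (k + 1)) =
      (∏ k ∈ Finset.Icc 1 m, (1 - (η ^ 2) ^ k)) * ∏ k ∈ Finset.Icc 1 m, (1 - (η ^ 2) ^ (p - k)) := by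
    rw [two_mul, Finset.prod_range_add, ← Finset.Ico_add_one_right_eq_Icc,
      Finset.prod_Ico_eq_prod_range, Finset.prod_Ico_eq_prod_range, Nat.add_sub_cancel]
    congr 1
    · exact Finset.prod_congr rfl fun k _ ↦ by rw [add_comm]
    · rw [← Finset.prod_range_reflect]
      refine Finset.prod_congr rfl fun k hk ↦ ?_
      rw [Finset.mem_range] at hk
      congr 2
      omega
  rw [hsplit, ← Finset.prod_mul_distrib, Finset.prod_congr rfl hpair, Finset.prod_mul_distrib,
    Finset.prod_const, Nat.card_Icc, Nat.add_sub_cancel, hodd.neg_one_pow,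
    Finset.prod_pow] at hprod
  have hpm : (p : ℂ) = 2 * m + 1 := by exact_mod_cast hm
  linear_combination -hprod + hpm

theorem prod_pow_sub_pow_eq_neg_I_mul {m : ℕ} (hm : p = 2 * m + 1) (hodd : Odd m) {η : ℂ}
    (hη : η = -Complex.exp (Real.pi / p * Complex.I)) (hη1 : η ^ p = 1) :
    ∃ r : ℝ, 0 < r ∧ ∏ k ∈ Finset.Icc 1 m, (η ^ k - η ^ (p - k)) = -Complex.I * r := by
  have hp : p.Prime := Fact.out
  have hp0 : (0 : ℝ) < p := by exact_mod_cast hp.pos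
  refine ⟨∏ k ∈ Finset.Icc 1 m, (2 * Real.sin (Real.pi / p * k)), ?_, ?_⟩
  · refine Finset.prod_pos fun k hk ↦ ?_
    rw [Finset.mem_Icc] at hk
    have hk0 : (0 : ℝ) < k := by exact_mod_cast hk.1
    have hkp : (k : ℝ) < p := by exact_mod_cast (show k < p by omega)
    have := Real.sin_pos_of_pos_of_lt_pi (x := Real.pi / p * k) (by positivity) (by
      rw [div_mul_eq_mul_div, div_lt_iff₀ hp0]
      gcongr)
    positivity
  · obtain ⟨j, hj⟩ := hodd
    rw [Complex.ofReal_prod, ← prod_Icc_neg_one_pow_mul_I j, ← hj, ← Finset.prod_mul_distrib]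
    refine Finset.prod_congr rfl fun k hk ↦ ?_
    rw [Finset.mem_Icc] at hk
    have h1 : η ^ k = (-1) ^ k * Complex.exp ((Real.pi / p * k : ℝ) * Complex.I) := by
      rw [hη, neg_pow, ← Complex.exp_nat_mul]
      congr 2
      push_cast
      ring
    have h2 : η ^ (p - k) = (-1) ^ k * Complex.exp (-(Real.pi / p * k : ℝ) * Complex.I) := by
      have h3 : η ^ k * η ^ (p - k) = 1 := by
        rw [← pow_add, Nat.add_sub_cancel' (by omega), hη1]
      rw [eq_inv_of_mul_eq_one_right h3, h1, mul_inv, neg_mul, Complex.exp_neg, ← inv_pow]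
      norm_num
    rw [h1, h2]
    push_cast
    rw [Complex.sin]
    linear_combination -(-1) ^ k *
      (Complex.exp (-((Real.pi : ℂ) / p * k) * Complex.I) -
        Complex.exp ((Real.pi : ℂ) / p * k * Complex.I)) * Complex.I_mul_I

/-- The sign of the quadratic Gauss sum for `p ≡ 3 (mod 4)`. -/
theorem gaussSum_quadraticChar_eq (hp4 : p % 4 = 3) :
    gaussSum ((quadraticChar (ZMod p)).ringHomComp (Int.castRingHom ℂ)) ZMod.stdAddChar =
      Real.sqrt p * Complex.I := by
  have hp : p.Prime := Fact.out
  set χ : MulChar (ZMod p) ℂ := (quadraticChar (ZMod p)).ringHomComp (Int.castRingHom ℂ) with hχdef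
  set τ := gaussSum χ ZMod.stdAddChar with hτ
  obtain ⟨m, hm⟩ : ∃ m, p = 2 * m + 1 := ⟨p / 2, by omega⟩
  have hodd : Odd m := Nat.odd_iff.2 (by omega)
  have hchar : ringChar (ZMod p) ≠ 2 := by
    rw [ZMod.ringChar_zmod_n]; omega
  have h2ne : (2 : ZMod p) ≠ 0 := Ring.two_ne_zero hchar
  have hχq : χ.IsQuadratic := (quadraticChar_isQuadratic (ZMod p)).comp _
  have hχ1 : χ ≠ 1 := by
    intro h
    obtain ⟨a, ha⟩ := quadraticChar_exists_neg_one hchar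
    have hu : IsUnit a := by
      by_contra hu
      rw [MulChar.map_nonunit _ hu] at ha
      norm_num at ha
    have h' := congrArg (fun ψ : MulChar (ZMod p) ℂ ↦ ψ a) h
    simp only [hχdef, MulChar.ringHomComp_apply, ha, MulChar.one_apply hu] at h'
    norm_num at h'
  have hχval (a : ZMod p) : χ a = (quadraticChar (ZMod p) a : ℂ) := rfl
  have hc : ((m + 1 : ℕ) : ZMod p) * 2 = 1 := by
    have : ((m + 1 : ℕ) : ZMod p) * 2 = (p : ZMod p) + 1 := by
      conv_rhs => rw [show (p : ZMod p) = ((2 * m + 1 : ℕ) : ZMod p) by rw [← hm]]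
      push_cast
      ring
    rw [this, CharP.cast_eq_zero (ZMod p) p, zero_add]
  have hcne : ((m + 1 : ℕ) : ZMod p) ≠ 0 := left_ne_zero_of_mul_eq_one hc
  set η : ℂ := ZMod.stdAddChar ((m + 1 : ℕ) : ZMod p) with hηdef
  have hηpow (k : ℕ) : η ^ k = ZMod.stdAddChar (k : ZMod p) ^ (m + 1) := by
    rw [hηdef, ← AddChar.map_nsmul_eq_pow, ← AddChar.map_nsmul_eq_pow, nsmul_eq_mul, nsmul_eq_mul,
      mul_comm]
  have hη1 : η ^ p = 1 := by
    rw [hηpow, CharP.cast_eq_zero (ZMod p) p, AddChar.map_zero_eq_one, one_pow]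
  have hηne : η ≠ 1 := by
    intro h
    refine hcne (ZMod.injective_stdAddChar ?_)
    rw [← hηdef, h, AddChar.map_zero_eq_one]
  have hprim : IsPrimitiveRoot η p := by
    have := orderOf_eq_prime hη1 hηne
    exact this ▸ IsPrimitiveRoot.orderOf η
  have hηexp : η = -Complex.exp (Real.pi / p * Complex.I) := by
    have hpC : (p : ℂ) ≠ 0 := by exact_mod_cast hp.ne_zero
    have := ZMod.stdAddChar_coe (N := p) (m + 1 : ℕ)
    rw [hηdef]
    push_cast at this ⊢
    rw [this, ← mul_neg_one, ← Complex.exp_pi_mul_I, ← Complex.exp_add]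
    congr 1
    have hpm : (p : ℂ) = 2 * m + 1 := by exact_mod_cast hm
    field_simp
    rw [hpm]
    ring
  set P := ∏ k ∈ Finset.Icc 1 m, (η ^ k - η ^ (p - k)) with hP
  have hPsq : P ^ 2 = -p := hprim.prod_pow_sub_pow_sq hm hodd
  have hτsq : τ ^ 2 = -p := by
    have h := gaussSum_sq hχ1 hχq (ZMod.isPrimitive_stdAddChar p)
    have hneg : quadraticChar (ZMod p) (-1) = -1 := by
      rw [quadraticChar_neg_one_iff_not_isSquare, ZMod.exists_sq_eq_neg_one_iff]
      omega
    rw [h, hχval, hneg, ZMod.card]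
    push_cast
    ring
  have hsq2 : quadraticChar (ZMod p) 2 ^ 2 = 1 := quadraticChar_sq_one h2ne
  have hsum : ∑ k ∈ Finset.range p, (quadraticChar (ZMod p) k : ℂ) * η ^ k =
      (quadraticChar (ZMod p) 2 : ℂ) * τ := by
    have h1 := sum_mul_stdAddChar_mul_natCast hχq hχ1 (m + 1)
    rw [← ZMod.sum_range_natCast] at h1
    have h2 : quadraticChar (ZMod p) ((m + 1 : ℕ) : ZMod p) = quadraticChar (ZMod p) 2 := by
      have := congrArg (quadraticChar (ZMod p)) hc
      rw [map_mul, map_one] at this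
      linear_combination (-quadraticChar (ZMod p) ((m + 1 : ℕ) : ZMod p)) * hsq2 +
        quadraticChar (ZMod p) 2 * this
    rw [hχval, h2] at h1
    rw [← h1]
    exact Finset.sum_congr rfl fun k _ ↦ by rw [hηpow, hχval]
  obtain ⟨ε, hε, hετ⟩ : ∃ ε : ℤ, (ε = 1 ∨ ε = -1) ∧ (quadraticChar (ZMod p) 2 : ℂ) * τ = ε * P := by
    have : ((quadraticChar (ZMod p) 2 : ℂ) * τ) ^ 2 = P ^ 2 := by
      rw [mul_pow, hPsq, hτsq]
      norm_cast
      rw [hsq2, one_mul]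
    rcases sq_eq_sq_iff_eq_or_eq_neg.1 this with h | h
    · exact ⟨1, .inl rfl, by simpa using h⟩
    · exact ⟨-1, .inr rfl, by simpa using h⟩
  have key := mul_two_pow_mul_factorial_sq_eq_of_isPrimitiveRoot hm (by rintro rfl; simp at hodd)
    hprim ε (hsum.trans hετ)
  have h2m : (2 : ZMod p) ^ m = (quadraticChar (ZMod p) 2 : ℤ) := by
    rw [quadraticChar_eq_pow_of_char_ne_two' hchar, ZMod.card, show p / 2 = m by omega]
  have hnsq : ¬ IsSquare (-1 : ZMod p) := by
    rw [ZMod.exists_sq_eq_neg_one_iff]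
    omega
  have hεχ : quadraticChar (ZMod p) 2 * ε = -1 := by
    by_contra hne
    have h1 : quadraticChar (ZMod p) 2 * ε = 1 := by
      rcases quadraticChar_dichotomy h2ne with h | h <;> rcases hε with h' | h' <;>
        simp [h, h'] at hne ⊢
    refine hnsq ⟨(m.factorial : ZMod p), ?_⟩
    rw [← key, h2m]
    have h1' : ((quadraticChar (ZMod p) 2 : ℤ) : ZMod p) * (ε : ZMod p) = 1 := by
      rw [← Int.cast_mul, h1, Int.cast_one]
    linear_combination ((m.factorial : ZMod p) ^ 2) * h1'
  have hτP : τ = -P := by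
    have h1 : ((quadraticChar (ZMod p) 2 : ℤ) : ℂ) * (ε : ℂ) = -1 := by exact_mod_cast hεχ
    have h2 : ((quadraticChar (ZMod p) 2 : ℤ) : ℂ) ^ 2 = 1 := by exact_mod_cast hsq2
    linear_combination (quadraticChar (ZMod p) 2 : ℂ) * hετ - τ * h2 + P * h1
  obtain ⟨r, hr0, hr⟩ := prod_pow_sub_pow_eq_neg_I_mul hm hodd hηexp hη1
  rw [← hP] at hr
  have hrsq : r ^ 2 = p := by
    have : (r : ℂ) ^ 2 = p := by
      rw [hr] at hPsq
      linear_combination (-1) * hPsq + (r : ℂ) ^ 2 * Complex.I_mul_I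
    exact_mod_cast this
  rw [hτP, hr, ← hrsq, Real.sqrt_sq hr0.le]
  ring

end QuadraticGaussSum

section ImaginaryQuadratic

open NumberField

variable {K : Type*} [Field K] {p : ℕ} {α : K}

theorem Rat.exists_intCast_eq_of_prime_mul_sq {p : ℕ} (hp : p.Prime) {w : ℚ} {n : ℤ}
    (h : p * w ^ 2 = n) : ∃ c : ℤ, w = c := by
  have hint : IsIntegral ℤ ((p : ℚ) * w) := by
    refine IsIntegral.of_pow (n := 2) two_pos ?_
    have : ((p : ℚ) * w) ^ 2 = algebraMap ℤ ℚ (p * n) := by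
      simp only [eq_intCast, Int.cast_mul, ← h]
      push_cast
      ring
    rw [this]
    exact isIntegral_algebraMap
  obtain ⟨c, hc⟩ := IsIntegrallyClosed.isIntegral_iff.1 hint
  rw [eq_intCast] at hc
  have hsq : c ^ 2 = p * n := by
    have : ((c : ℚ)) ^ 2 = p * n := by rw [hc, ← h]; ring
    exact_mod_cast this
  obtain ⟨d, rfl⟩ := (Nat.prime_iff_prime_int.1 hp).dvd_of_dvd_pow (Dvd.intro _ hsq.symm)
  refine ⟨d, ?_⟩
  have hp0 : (p : ℚ) ≠ 0 := by exact_mod_cast hp.ne_zero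
  push_cast at hc
  exact (mul_left_cancel₀ hp0 hc).symm

theorem exists_basis_one_sqrt [NumberField K] (hp : 0 < p) (hα : α ^ 2 = -(p : K))
    (hdeg : Module.finrank ℚ K = 2) : ∃ b : Module.Basis (Fin 2) ℚ K, b 0 = 1 ∧ b 1 = α := by
  have hli : LinearIndependent ℚ ![(1 : K), α] := by
    rw [LinearIndependent.pair_iff]
    intro s t h
    have h2 : ((s ^ 2 + p * t ^ 2 : ℚ) : K) = 0 := by
      rw [Algebra.smul_def, Algebra.smul_def, eq_ratCast, eq_ratCast, mul_one] at h
      push_cast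
      linear_combination (s - t * α) * h + t ^ 2 * hα
    have h3 : s ^ 2 + p * t ^ 2 = 0 := by exact_mod_cast h2
    have hp' : (0 : ℚ) < p := by exact_mod_cast hp
    have ht : t ^ 2 = 0 := by
      nlinarith [sq_nonneg s, mul_nonneg hp'.le (sq_nonneg t), sq_nonneg t]
    have hs : s ^ 2 = 0 := by nlinarith
    exact ⟨pow_eq_zero_iff two_ne_zero |>.1 hs, pow_eq_zero_iff two_ne_zero |>.1 ht⟩
  refine ⟨basisOfLinearIndependentOfCardEqFinrank hli (by simp [hdeg]), ?_, ?_⟩ <;> simp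

theorem leftMulMatrix_eq_of_sq_eq {R S : Type*} [CommRing R] [CommRing S] [Algebra R S]
    (b : Module.Basis (Fin 2) R S) (h0 : b 0 = 1) {s t : R}
    (h1 : b 1 ^ 2 = s • 1 + t • b 1) (u v : R) :
    Algebra.leftMulMatrix b (u • 1 + v • b 1) = !![u, v * s; v, u + v * t] := by
  have e0 : (u • 1 + v • b 1) * b 0 = u • b 0 + v • b 1 := by rw [h0, mul_one]
  have e1 : (u • 1 + v • b 1) * b 1 = (v * s) • b 0 + (u + v * t) • b 1 := by
    rw [h0, add_mul, smul_mul_assoc, smul_mul_assoc, ← sq, h1, one_mul]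
    simp only [smul_add, add_smul, smul_smul]
    ring
  ext i j
  rw [Algebra.leftMulMatrix_eq_repr_mul]
  fin_cases j
  · simp only [Fin.zero_eta, e0]
    fin_cases i <;> simp
  · simp only [Fin.mk_one, e1]
    fin_cases i <;> simp

/-- The integral basis `1, (1 + √-p) / 2` of an imaginary quadratic field with
`p ≡ 3 (mod 4)`. -/
theorem exists_integralBasis [NumberField K] (hp : p.Prime) (hp4 : p % 4 = 3)
    (hα : α ^ 2 = -(p : K))
    (hdeg : Module.finrank ℚ K = 2) : ∃ b : Module.Basis (Fin 2) ℤ (𝓞 K), b 0 = 1 ∧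
      b 1 ^ 2 = (-((p / 4 + 1 : ℕ) : ℤ)) • (1 : 𝓞 K) + (1 : ℤ) • b 1 := by
  obtain ⟨b, hb0, hb1⟩ := exists_basis_one_sqrt hp.pos hα hdeg
  set N : ℕ := p / 4 + 1 with hN
  have hpN : (p : K) = 4 * N - 1 := by
    have : p + 1 = 4 * N := by omega
    have h : (p : K) + 1 = 4 * N := by exact_mod_cast this
    linear_combination h
  have h2 : (2 : K) ≠ 0 := two_ne_zero
  have hsq : ((1 + α) / 2) ^ 2 = -(N : K) + (1 + α) / 2 := by
    field_simp
    linear_combination hα - hpN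
  have hint : IsIntegral ℤ ((1 + α) / 2) := by
    refine ⟨Polynomial.X ^ 2 - (Polynomial.X - Polynomial.C (N : ℤ)), ?_, ?_⟩
    · exact Polynomial.monic_X_pow_sub ((Polynomial.degree_X_sub_C_le _).trans_lt (by norm_num))
    · simp [hsq]
      ring
  set θ : 𝓞 K := ⟨(1 + α) / 2, hint⟩ with hθ
  have hθK : algebraMap (𝓞 K) K θ = (1 + α) / 2 := rfl
  have hmat (u v : ℚ) := leftMulMatrix_eq_of_sq_eq b hb0 (s := -p) (t := 0) (by
      rw [hb1, hα, Algebra.smul_def]; simp) u v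
  have hspan (x : 𝓞 K) : ∃ a c : ℤ, a • (1 : 𝓞 K) + c • θ = x := by
    obtain ⟨u, v, huv⟩ : ∃ u v : ℚ, (x : K) = u • 1 + v • α := by
      refine ⟨b.repr x 0, b.repr x 1, ?_⟩
      conv_lhs => rw [← b.sum_repr x]
      rw [Fin.sum_univ_two, hb0, hb1]
    have hx : IsIntegral ℤ (x : K) := x.isIntegral_coe
    obtain ⟨t, ht⟩ := IsIntegrallyClosed.isIntegral_iff.1 (Algebra.isIntegral_trace (L := ℚ) hx)
    obtain ⟨n, hn⟩ := IsIntegrallyClosed.isIntegral_iff.1 (Algebra.isIntegral_norm ℚ hx)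
    rw [Algebra.trace_eq_matrix_trace b, huv, ← hb1, hmat, Matrix.trace_fin_two_of] at ht
    rw [Algebra.norm_eq_matrix_det b, huv, ← hb1, hmat, Matrix.det_fin_two_of] at hn
    rw [eq_intCast] at ht hn
    obtain ⟨c, hc⟩ := Rat.exists_intCast_eq_of_prime_mul_sq hp (w := 2 * v) (n := 4 * n - t ^ 2) (by
      push_cast
      rw [ht, hn]
      ring)
    have hrel : t ^ 2 + p * c ^ 2 = 4 * n := by
      have : (t : ℚ) ^ 2 + p * c ^ 2 = 4 * n := by
        rw [ht, hn, ← hc]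
        ring
      exact_mod_cast this
    obtain ⟨a, ha⟩ : (2 : ℤ) ∣ t - c := by
      have hN' : (p : ℤ) = 4 * N - 1 := by omega
      have h4 : (2 : ℤ) ∣ (t - c) * (t + c) :=
        ⟨2 * n - 2 * N * c ^ 2, by rw [hN'] at hrel; linear_combination hrel⟩
      rcases Int.prime_two.dvd_or_dvd h4 with h | h
      · exact h
      · omega
    refine ⟨a, c, RingOfIntegers.ext ?_⟩
    have haQ : (t : ℚ) - c = 2 * a := by exact_mod_cast ha
    have hv : v = c / 2 := by linear_combination hc / 2
    have hu : u = a + c / 2 := by linear_combination (-1 / 2) * ht + haQ / 2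
    rw [huv, hu, hv, zsmul_eq_mul, zsmul_eq_mul, Algebra.smul_def, Algebra.smul_def, eq_ratCast,
      eq_ratCast, mul_one, mul_one]
    simp only [map_add, map_mul, map_intCast, hθK]
    push_cast
    ring
  have hli : LinearIndependent ℤ ![(1 : 𝓞 K), θ] := by
    rw [LinearIndependent.pair_iff]
    intro s t h
    have h1 := congrArg (fun y : 𝓞 K ↦ b.repr (y : K)) h
    have h2 : ((s • (1 : 𝓞 K) + t • θ : 𝓞 K) : K) = ((s + t / 2 : ℚ)) • b 0 + (t / 2 : ℚ) • b 1 := by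
      rw [zsmul_eq_mul, zsmul_eq_mul, Algebra.smul_def, Algebra.smul_def, eq_ratCast,
        eq_ratCast, hb0, hb1]
      simp only [map_add, map_mul, map_intCast, hθK, map_one]
      push_cast
      ring
    simp only [h2, map_zero] at h1
    have h3 := DFunLike.congr_fun h1 0
    have h4 := DFunLike.congr_fun h1 1
    simp at h3 h4
    subst h4
    simpa using h3
  refine ⟨Module.Basis.mk hli ?_, ?_, ?_⟩
  · rintro x -
    obtain ⟨a, c, rfl⟩ := hspan x
    rw [Matrix.range_cons, Matrix.range_cons, Matrix.range_empty, Set.union_empty]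
    exact Submodule.mem_span_pair.2 ⟨a, c, rfl⟩
  · simp
  · refine RingOfIntegers.ext ?_
    simp [hθK, hsq]

section Invariants

variable {b : Module.Basis (Fin 2) ℤ (𝓞 K)} {N : ℤ}

theorem discr_eq_of_sq_eq [NumberField K] (h0 : b 0 = 1)
    (h1 : b 1 ^ 2 = (-N) • (1 : 𝓞 K) + (1 : ℤ) • b 1) :
    discr K = 1 - 4 * N := by
  have htr (u v : ℤ) : Algebra.trace ℤ (𝓞 K) (u • 1 + v • b 1) = 2 * u + v := by
    rw [Algebra.trace_eq_matrix_trace b, leftMulMatrix_eq_of_sq_eq b h0 h1,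
      Matrix.trace_fin_two_of]
    ring
  have e00 : b 0 * b 0 = (1 : ℤ) • 1 + (0 : ℤ) • b 1 := by simp [h0]
  have e01 : b 0 * b 1 = (0 : ℤ) • 1 + (1 : ℤ) • b 1 := by simp [h0]
  have e10 : b 1 * b 0 = (0 : ℤ) • 1 + (1 : ℤ) • b 1 := by simp [h0]
  rw [← discr_eq_discr K b, Algebra.discr_def, Matrix.det_fin_two]
  simp only [Algebra.traceMatrix_apply, Algebra.traceForm_apply]
  rw [e00, e01, e10, ← sq, h1, htr, htr, htr]
  ring

theorem four_mul_norm_eq (h0 : b 0 = 1) (h1 : b 1 ^ 2 = (-N) • (1 : 𝓞 K) + (1 : ℤ) • b 1)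
    (u v : ℤ) :
    4 * Algebra.norm ℤ (u • 1 + v • b 1) = (2 * u + v) ^ 2 + (4 * N - 1) * v ^ 2 := by
  rw [Algebra.norm_eq_matrix_det b, leftMulMatrix_eq_of_sq_eq b h0 h1, Matrix.det_fin_two_of]
  ring

theorem exists_eq_smul_one_add (h0 : b 0 = 1) (x : 𝓞 K) :
    ∃ u v : ℤ, x = u • 1 + v • b 1 := by
  refine ⟨b.repr x 0, b.repr x 1, ?_⟩
  conv_lhs => rw [← b.sum_repr x]
  rw [Fin.sum_univ_two, h0]

theorem torsionOrder_eq_two_of_sq_eq [NumberField K] (hN : 2 ≤ N) (h0 : b 0 = 1)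
    (h1 : b 1 ^ 2 = (-N) • (1 : 𝓞 K) + (1 : ℤ) • b 1) : Units.torsionOrder K = 2 := by
  have hunit (x : (𝓞 K)ˣ) : x = 1 ∨ x = -1 := by
    obtain ⟨u, v, huv⟩ := exists_eq_smul_one_add h0 (x : 𝓞 K)
    have hnorm := four_mul_norm_eq h0 h1 u v
    rw [← huv] at hnorm
    have hx := Int.isUnit_iff.1 (x.isUnit.map (Algebra.norm ℤ (S := 𝓞 K)))
    have hv : v = 0 := by
      by_contra hv
      have : 1 ≤ v ^ 2 := by have := sq_pos_of_ne_zero hv; omega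
      rcases hx with hx | hx <;> rw [hx] at hnorm <;> nlinarith [sq_nonneg (2 * u + v)]
    subst hv
    have hu : u ^ 2 = 1 := by
      rcases hx with hx | hx <;> rw [hx] at hnorm <;> nlinarith [sq_nonneg u]
    rcases Int.isUnit_iff.1 (.of_mul_eq_one u (by rw [← sq, hu])) with rfl | rfl
    · exact .inl (Units.ext (by simpa using huv))
    · exact .inr (Units.ext (by simpa using huv))
  have hle : Units.torsionOrder K ≤ 2 := by
    classical
    have hsub : (Units.torsion K : Set (𝓞 K)ˣ) ⊆ ({1, -1} : Finset (𝓞 K)ˣ) := fun x _ ↦ by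
      simpa using hunit x
    have hcard := Set.ncard_le_ncard hsub (Finset.finite_toSet _)
    rw [Set.ncard_coe_finset] at hcard
    exact hcard.trans Finset.card_le_two
  obtain ⟨k, hk⟩ := Units.even_torsionOrder (K := K)
  have := Units.torsionOrder_pos K
  omega

end Invariants

theorem isTotallyComplex_of_sq_eq_neg [NumberField K] (hp : 0 < p) (hα : α ^ 2 = -(p : K)) :
    IsTotallyComplex K := by
  refine ⟨fun w ↦ ?_⟩
  by_contra h
  rw [InfinitePlace.not_isComplex_iff_isReal] at h
  have h2 := congrArg (InfinitePlace.embedding_of_isReal h) hα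
  rw [map_pow, map_neg, map_natCast] at h2
  have hp' : (0 : ℝ) < p := by exact_mod_cast hp
  nlinarith [sq_nonneg (InfinitePlace.embedding_of_isReal h α)]

theorem regulator_eq_one_of_rank_eq_zero [NumberField K] (h : Units.rank K = 0) :
    Units.regulator K = 1 := by
  have : IsEmpty (Fin (Units.rank K)) := by rw [h]; infer_instance
  classical
  rw [Units.regulator_eq_regOfFamily_fundSystem, Units.regOfFamily_eq_det']
  have : IsEmpty {w : InfinitePlace K // w ≠ Units.dirichletUnitTheorem.w₀} :=
    Function.isEmpty (Units.equivFinRank K).symm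
  simp

/-- The residue of `ζ_K` at `1` for `K = ℚ(√-p)`. -/
theorem dedekindZeta_residue_eq [NumberField K] (hp : p.Prime) (hp7 : 7 ≤ p)
    (hp4 : p % 4 = 3) (hα : α ^ 2 = -(p : K)) (hdeg : Module.finrank ℚ K = 2) :
    dedekindZeta_residue K = Real.pi * classNumber K / Real.sqrt p := by
  obtain ⟨b, h0, h1⟩ := exists_integralBasis hp hp4 hα hdeg
  have := isTotallyComplex_of_sq_eq_neg hp.pos hα
  have hr : InfinitePlace.nrRealPlaces K = 0 := IsTotallyComplex.nrRealPlaces_eq_zero K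
  have hc : InfinitePlace.nrComplexPlaces K = 1 := by
    have := IsTotallyComplex.finrank K
    omega
  have hrank : Units.rank K = 0 := by
    rw [Units.rank, InfinitePlace.card_eq_nrRealPlaces_add_nrComplexPlaces, hr, hc]
  rw [dedekindZeta_residue_def, hr, hc, regulator_eq_one_of_rank_eq_zero hrank,
    torsionOrder_eq_two_of_sq_eq (by omega) h0 h1, discr_eq_of_sq_eq h0 h1]
  have habs : |((1 - 4 * ((p / 4 + 1 : ℕ) : ℤ) : ℤ))| = (p : ℤ) := by
    rw [show 1 - 4 * ((p / 4 + 1 : ℕ) : ℤ) = -(p : ℤ) by omega, abs_neg, Nat.abs_cast]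
  rw [← Int.cast_abs, habs]
  have : Real.sqrt p ≠ 0 := Real.sqrt_ne_zero'.2 (by exact_mod_cast hp.pos)
  push_cast
  field_simp

end ImaginaryQuadratic

section IdealCount

open Ideal

theorem Ideal.eq_top_of_intCast_mem_of_coprime {R : Type*} [CommRing R] {I : Ideal R} {a b : ℤ}
    (ha : (a : R) ∈ I) (hb : (b : R) ∈ I) (h : IsCoprime a b) : I = ⊤ := by
  obtain ⟨u, v, huv⟩ := h
  rw [Ideal.eq_top_iff_one, ← Int.cast_one, ← huv]
  push_cast
  exact I.add_mem (I.mul_mem_left _ ha) (I.mul_mem_left _ hb)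

section CountIdeals

variable {R : Type*} [CommRing R] [IsDedekindDomain R] [Module.Free ℤ R]

theorem Ideal.isCoprime_of_coprime_absNorm {I J : Ideal R}
    (h : (absNorm I).Coprime (absNorm J)) : IsCoprime I J := by
  rw [Ideal.isCoprime_iff_exists]
  obtain ⟨u, v, huv⟩ := Nat.isCoprime_iff_coprime.2 h
  refine ⟨u * absNorm I, I.mul_mem_left _ (absNorm_mem I), v * absNorm J,
    J.mul_mem_left _ (absNorm_mem J), ?_⟩
  exact_mod_cast congrArg (Int.cast : ℤ → R) huv

theorem Ideal.card_absNorm_eq_mul_of_coprime [Module.Finite ℤ R] {m n : ℕ} (hm : m ≠ 0)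
    (hn : n ≠ 0) (h : m.Coprime n) :
    Nat.card {I : Ideal R // absNorm I = m * n} =
      Nat.card {I : Ideal R // absNorm I = m} * Nat.card {I : Ideal R // absNorm I = n} := by
  rw [← Nat.card_prod]
  refine (Nat.card_eq_of_bijective (fun IJ : {I : Ideal R // absNorm I = m} ×
    {I : Ideal R // absNorm I = n} ↦ (⟨IJ.1.1 * IJ.2.1, by rw [map_mul, IJ.1.2, IJ.2.2]⟩ :
      {I : Ideal R // absNorm I = m * n})) ⟨?_, ?_⟩).symm
  · rintro ⟨⟨I, hI⟩, ⟨J, hJ⟩⟩ ⟨⟨I', hI'⟩, ⟨J', hJ'⟩⟩ heq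
    simp only [Subtype.mk.injEq, Prod.mk.injEq] at heq ⊢
    have hII' : I = I' := by
      refine dvd_antisymm ?_ ?_
      · exact (isCoprime_of_coprime_absNorm (by rwa [hI, hJ'])).dvd_of_dvd_mul_right
          (heq ▸ dvd_mul_right I J)
      · exact (isCoprime_of_coprime_absNorm (by rwa [hI', hJ])).dvd_of_dvd_mul_right
          (heq ▸ dvd_mul_right I' J')
    refine ⟨hII', ?_⟩
    subst hII'
    refine mul_left_cancel₀ (fun h0 ↦ hm ?_) heq
    rw [← hI, h0, Ideal.zero_eq_bot, absNorm_bot]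
  · rintro ⟨L, hL⟩
    have hdvd : L ∣ span {(m : R)} * span {(n : R)} := by
      rw [Ideal.span_singleton_mul_span_singleton, Ideal.dvd_span_singleton, ← Nat.cast_mul, ← hL]
      exact absNorm_mem L
    obtain ⟨I, J, hI, hJ, rfl⟩ := exists_dvd_and_dvd_of_dvd_mul hdvd
    rw [map_mul] at hL
    have hIm := map_dvd absNorm hI
    have hJn := map_dvd absNorm hJ
    rw [absNorm_span_natCast] at hIm hJn
    have hIdvd : absNorm I ∣ m :=
      ((h.symm.pow_right _).symm.coprime_dvd_left hIm).dvd_of_dvd_mul_right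
        (hL ▸ dvd_mul_right _ _)
    have hJdvd : absNorm J ∣ n :=
      ((h.pow_right _).symm.coprime_dvd_left hJn).dvd_of_dvd_mul_left
        (hL ▸ dvd_mul_left _ _)
    have hIle := Nat.le_of_dvd hm.bot_lt hIdvd
    have hJle := Nat.le_of_dvd hn.bot_lt hJdvd
    have hIeq : absNorm I = m := by
      refine le_antisymm hIle (le_of_mul_le_mul_right ?_ hn.bot_lt)
      rw [← hL]
      gcongr
    have hJeq : absNorm J = n := by
      rw [hIeq] at hL
      exact mul_left_cancel₀ hm hL
    exact ⟨⟨⟨I, hIeq⟩, ⟨J, hJeq⟩⟩, rfl⟩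

variable {q : ℕ}

theorem Ideal.dvd_span_natCast_pow_of_absNorm_eq {I : Ideal R} {k : ℕ} (hI : absNorm I = q ^ k) :
    I ∣ span {(q : R)} ^ k := by
  rw [Ideal.span_singleton_pow, Ideal.dvd_span_singleton, ← Nat.cast_pow, ← hI]
  exact absNorm_mem I

theorem Ideal.card_absNorm_eq_prime_pow_of_inert [Module.Finite ℤ R] (hq : q.Prime)
    (hrank : Module.finrank ℤ R = 2) (hP : Prime (span {(q : R)})) (k : ℕ) :
    (Nat.card {I : Ideal R // absNorm I = q ^ k} : ℤ) = ∑ i ∈ Finset.range (k + 1), (-1) ^ i := by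
  have hN : absNorm (span {(q : R)}) = q ^ 2 := by rw [absNorm_span_natCast, hrank]
  have hform (I : Ideal R) (hI : absNorm I = q ^ k) :
      ∃ j, I = span {(q : R)} ^ j ∧ k = 2 * j := by
    obtain ⟨j, -, hj⟩ := (dvd_prime_pow hP k).1 (dvd_span_natCast_pow_of_absNorm_eq hI)
    rw [associated_iff_eq] at hj
    refine ⟨j, hj, ?_⟩
    rw [hj, map_pow, hN, ← pow_mul] at hI
    exact (Nat.pow_right_injective hq.two_le hI).symm
  rw [neg_one_geom_sum]
  rcases Nat.even_or_odd' k with ⟨c, rfl | rfl⟩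
  · have : Unique {I : Ideal R // absNorm I = q ^ (2 * c)} :=
      { default := ⟨span {(q : R)} ^ c, by rw [map_pow, hN, ← pow_mul]⟩
        uniq := fun ⟨I, hI⟩ ↦ Subtype.ext <| by
          obtain ⟨j, rfl, hj⟩ := hform I hI
          exact congrArg (span {(q : R)} ^ ·) (show j = c by omega) }
    rw [Nat.card_unique, if_neg (by simp)]
    rfl
  · have : IsEmpty {I : Ideal R // absNorm I = q ^ (2 * c + 1)} := ⟨fun ⟨I, hI⟩ ↦ by
      obtain ⟨j, -, hj⟩ := hform I hI
      omega⟩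
    rw [Nat.card_of_isEmpty, if_pos ⟨c + 1, by ring⟩]
    rfl

theorem Ideal.card_absNorm_eq_prime_pow_of_ramified (hq : q.Prime) {P : Ideal R}
    (hP : Prime P) (hN : absNorm P = q) (hPq : P * P = span {(q : R)}) (k : ℕ) :
    Nat.card {I : Ideal R // absNorm I = q ^ k} = 1 := by
  have : Unique {I : Ideal R // absNorm I = q ^ k} :=
    { default := ⟨P ^ k, by rw [map_pow, hN]⟩
      uniq := fun ⟨I, hI⟩ ↦ Subtype.ext <| by
        have hdvd := dvd_span_natCast_pow_of_absNorm_eq hI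
        rw [← hPq, ← sq, ← pow_mul, dvd_prime_pow hP] at hdvd
        obtain ⟨j, -, hj⟩ := hdvd
        rw [associated_iff_eq] at hj
        subst hj
        rw [map_pow, hN] at hI
        exact congrArg (P ^ ·) (Nat.pow_right_injective hq.two_le hI) }
  exact Nat.card_unique

theorem Ideal.card_absNorm_eq_prime_pow_of_split (hq : q.Prime) {P Q : Ideal R}
    (hP : Prime P) (hQ : Prime Q) (hNP : absNorm P = q) (hNQ : absNorm Q = q) (hne : P ≠ Q)
    (hPQ : P * Q = span {(q : R)}) (k : ℕ) :
    Nat.card {I : Ideal R // absNorm I = q ^ k} = k + 1 := by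
  have hPQdvd (i : ℕ) : ¬ P ∣ Q ^ i := fun h ↦ by
    have := hP.dvd_of_dvd_pow h
    rw [hP.dvd_prime_iff_associated hQ, associated_iff_eq] at this
    exact hne this
  have hle (i j i' j' : ℕ) (h : P ^ i * Q ^ j = P ^ i' * Q ^ j') : i ≤ i' := by
    by_contra! hlt
    obtain ⟨d, rfl⟩ := Nat.exists_eq_add_of_lt hlt
    rw [pow_succ, pow_add, mul_assoc, mul_assoc] at h
    have h' := mul_left_cancel₀ (pow_ne_zero i' hP.ne_zero) h
    exact hPQdvd j' (h' ▸ ((dvd_mul_right P (Q ^ j)).mul_left (P ^ d)))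
  rw [Nat.card_eq_of_equiv_fin (n := k + 1)]
  refine (Equiv.ofBijective (fun i : Fin (k + 1) ↦
    (⟨P ^ (i : ℕ) * Q ^ (k - i), ?_⟩ : {I : Ideal R // absNorm I = q ^ k})) ⟨?_, ?_⟩).symm
  · rw [map_mul, map_pow, map_pow, hNP, hNQ, ← pow_add, Nat.add_sub_cancel' (by omega)]
  · intro i j hij
    simp only [Subtype.mk.injEq] at hij
    exact Fin.ext (le_antisymm (hle _ _ _ _ hij) (hle _ _ _ _ hij.symm))
  · rintro ⟨I, hI⟩
    have hdvd := dvd_span_natCast_pow_of_absNorm_eq hI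
    rw [← hPQ, mul_pow] at hdvd
    obtain ⟨A, B, hA, hB, rfl⟩ := exists_dvd_and_dvd_of_dvd_mul hdvd
    obtain ⟨i, -, hi⟩ := (dvd_prime_pow hP k).1 hA
    obtain ⟨j, -, hj⟩ := (dvd_prime_pow hQ k).1 hB
    rw [associated_iff_eq] at hi hj
    subst hi hj
    rw [map_mul, map_pow, map_pow, hNP, hNQ, ← pow_add] at hI
    have := Nat.pow_right_injective hq.two_le hI
    refine ⟨⟨i, by omega⟩, Subtype.ext ?_⟩
    simp only [← this, Nat.add_sub_cancel_left]

end CountIdeals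

end IdealCount

section QuadraticOrderIdeals

open Ideal

section QuadraticOrder

variable {R : Type*} [CommRing R] {b : Module.Basis (Fin 2) ℤ R} {N : ℤ} {q : ℕ}

theorem sub_intCast_notMem_span_natCast (h0 : b 0 = 1) (hq : q.Prime) (r : ℤ) :
    b 1 - r ∉ span {(q : R)} := by
  intro h
  obtain ⟨y, hy⟩ := mem_span_singleton.1 h
  have h2 := congrArg (fun x ↦ b.repr x 1) hy
  have e1 : b 1 - (r : R) = b 1 - r • b 0 := by rw [h0, zsmul_one]
  have e2 : (q : R) * y = (q : ℤ) • y := by rw [zsmul_eq_mul, Int.cast_natCast]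
  simp only [e1, e2, map_sub, map_zsmul, Finsupp.sub_apply, Finsupp.smul_apply, b.repr_self] at h2
  simp at h2
  exact hq.one_lt.ne' (Int.natAbs_one ▸ by
    have := Int.isUnit_iff_natAbs_eq.1 (.of_mul_eq_one _ h2.symm)
    simpa using this)

theorem span_pair_mul_span_pair_le
    (h1 : b 1 ^ 2 = (-N) • (1 : R) + (1 : ℤ) • b 1) {r : ℤ} (hr : (q : ℤ) ∣ r ^ 2 - r + N) :
    span {(q : R), b 1 - r} * span {(q : R), b 1 - (1 - r : ℤ)} ≤ span {(q : R)} := by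
  rw [zsmul_eq_mul, mul_one, one_smul] at h1
  obtain ⟨c, hc⟩ := hr
  rw [span_pair_mul_span_pair, span_le]
  rintro x (rfl | rfl | rfl | rfl)
  · exact mul_mem_right _ _ (mem_span_singleton_self _)
  · exact mul_mem_right _ _ (mem_span_singleton_self _)
  · exact mul_mem_left _ _ (mem_span_singleton_self _)
  · refine mem_span_singleton.2 ⟨-c, ?_⟩
    have hcR := congrArg (Int.cast : ℤ → R) hc
    push_cast at hcR h1 ⊢
    linear_combination h1 - hcR

variable [IsDedekindDomain R] [Module.Free ℤ R]

theorem Ideal.ne_top_of_absNorm_eq_prime {I : Ideal R} (hq : q.Prime) (hI : absNorm I = q) :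
    I ≠ ⊤ := by
  rintro rfl
  rw [absNorm_top] at hI
  exact hq.one_lt.ne hI

theorem Ideal.dvd_of_intCast_mem_of_absNorm_eq {I : Ideal R} (hq : q.Prime)
    (hI : absNorm I = q) {a : ℤ} (ha : (a : R) ∈ I) : (q : ℤ) ∣ a := by
  by_contra h
  refine ne_top_of_absNorm_eq_prime hq hI (eq_top_of_intCast_mem_of_coprime (a := q) (b := a) ?_ ha
    ((Nat.prime_iff_prime_int.1 hq).coprime_iff_not_dvd.2 h))
  rw [Int.cast_natCast, ← hI]
  exact absNorm_mem I

theorem Ideal.prime_of_absNorm_eq_prime {I : Ideal R} (hq : q.Prime) (hI : absNorm I = q) :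
    Prime I := by
  refine Ideal.prime_of_isPrime ?_ (isPrime_of_irreducible_absNorm (hI ▸ hq))
  rintro rfl
  rw [absNorm_bot] at hI
  exact hq.ne_zero hI.symm

theorem exists_dvd_of_absNorm_eq_prime (h1 : b 1 ^ 2 = (-N) • (1 : R) + (1 : ℤ) • b 1)
    (hq : q.Prime) {M : Ideal R} (hM : absNorm M = q) : ∃ r : ℤ, (q : ℤ) ∣ r ^ 2 - r + N := by
  have : NeZero q := ⟨hq.ne_zero⟩
  have hqM : (q : R) ∈ M := hM ▸ absNorm_mem M
  let f : ZMod q →+ R ⧸ M := ZMod.lift q ⟨Int.castAddHom (R ⧸ M), by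
    change (((q : ℤ) : R ⧸ M)) = 0
    rw [Int.cast_natCast, ← map_natCast (Ideal.Quotient.mk M)]
    exact Ideal.Quotient.eq_zero_iff_mem.2 hqM⟩
  have hf (r : ℤ) : f r = (r : R ⧸ M) := ZMod.lift_coe _ _ _
  have hinj : Function.Injective f := by
    refine (injective_iff_map_eq_zero f).2 fun a ha ↦ ?_
    obtain ⟨r, rfl⟩ := ZMod.intCast_surjective a
    rw [hf, ← map_intCast (Ideal.Quotient.mk M), Ideal.Quotient.eq_zero_iff_mem] at ha
    exact (ZMod.intCast_zmod_eq_zero_iff_dvd _ _).2 (dvd_of_intCast_mem_of_absNorm_eq hq hM ha)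
  have hcard : Nat.card (R ⧸ M) = q := hM
  have : Finite (R ⧸ M) := Nat.finite_of_card_ne_zero (hcard ▸ hq.ne_zero)
  have hbij := hinj.bijective_of_nat_card_le (by rw [hcard, Nat.card_zmod])
  obtain ⟨a, ha⟩ := hbij.2 (Ideal.Quotient.mk M (b 1))
  obtain ⟨r, rfl⟩ := ZMod.intCast_surjective a
  rw [hf, ← map_intCast (Ideal.Quotient.mk M), eq_comm, Ideal.Quotient.eq] at ha
  refine ⟨r, dvd_of_intCast_mem_of_absNorm_eq hq hM ?_⟩
  have hmem := M.mul_mem_left (1 - b 1 - r) ha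
  rw [zsmul_eq_mul, mul_one, one_smul] at h1
  convert hmem using 1
  push_cast at h1 ⊢
  linear_combination h1

variable [Module.Finite ℤ R]

theorem absNorm_span_natCast_eq_sq (b : Module.Basis (Fin 2) ℤ R) (q : ℕ) :
    absNorm (span {(q : R)}) = q ^ 2 := by
  rw [absNorm_span_natCast, Module.finrank_eq_card_basis b, Fintype.card_fin]

theorem absNorm_span_pair_eq (h0 : b 0 = 1)
    (h1 : b 1 ^ 2 = (-N) • (1 : R) + (1 : ℤ) • b 1) (hq : q.Prime) {r : ℤ}
    (hr : (q : ℤ) ∣ r ^ 2 - r + N) : absNorm (span {(q : R), b 1 - r}) = q := by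
  set P := span {(q : R), b 1 - r} with hP
  have hmem : b 1 - (r : R) ∈ P := subset_span (by simp)
  have hPq : P ∣ span {(q : R)} := by
    rw [dvd_span_singleton]
    exact subset_span (by simp)
  obtain ⟨J, hJ⟩ := hPq
  have hdvd : absNorm P ∣ q ^ 2 := by
    rw [← absNorm_span_natCast_eq_sq b q, hJ, map_mul]
    exact dvd_mul_right _ _
  obtain ⟨i, hi, hPi⟩ := (Nat.dvd_prime_pow hq).1 hdvd
  interval_cases i
  · rw [pow_zero, absNorm_eq_one_iff] at hPi
    have := span_pair_mul_span_pair_le h1 hr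
    rw [← hP, hPi, top_mul] at this
    exact (sub_intCast_notMem_span_natCast h0 hq (1 - r) (this (subset_span (by simp)))).elim
  · rwa [pow_one] at hPi
  · have hN := absNorm_span_natCast_eq_sq b q
    have hJ1 : absNorm J = 1 := by
      rw [hJ, map_mul, hPi] at hN
      exact mul_left_cancel₀ (pow_ne_zero 2 hq.ne_zero) (hN.trans (mul_one _).symm)
    rw [absNorm_eq_one_iff] at hJ1
    rw [hJ1, mul_top] at hJ
    exact (sub_intCast_notMem_span_natCast h0 hq r (hJ ▸ hmem)).elim

theorem span_pair_mul_span_pair_eq (h0 : b 0 = 1)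
    (h1 : b 1 ^ 2 = (-N) • (1 : R) + (1 : ℤ) • b 1) (hq : q.Prime) {r : ℤ}
    (hr : (q : ℤ) ∣ r ^ 2 - r + N) :
    span {(q : R), b 1 - r} * span {(q : R), b 1 - (1 - r : ℤ)} = span {(q : R)} := by
  obtain ⟨J, hJ⟩ := dvd_iff_le.2 (span_pair_mul_span_pair_le h1 hr)
  have hr' : (q : ℤ) ∣ (1 - r) ^ 2 - (1 - r) + N := by
    convert hr using 1
    ring
  have hN := congrArg absNorm hJ
  rw [map_mul, map_mul, absNorm_span_pair_eq h0 h1 hq hr, absNorm_span_pair_eq h0 h1 hq hr',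
    absNorm_span_natCast_eq_sq b q, ← sq] at hN
  have hJ1 : absNorm J = 1 :=
    mul_left_cancel₀ (pow_ne_zero 2 hq.ne_zero) (hN.symm.trans (mul_one _).symm)
  rw [absNorm_eq_one_iff] at hJ1
  rw [hJ, hJ1, mul_top]

theorem prime_span_natCast_of_forall_not_dvd
    (h1 : b 1 ^ 2 = (-N) • (1 : R) + (1 : ℤ) • b 1) (hq : q.Prime)
    (h : ∀ r : ℤ, ¬ (q : ℤ) ∣ r ^ 2 - r + N) : Prime (span {(q : R)}) := by
  have hN := absNorm_span_natCast_eq_sq b q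
  have hne : span {(q : R)} ≠ ⊤ := fun htop ↦ by
    rw [htop, absNorm_top] at hN
    nlinarith [hq.two_le]
  obtain ⟨M, hM, hle⟩ := exists_le_maximal _ hne
  obtain ⟨J, hJ⟩ := dvd_iff_le.2 hle
  have hdvd : absNorm M ∣ q ^ 2 := by
    rw [← hN, hJ, map_mul]
    exact dvd_mul_right _ _
  obtain ⟨i, hi, hMi⟩ := (Nat.dvd_prime_pow hq).1 hdvd
  interval_cases i
  · rw [pow_zero, absNorm_eq_one_iff] at hMi
    exact (hM.ne_top hMi).elim
  · obtain ⟨r, hr⟩ := exists_dvd_of_absNorm_eq_prime h1 hq (hMi.trans (pow_one q))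
    exact (h r hr).elim
  · have hJ1 : absNorm J = 1 := by
      rw [hJ, map_mul, hMi] at hN
      exact mul_left_cancel₀ (pow_ne_zero 2 hq.ne_zero) (hN.trans (mul_one _).symm)
    rw [absNorm_eq_one_iff] at hJ1
    rw [hJ1, mul_top] at hJ
    rw [hJ]
    refine Ideal.prime_of_isPrime ?_ hM.isPrime
    rintro rfl
    rw [absNorm_bot] at hMi
    exact pow_ne_zero 2 hq.ne_zero hMi.symm

end QuadraticOrder

end QuadraticOrderIdeals

section SplittingLaw

open Ideal

section Splitting

variable {p : ℕ} [Fact p.Prime]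

theorem quadraticChar_natCast_eq_neg (hp4 : p % 4 = 3) {q : ℕ} [Fact q.Prime] (hq2 : q ≠ 2)
    (hqp : q ≠ p) : quadraticChar (ZMod p) q = quadraticChar (ZMod q) (-p : ℤ) := by
  have hp2 : ringChar (ZMod p) ≠ 2 := by
    rw [ZMod.ringChar_zmod_n]
    rintro rfl
    norm_num at hp4
  have h := quadraticChar_odd_prime (F := ZMod p) hp2 hq2
    (by rw [ZMod.ringChar_zmod_n]; exact hqp.symm)
  rw [h, ZMod.card, ZMod.χ₄_nat_three_mod_four hp4]
  push_cast
  congr 1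
  ring

theorem exists_dvd_sq_sub_add_iff (hp4 : p % 4 = 3) {q : ℕ} (hq : q.Prime) (hqp : q ≠ p) :
    (∃ r : ℤ, (q : ℤ) ∣ r ^ 2 - r + (p / 4 + 1 : ℕ)) ↔ quadraticChar (ZMod p) q = 1 := by
  have hN : 4 * ((p / 4 + 1 : ℕ) : ℤ) = p + 1 := by omega
  have : Fact q.Prime := ⟨hq⟩
  rcases eq_or_ne q 2 with rfl | hq2
  · have hp2 : ringChar (ZMod p) ≠ 2 := by
      rw [ZMod.ringChar_zmod_n]
      rintro rfl
      norm_num at hp4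
    have h := quadraticChar_two (F := ZMod p) hp2
    rw [ZMod.card, ZMod.χ₈_nat_eq_if_mod_eight] at h
    rw [show ((2 : ℕ) : ZMod p) = 2 from Nat.cast_ofNat, h]
    have hr (r : ℤ) : (2 : ℤ) ∣ r ^ 2 - r := by
      have := Int.even_mul_pred_self r
      rw [show r ^ 2 - r = r * (r - 1) by ring]
      exact this.two_dvd
    constructor
    · rintro ⟨r, h2⟩
      have := hr r
      rw [if_neg (by omega), if_pos (by omega)]
    · intro h8
      refine ⟨0, ?_⟩
      split_ifs at h8 <;> omega
  · rw [quadraticChar_natCast_eq_neg hp4 hq2 hqp, quadraticChar_one_iff_isSquare]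
    · constructor
      · rintro ⟨r, c, hc⟩
        refine ⟨(2 * r - 1 : ℤ), ?_⟩
        have : (-p : ℤ) = (2 * r - 1) * (2 * r - 1) - q * (4 * c) := by linarith
        rw [this]
        push_cast
        simp
      · rintro ⟨a, ha⟩
        have h2 : (2 : ZMod q) ≠ 0 := by
          intro h
          have : ((2 : ℕ) : ZMod q) = 0 := by exact_mod_cast h
          rw [ZMod.natCast_eq_zero_iff] at this
          exact hq2 ((Nat.prime_dvd_prime_iff_eq hq Nat.prime_two).1 this)
        obtain ⟨r, hr⟩ := ZMod.intCast_surjective ((a + 1) / 2)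
        refine ⟨r, (ZMod.intCast_zmod_eq_zero_iff_dvd _ _).1 ?_⟩
        have hN' := congrArg (Int.cast : ℤ → ZMod q) hN
        push_cast at hN' ha ⊢
        have h2r : 2 * (r : ZMod q) = a + 1 := by
          rw [hr, mul_div_cancel₀ _ h2]
        have h4 : (4 : ZMod q) ≠ 0 := by
          rw [show (4 : ZMod q) = 2 * 2 by norm_num]
          exact mul_ne_zero h2 h2
        refine (mul_eq_zero_iff_left h4).1 ?_
        linear_combination (2 * r - 1 + a) * h2r + hN' - ha
    · rw [Int.cast_neg, neg_ne_zero, Int.cast_natCast, Ne, ZMod.natCast_eq_zero_iff]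
      exact fun h ↦ hqp ((Nat.prime_dvd_prime_iff_eq hq Fact.out).1 h)

variable {R : Type*} [CommRing R] [IsDedekindDomain R] [Module.Free ℤ R] [Module.Finite ℤ R]
  {b : Module.Basis (Fin 2) ℤ R}

theorem Ideal.card_absNorm_eq_prime_pow (hp4 : p % 4 = 3) (h0 : b 0 = 1)
    (h1 : b 1 ^ 2 = (-((p / 4 + 1 : ℕ) : ℤ)) • (1 : R) + (1 : ℤ) • b 1) {q : ℕ} (hq : q.Prime)
    (k : ℕ) : (Nat.card {I : Ideal R // absNorm I = q ^ k} : ℤ) =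
      ∑ i ∈ Finset.range (k + 1), quadraticChar (ZMod p) q ^ i := by
  have hN : 4 * ((p / 4 + 1 : ℕ) : ℤ) = p + 1 := by omega
  rcases eq_or_ne q p with rfl | hqp
  · have hr : (q : ℤ) ∣ ((q / 2 + 1 : ℕ) : ℤ) ^ 2 - (q / 2 + 1 : ℕ) + (q / 4 + 1 : ℕ) := by
      have h2 : 2 * ((q / 2 + 1 : ℕ) : ℤ) = q + 1 := by omega
      refine (Int.isCoprime_iff_gcd_eq_one.2 ?_ : IsCoprime (q : ℤ) 4).dvd_of_dvd_mul_left
        (⟨q + 1, ?_⟩ : _ ∣ (4 : ℤ) * _)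
      · have : Nat.gcd q 4 = 1 := by rw [Nat.gcd_comm, Nat.gcd_rec, hp4]; rfl
        exact_mod_cast this
      · linear_combination hN + (2 * ((q / 2 + 1 : ℕ) : ℤ) + q - 1) * h2
    set r : ℤ := ((q / 2 + 1 : ℕ) : ℤ) with hrdef
    have hP := absNorm_span_pair_eq h0 h1 hq hr
    have heq : span {(q : R), b 1 - (1 - r : ℤ)} = span {(q : R), b 1 - r} := by
      have h2 : (r : R) = q + (1 - r : ℤ) := by
        have h2 : r = q + (1 - r) := by omega
        exact_mod_cast congrArg (Int.cast : ℤ → R) h2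
      rw [h2]
      refine le_antisymm (span_le.2 ?_) (span_le.2 ?_)
      · rintro x (rfl | rfl)
        · exact subset_span (by simp)
        · exact mem_span_pair.2 ⟨1, 1, by ring⟩
      · rintro x (rfl | rfl)
        · exact subset_span (by simp)
        · exact mem_span_pair.2 ⟨-1, 1, by ring⟩
    have hPP := span_pair_mul_span_pair_eq h0 h1 hq hr
    rw [heq] at hPP
    rw [card_absNorm_eq_prime_pow_of_ramified hq (prime_of_absNorm_eq_prime hq hP) hP hPP k,
      show ((q : ℕ) : ZMod q) = 0 from ZMod.natCast_self q, MulChar.map_zero, Finset.sum_range_succ']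
    simp
  · by_cases hex : ∃ r : ℤ, (q : ℤ) ∣ r ^ 2 - r + (p / 4 + 1 : ℕ)
    · rw [(exists_dvd_sq_sub_add_iff hp4 hq hqp).1 hex]
      obtain ⟨r, hr⟩ := hex
      have hr' : (q : ℤ) ∣ (1 - r) ^ 2 - (1 - r) + (p / 4 + 1 : ℕ) := by
        convert hr using 1
        ring
      have hP := absNorm_span_pair_eq h0 h1 hq hr
      have hQ := absNorm_span_pair_eq h0 h1 hq hr'
      rw [card_absNorm_eq_prime_pow_of_split hq (prime_of_absNorm_eq_prime hq hP)
        (prime_of_absNorm_eq_prime hq hQ) hP hQ ?_ (span_pair_mul_span_pair_eq h0 h1 hq hr) k]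
      · simp
      · intro heq
        have hm1 : b 1 - ((1 - r : ℤ) : R) ∈ span {(q : R), b 1 - r} := by
          rw [heq]
          exact subset_span (by simp)
        have hm2 : b 1 - (r : R) ∈ span {(q : R), b 1 - r} := subset_span (by simp)
        have hm : ((2 * r - 1 : ℤ) : R) ∈ span {(q : R), b 1 - r} := by
          convert sub_mem hm1 hm2 using 1
          push_cast
          ring
        have hd := dvd_of_intCast_mem_of_absNorm_eq hq hP hm
        have hqp' : (q : ℤ) ∣ p := by
          have : (p : ℤ) = 4 * (r ^ 2 - r + (p / 4 + 1 : ℕ)) - (2 * r - 1) * (2 * r - 1) := by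
            linear_combination -hN
          rw [this]
          exact dvd_sub (hr.mul_left _) (hd.mul_left _)
        exact hqp ((Nat.prime_dvd_prime_iff_eq hq Fact.out).1 (Int.natCast_dvd_natCast.1 hqp'))
    · have hχ : quadraticChar (ZMod p) q = -1 := by
        refine (quadraticChar_dichotomy ?_).resolve_left
          fun h ↦ hex ((exists_dvd_sq_sub_add_iff hp4 hq hqp).2 h)
        rw [Ne, ZMod.natCast_eq_zero_iff]
        exact fun h ↦ hqp ((Nat.prime_dvd_prime_iff_eq Fact.out hq).1 h).symm
      rw [hχ]
      refine card_absNorm_eq_prime_pow_of_inert hq ?_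
        (prime_span_natCast_of_forall_not_dvd h1 hq (not_exists.1 hex)) k
      rw [Module.finrank_eq_card_basis b, Fintype.card_fin]

open ArithmeticFunction in
theorem Ideal.card_absNorm_eq_sum_divisors (hp4 : p % 4 = 3) (h0 : b 0 = 1)
    (h1 : b 1 ^ 2 = (-((p / 4 + 1 : ℕ) : ℤ)) • (1 : R) + (1 : ℤ) • b 1) {n : ℕ} (hn : n ≠ 0) :
    (Nat.card {I : Ideal R // absNorm I = n} : ℤ) =
      ∑ d ∈ n.divisors, quadraticChar (ZMod p) d := by
  let A : ArithmeticFunction ℤ :=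
    ⟨fun n ↦ if n = 0 then 0 else Nat.card {I : Ideal R // absNorm I = n}, if_pos rfl⟩
  let X : ArithmeticFunction ℤ := ⟨fun n ↦ quadraticChar (ZMod p) n, by simp⟩
  have hA : A.IsMultiplicative := by
    refine IsMultiplicative.iff_ne_zero.2 ⟨?_, fun {m n} hm hn hmn ↦ ?_⟩
    · change (if 1 = 0 then 0 else (Nat.card {I : Ideal R // absNorm I = 1} : ℤ)) = 1
      rw [if_neg one_ne_zero]
      have : Nat.card {I : Ideal R // absNorm I = 1} = 1 := by
        simp only [absNorm_eq_one_iff]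
        simp
      rw [this, Nat.cast_one]
    · change (if _ then _ else _) = (if _ then _ else _) * (if _ then _ else _)
      rw [if_neg hm, if_neg hn, if_neg (mul_ne_zero hm hn),
        card_absNorm_eq_mul_of_coprime hm hn hmn, Nat.cast_mul]
  have hX : X.IsMultiplicative := by
    refine IsMultiplicative.iff_ne_zero.2 ⟨?_, fun {m n} _ _ _ ↦ ?_⟩
    · change quadraticChar (ZMod p) ((1 : ℕ) : ZMod p) = 1
      simp
    · change quadraticChar (ZMod p) ((m * n : ℕ) : ZMod p) =
        quadraticChar (ZMod p) m * quadraticChar (ZMod p) n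
      rw [Nat.cast_mul, map_mul]
  have hAX : A = (zeta : ArithmeticFunction ℤ) * X := by
    refine (hA.eq_iff_eq_on_prime_powers _ _ (isMultiplicative_zeta.natCast.mul hX)).2
      fun q k hq ↦ ?_
    rw [coe_zeta_mul_apply, Nat.sum_divisors_prime_pow hq]
    change (if _ then _ else _) = ∑ i ∈ _, quadraticChar (ZMod p) ((q ^ i : ℕ) : ZMod p)
    rw [if_neg (pow_ne_zero _ hq.ne_zero), card_absNorm_eq_prime_pow hp4 h0 h1 hq]
    simp only [Nat.cast_pow, map_pow]
  have h := congrArg (fun f : ArithmeticFunction ℤ ↦ f n) hAX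
  simp only [coe_zeta_mul_apply] at h
  exact (if_neg hn).symm.trans h

end Splitting

end SplittingLaw

section AnalyticClassNumber

open Filter Topology NumberField

section ClassNumber

variable {p : ℕ} [Fact p.Prime]

theorem sum_range_add_natCast_eq {χ : MulChar (ZMod p) ℂ} (hχ : χ ≠ 1) (m : ℕ) :
    ∑ k ∈ Finset.range (p + m), χ k = ∑ k ∈ Finset.range m, χ k := by
  rw [Finset.sum_range_add, ZMod.sum_range_natCast, MulChar.sum_eq_zero_of_ne_one hχ, zero_add]
  simp

theorem norm_sum_range_natCast_le {χ : MulChar (ZMod p) ℂ} (hχ : χ ≠ 1) (m : ℕ) :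
    ‖∑ k ∈ Finset.range m, χ k‖ ≤ p := by
  induction m using Nat.strong_induction_on with
  | _ m ih =>
    rcases le_total m p with hm | hm
    · refine (norm_sum_le_of_le _ (n := fun _ ↦ 1)
        fun k _ ↦ DirichletCharacter.norm_le_one χ _).trans ?_
      simpa using hm
    · obtain ⟨m, rfl⟩ := Nat.exists_eq_add_of_le hm
      rw [sum_range_add_natCast_eq hχ]
      exact ih m (Nat.lt_add_of_pos_left (NeZero.pos p))

variable {K : Type*} [Field K] [NumberField K] {α : K}

theorem dedekindZeta_eq_riemannZeta_mul (hp4 : p % 4 = 3) (hα : α ^ 2 = -(p : K))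
    (hdeg : Module.finrank ℚ K = 2) {s : ℂ} (hs : 1 < s.re) :
    dedekindZeta K s = riemannZeta s *
      LSeries (fun n ↦ (quadraticChar (ZMod p)).ringHomComp (Int.castRingHom ℂ) n) s := by
  obtain ⟨b, h0, h1⟩ := exists_integralBasis Fact.out hp4 hα hdeg
  rw [← ArithmeticFunction.LSeries_zeta_eq_riemannZeta hs,
    ← LSeries_convolution' (ArithmeticFunction.LSeriesSummable_zeta_iff.2 hs)
      (DirichletCharacter.LSeriesSummable_of_one_lt_re _ hs)]
  refine LSeries_congr (fun {n} hn ↦ ?_) s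
  rw [← LSeries.one_convolution_eq_zeta_convolution, LSeries.convolution_def]
  have h := congrArg (Int.cast : ℤ → ℂ) (Ideal.card_absNorm_eq_sum_divisors hp4 h0 h1 hn)
  push_cast at h
  simp only [Pi.one_apply, one_mul]
  rw [Nat.sum_divisorsAntidiagonal' fun _ d : ℕ ↦
    (quadraticChar (ZMod p)).ringHomComp (Int.castRingHom ℂ) d]
  exact h

theorem tendsto_LSeries_quadraticChar (hp7 : 7 ≤ p) (hp4 : p % 4 = 3) (hα : α ^ 2 = -(p : K))
    (hdeg : Module.finrank ℚ K = 2) :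
    Tendsto (fun s : ℝ ↦
      LSeries (fun n ↦ (quadraticChar (ZMod p)).ringHomComp (Int.castRingHom ℂ) n) s)
      (𝓝[>] 1) (𝓝 (Real.pi * classNumber K / Real.sqrt p)) := by
  have hK := tendsto_sub_one_mul_dedekindZeta_nhdsGT K
  have hc : Tendsto (fun s : ℝ ↦ (s : ℂ)) (𝓝[>] 1) (𝓝[≠] 1) := by
    refine tendsto_nhdsWithin_iff.2 ⟨?_, ?_⟩
    · exact (Complex.continuous_ofReal.tendsto' 1 1 Complex.ofReal_one).mono_left
        nhdsWithin_le_nhds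
    · filter_upwards [self_mem_nhdsWithin] with s hs
      exact Complex.ofReal_ne_one.2 (ne_of_gt hs)
  have hζ := riemannZeta_residue_one.comp hc
  have h := hK.div hζ one_ne_zero
  rw [div_one, dedekindZeta_residue_eq Fact.out hp7 hp4 hα hdeg] at h
  push_cast at h
  refine h.congr' ?_
  filter_upwards [self_mem_nhdsWithin] with s hs
  have hs' : (1 : ℝ) < (s : ℂ).re := hs
  have hs1 : (s : ℂ) - 1 ≠ 0 := sub_ne_zero.2 (by exact_mod_cast (ne_of_gt hs : s ≠ 1))
  simp only [Pi.div_apply, Function.comp_apply]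
  rw [dedekindZeta_eq_riemannZeta_mul hp4 hα hdeg hs', ← mul_assoc,
    mul_div_cancel_left₀ _ (mul_ne_zero hs1 (riemannZeta_ne_zero_of_one_lt_re hs'))]

theorem mul_classNumber_eq_neg_sum (hp7 : 7 ≤ p) (hp4 : p % 4 = 3) (hα : α ^ 2 = -(p : K))
    (hdeg : Module.finrank ℚ K = 2) :
    (p : ℤ) * classNumber K = -∑ a : ZMod p, a.val * quadraticChar (ZMod p) a := by
  have hchar : ringChar (ZMod p) ≠ 2 := by
    rw [ZMod.ringChar_zmod_n]
    omega
  set χ := (quadraticChar (ZMod p)).ringHomComp (Int.castRingHom ℂ) with hχ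
  have hq : χ.IsQuadratic := (quadraticChar_isQuadratic (ZMod p)).comp _
  have hneg : χ (-1) = -1 := by
    have : quadraticChar (ZMod p) (-1) = -1 := by
      rw [quadraticChar_neg_one_iff_not_isSquare, ZMod.exists_sq_eq_neg_one_iff]
      omega
    rw [hχ, MulChar.ringHomComp_apply, this]
    simp
  have hχ1 : χ ≠ 1 := fun h ↦ by
    rw [h, MulChar.one_apply isUnit_one.neg] at hneg
    norm_num at hneg
  obtain ⟨l, hl, hL⟩ := exists_tendsto_sum_div_and_tendsto_LSeries (fun n : ℕ ↦ χ n) (C := p)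
    (by rw [Nat.cast_zero, MulChar.map_zero])
    (fun n ↦ by rw [← Nat.range_succ_eq_Icc_zero]; exact norm_sum_range_natCast_le hχ1 _)
    fun s hs ↦ DirichletCharacter.LSeriesSummable_of_one_lt_re χ hs
  have hlim := tendsto_nhds_unique hL (tendsto_LSeries_quadraticChar hp7 hp4 hα hdeg)
  have h := gaussSum_mul_eq_of_tendsto_sum_div hq hneg hl
  rw [hlim, gaussSum_quadraticChar_eq hp4] at h
  have hp0 : (p : ℂ) ≠ 0 := Nat.cast_ne_zero.2 (NeZero.ne p)
  have hsq : (Real.sqrt p : ℂ) ≠ 0 := by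
    exact_mod_cast (Real.sqrt_pos.2 (Nat.cast_pos.2 (NeZero.pos p))).ne'
  have hpi : (Real.pi : ℂ) ≠ 0 := by exact_mod_cast Real.pi_ne_zero
  have hcast : ((∑ a : ZMod p, a.val * quadraticChar (ZMod p) a : ℤ) : ℂ) =
      ∑ a : ZMod p, a.val * χ a := by
    push_cast
    rfl
  refine Int.cast_injective (α := ℂ) ?_
  rw [Int.cast_neg, hcast]
  push_cast
  generalize ∑ a : ZMod p, (a.val : ℂ) * χ a = S at h
  field_simp at h
  linear_combination h

end ClassNumber

end AnalyticClassNumber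

section Digits

variable {p : ℕ} [Fact p.Prime] {g : ℕ}

theorem quadraticChar_eq_neg_one_of_orderOf_eq (hp2 : p ≠ 2)
    (hord : orderOf (g : ZMod p) = p - 1) : quadraticChar (ZMod p) g = -1 := by
  have hp : p.Prime := Fact.out
  have h2 := hp.two_le
  have hg0 : (g : ZMod p) ≠ 0 := by
    intro h
    rw [h, orderOf_zero] at hord
    omega
  refine (quadraticChar_dichotomy hg0).resolve_left fun h ↦ ?_
  rw [quadraticChar_one_iff_isSquare hg0, ZMod.euler_criterion p hg0] at h
  have := Nat.le_of_dvd (by omega) (orderOf_dvd_of_pow_eq_one h)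
  omega

theorem sum_range_pow_eq_sum_of_orderOf_eq {M : Type*} [AddCommMonoid M]
    (hord : orderOf (g : ZMod p) = p - 1) (f : ZMod p → M) (hf : f 0 = 0) :
    ∑ k ∈ Finset.range (p - 1), f ((g : ZMod p) ^ k) = ∑ a, f a := by
  have hp : p.Prime := Fact.out
  have h2 := hp.two_le
  have hg0 : (g : ZMod p) ≠ 0 := by
    intro h
    rw [h, orderOf_zero] at hord
    omega
  have hinj : Set.InjOn (fun k ↦ (g : ZMod p) ^ k) (Finset.range (p - 1)) := by
    rw [← hord, Finset.coe_range]
    exact pow_injOn_Iio_orderOf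
  rw [← Finset.sum_image (f := f) hinj]
  have himg : (Finset.range (p - 1)).image (fun k ↦ (g : ZMod p) ^ k) = Finset.univ.erase 0 := by
    refine Finset.eq_of_subset_of_card_le (fun x hx ↦ ?_) ?_
    · obtain ⟨k, -, rfl⟩ := Finset.mem_image.1 hx
      exact Finset.mem_erase.2 ⟨pow_ne_zero k hg0, Finset.mem_univ _⟩
    · rw [Finset.card_image_of_injOn hinj, Finset.card_erase_of_mem (Finset.mem_univ _),
        Finset.card_univ, ZMod.card, Finset.card_range]
  rw [himg, Finset.sum_erase _ hf]

theorem mul_sum_digits_eq (hp2 : p ≠ 2) (hord : orderOf (g : ZMod p) = p - 1) :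
    (p : ℤ) * ∑ k ∈ Finset.Icc 1 (p - 1), (-1) ^ k * ((g * (g ^ (k - 1) % p) / p : ℕ) : ℤ) =
      -((g + 1) * ∑ a : ZMod p, a.val * quadraticChar (ZMod p) a) := by
  have hχ (k : ℕ) : quadraticChar (ZMod p) ((g : ZMod p) ^ k) = (-1) ^ k := by
    rw [map_pow, quadraticChar_eq_neg_one_of_orderOf_eq hp2 hord]
  have hval (k : ℕ) : ((g : ZMod p) ^ k).val = g ^ k % p := by
    rw [← Nat.cast_pow, ZMod.val_natCast]
  have hS : ∑ a : ZMod p, a.val * quadraticChar (ZMod p) a =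
      ∑ k ∈ Finset.range (p - 1), ((g ^ k % p : ℕ) : ℤ) * (-1) ^ k := by
    rw [← sum_range_pow_eq_sum_of_orderOf_eq hord
      (fun a ↦ (a.val : ℤ) * quadraticChar (ZMod p) a) (by simp)]
    simp only [hχ, hval]
  have hS' : ∑ a : ZMod p, a.val * quadraticChar (ZMod p) a =
      ∑ k ∈ Finset.range (p - 1), ((g ^ (k + 1) % p : ℕ) : ℤ) * (-1) ^ (k + 1) := by
    have hodd : Odd p := (Fact.out : p.Prime).odd_of_ne_two hp2
    have hpow : (g : ZMod p) ^ (p - 1) = 1 := hord ▸ pow_orderOf_eq_one _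
    have hlast : g ^ (p - 1) % p = g ^ 0 % p := by
      rw [← hval, ← hval, hpow, pow_zero]
    have heven : Even (p - 1) := hodd.tsub_odd odd_one
    have h := Finset.sum_range_succ' (fun k ↦ ((g ^ k % p : ℕ) : ℤ) * (-1) ^ k) (p - 1)
    rw [Finset.sum_range_succ, hlast, heven.neg_one_pow, pow_zero (-1 : ℤ), ← hS] at h
    exact add_right_cancel h
  have hdigit (k : ℕ) : (p : ℤ) * ((g * (g ^ k % p) / p : ℕ) : ℤ) =
      g * (g ^ k % p : ℕ) - (g ^ (k + 1) % p : ℕ) := by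
    have h1 := Nat.div_add_mod (g * (g ^ k % p)) p
    rw [Nat.mul_mod_mod, ← pow_succ'] at h1
    rw [eq_sub_iff_add_eq]
    exact_mod_cast h1
  have hIcc : Finset.Icc 1 (p - 1) = Finset.Ico 1 p := by
    ext k
    have := NeZero.pos p
    rw [Finset.mem_Icc, Finset.mem_Ico]
    omega
  rw [hIcc, Finset.sum_Ico_eq_sum_range, add_one_mul]
  nth_rewrite 2 [hS']
  rw [hS, Finset.mul_sum, Finset.mul_sum, ← Finset.sum_add_distrib, ← Finset.sum_neg_distrib]
  refine Finset.sum_congr rfl fun k _ ↦ ?_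
  rw [Nat.add_sub_cancel_left, pow_add, pow_one, pow_succ (-1 : ℤ)]
  linear_combination -(-1) ^ k * hdigit k

end Digits

/-- Girstmair's formula: for a prime `p ≥ 7` with `p ≡ 3 (mod 4)` and `g` a
primitive root modulo `p`, the class number of `K = ℚ(√-p)` satisfies
`(g+1) · h_K = ∑_{k=1}^{p-1} (-1)^k x_k`, where `x_k = ⌊g · {g^{k-1}/p}⌋` is the `k`-th
digit of the periodic base-`g` expansion of `1/p`. -/
theorem girstmair_class_number_formula {K : Type*} [Field K] [NumberField K]
    (p : ℕ) (hp : p.Prime) (hp7 : 7 ≤ p) (hp4 : p % 4 = 3)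
    (g : ℕ) (hg : 2 ≤ g) (hord : orderOf (g : ZMod p) = p - 1)
    (α : K) (hα : α ^ 2 = -(p : K)) (hdeg : Module.finrank ℚ K = 2) :
    ((g : ℤ) + 1) * (NumberField.classNumber K : ℤ) =
      ∑ k ∈ Finset.Icc 1 (p - 1), (-1) ^ k * ((g * (g ^ (k - 1) % p) / p : ℕ) : ℤ) := by
  have : Fact p.Prime := ⟨hp⟩
  refine mul_left_cancel₀ (Nat.cast_ne_zero.2 hp.ne_zero : (p : ℤ) ≠ 0) ?_
  rw [mul_sum_digits_eq (by omega) hord]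
  linear_combination ((g : ℤ) + 1) * mul_classNumber_eq_neg_sum hp7 hp4 hα hdeg
end

section
/- Let $d < 0$ be a fundamental discriminant. Then the class number of $\mathbb{Q}(\sqrt{d})$ satisfies $h_{\mathbb{Q}(\sqrt{d})} = -\frac{w_d}{2|d|}\sum_{r=1}^{|d|-1}\left(\frac{d}{r}\right) r$, where $w_d$ is the number of roots of unity in $\mathbb{Q}(\sqrt{d})$ and $\left(\frac{d}{\cdot}\right)$ is the Kronecker symbol. -/
/-- `d` is a fundamental discriminant. -/
def IsFundamentalDiscriminant (d : ℤ) : Prop :=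
  d ≠ 1 ∧ ((d % 4 = 1 ∧ Squarefree d) ∨
    (d % 4 = 0 ∧ Squarefree (d / 4) ∧ (d / 4 % 4 = 2 ∨ d / 4 % 4 = 3)))

/-- The Kronecker symbol `(d / n)`, defined multiplicatively from the Jacobi symbol on the
odd part of `n` together with the value at `2`. -/
def kroneckerSym (d : ℤ) (n : ℕ) : ℤ :=
  (if d % 2 = 0 then 0 else if d % 8 = 1 ∨ d % 8 = 7 then 1 else -1) ^ n.factorization 2 *
    jacobiSym d (n / 2 ^ n.factorization 2)

open Filter Topology NumberField

open scoped nonZeroDivisors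

theorem sum_range_mul_eq (f : ℕ → ℝ) (N Q : ℕ) :
    ∑ m ∈ Finset.range (N * Q), f m =
      ∑ q ∈ Finset.range Q, ∑ r ∈ Finset.range N, f (N * q + r) := by
  induction Q with
  | zero => simp
  | succ Q ih => rw [Nat.mul_succ, Finset.sum_range_add, ih, Finset.sum_range_succ]

/-- For a slowly decreasing convex sequence `a`, the differences `a m - a (m + r)` and
`r / N * (a m - a (m + N))` agree up to second differences. -/
theorem abs_sub_add_div_mul_sub_le {a : ℕ → ℝ} (ha : Antitone fun m ↦ a m - a (m + 1)) {N r : ℕ}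
    (hr : r < N) (m : ℕ) :
    |a (m + r) - a m + r / N * (a m - a (m + N))| ≤
      r * ((a m - a (m + 1)) - (a (m + N) - a (m + N + 1))) := by
  have key : ∀ k ≤ N, k * (a (m + N) - a (m + N + 1)) ≤ a m - a (m + k) ∧
      a m - a (m + k) ≤ k * (a m - a (m + 1)) := by
    intro k hk
    induction k with
    | zero => simp
    | succ k ih =>
      obtain ⟨h1, h2⟩ := ih (by omega)
      have h3 := ha (show m ≤ m + k by omega)
      have h4 := ha (show m + k ≤ m + N by omega)
      simp only at h3 h4
      push_cast
      rw [← add_assoc]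
      constructor <;> linarith
  obtain ⟨h1, h2⟩ := key r hr.le
  obtain ⟨h3, h4⟩ := key N le_rfl
  have hN : (0 : ℝ) < N := by exact_mod_cast (show 0 < N by omega)
  have h5 : r / N * (N * (a (m + N) - a (m + N + 1))) ≤ (r / N : ℝ) * (a m - a (m + N)) := by gcongr
  have h6 : r / N * (a m - a (m + N)) ≤ (r / N : ℝ) * (N * (a m - a (m + 1))) := by gcongr
  rw [← mul_assoc, div_mul_cancel₀ _ hN.ne'] at h5 h6
  rw [abs_le]
  constructor <;> linarith

theorem abs_tsum_mul_add_le {N : ℕ} (hN : 0 < N) {χ : ℕ → ℝ} (hper : Function.Periodic χ N)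
    (hsum : ∑ r ∈ Finset.range N, χ r = 0) (hχ : ∀ n, |χ n| ≤ 1) {a : ℕ → ℝ}
    (ha : Antitone fun m ↦ a m - a (m + 1)) (hs : Summable a) :
    |∑' m, χ m * a m + (∑ r ∈ Finset.range N, χ r * r) / N * a 0| ≤
      (∑ r ∈ Finset.range N, (r : ℝ)) * (a 0 - a 1) := by
  have hNR : (N : ℝ) ≠ 0 := by positivity
  have hlim := hs.tendsto_atTop_zero
  have hs' : Summable fun m ↦ χ m * a m := by
    refine hs.norm.of_norm_bounded fun n ↦ ?_
    rw [norm_mul]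
    exact mul_le_of_le_one_left (norm_nonneg _) (hχ n)
  have hsub : Tendsto (fun Q : ℕ ↦ N * Q) atTop atTop := tendsto_id.const_mul_atTop' hN
  have hpart : ∀ Q : ℕ, |∑ m ∈ Finset.range (N * Q), χ m * a m +
      (∑ r ∈ Finset.range N, χ r * r) / N * (a 0 - a (N * Q))| ≤
      (∑ r ∈ Finset.range N, (r : ℝ)) * ((a 0 - a 1) - (a (N * Q) - a (N * Q + 1))) := by
    intro Q
    have hid : ∑ m ∈ Finset.range (N * Q), χ m * a m +
        (∑ r ∈ Finset.range N, χ r * r) / N * (a 0 - a (N * Q)) =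
        ∑ q ∈ Finset.range Q, ∑ r ∈ Finset.range N,
          χ r * (a (N * q + r) - a (N * q) + r / N * (a (N * q) - a (N * q + N))) := by
      have h0 := Finset.sum_range_sub' (fun q ↦ a (N * q)) Q
      simp only [mul_zero] at h0
      rw [sum_range_mul_eq, ← h0, Finset.mul_sum, ← Finset.sum_add_distrib]
      refine Finset.sum_congr rfl fun q _ ↦ ?_
      have hc : ∀ r, χ (N * q + r) = χ r := fun r ↦ by
        rw [add_comm, mul_comm]; exact hper.nat_mul q r
      simp only [hc, mul_add, mul_sub, Finset.sum_add_distrib, Finset.sum_sub_distrib,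
        ← Finset.sum_mul, hsum, mul_one]
      rw [Finset.sum_div, Finset.sum_mul, Finset.sum_mul]
      simp only [← mul_assoc, mul_div_assoc]
      ring
    have h1 := Finset.sum_range_sub' (fun q ↦ a (N * q) - a (N * q + 1)) Q
    simp only [mul_zero, zero_add] at h1
    rw [hid, ← h1, Finset.mul_sum]
    refine (Finset.abs_sum_le_sum_abs _ _).trans (Finset.sum_le_sum fun q _ ↦ ?_)
    rw [Finset.sum_mul]
    refine (Finset.abs_sum_le_sum_abs _ _).trans (Finset.sum_le_sum fun r hr ↦ ?_)
    rw [abs_mul]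
    refine (mul_le_of_le_one_left (abs_nonneg _) (hχ r)).trans ?_
    exact abs_sub_add_div_mul_sub_le ha (Finset.mem_range.mp hr) (N * q)
  refine le_of_tendsto_of_tendsto' (b := atTop)
    (f := fun Q : ℕ ↦ |∑ m ∈ Finset.range (N * Q), χ m * a m +
      (∑ r ∈ Finset.range N, χ r * r) / N * (a 0 - a (N * Q))|)
    (g := fun Q : ℕ ↦
      (∑ r ∈ Finset.range N, (r : ℝ)) * ((a 0 - a 1) - (a (N * Q) - a (N * Q + 1)))) ?_ ?_ hpart
  · have h1 := (hs'.hasSum.tendsto_sum_nat.comp hsub)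
    have h2 := (hlim.comp hsub)
    simpa using (h1.add ((h2.const_sub (a 0)).const_mul
      ((∑ r ∈ Finset.range N, χ r * r) / N))).abs
  · have h2 := (hlim.comp hsub)
    have h3 := ((hlim.comp (tendsto_add_atTop_nat 1)).comp hsub)
    simpa using ((h2.sub h3).const_sub (a 0 - a 1)).const_mul (∑ r ∈ Finset.range N, (r : ℝ))

theorem antitone_sub_one_div_exp_add_one {t : ℝ} (ht : 0 < t) :
    Antitone fun m : ℕ ↦ 1 / (Real.exp (m * t) + 1) - 1 / (Real.exp ((m + 1 : ℕ) * t) + 1) := by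
  refine antitone_nat_of_succ_le fun m ↦ ?_
  have hY : 1 < Real.exp t := Real.one_lt_exp_iff.mpr ht
  have hX : 1 ≤ Real.exp (m * t) := Real.one_le_exp (by positivity)
  have e1 : Real.exp ((m + 1 : ℕ) * t) = Real.exp (m * t) * Real.exp t := by
    rw [← Real.exp_add]; push_cast; ring_nf
  have e2 : Real.exp ((m + 1 + 1 : ℕ) * t) = Real.exp (m * t) * Real.exp t ^ 2 := by
    rw [← Real.exp_nat_mul, ← Real.exp_add]; push_cast; ring_nf
  rw [e1, e2]
  generalize Real.exp (m * t) = X at *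
  generalize Real.exp t = Y at *
  have h1 : 0 ≤ X * Y - 1 := by nlinarith
  have key : 1 / (X + 1) - 1 / (X * Y + 1) - (1 / (X * Y + 1) - 1 / (X * Y ^ 2 + 1)) =
      X * (Y - 1) * ((Y - 1) * (X * Y - 1)) / ((X + 1) * (X * Y + 1) * (X * Y ^ 2 + 1)) := by
    have : X + 1 ≠ 0 := by positivity
    have : X * Y + 1 ≠ 0 := by positivity
    have : X * Y ^ 2 + 1 ≠ 0 := by positivity
    field_simp
    ring
  have h2 : 0 ≤ Y - 1 := by linarith
  have h3 : 0 ≤ X * (Y - 1) * ((Y - 1) * (X * Y - 1)) /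
      ((X + 1) * (X * Y + 1) * (X * Y ^ 2 + 1)) := by positivity
  linarith

theorem summable_exp_neg_nat_mul {t : ℝ} (ht : 0 < t) :
    Summable fun m : ℕ ↦ Real.exp (-(m * t)) := by
  have := Real.summable_exp_nat_mul_iff.mpr (neg_lt_zero.mpr ht)
  exact this.congr fun m ↦ by ring_nf

theorem summable_one_div_exp_add_one {t : ℝ} (ht : 0 < t) :
    Summable fun m : ℕ ↦ 1 / (Real.exp (m * t) + 1) := by
  refine .of_nonneg_of_le (fun m ↦ by positivity) (fun m ↦ ?_) (summable_exp_neg_nat_mul ht)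
  rw [Real.exp_neg, ← one_div]
  gcongr
  linarith

theorem tendsto_tsum_mul_one_div_exp_add_one {N : ℕ} (hN : 0 < N) {χ : ℕ → ℝ}
    (hper : Function.Periodic χ N) (hsum : ∑ r ∈ Finset.range N, χ r = 0) (hχ : ∀ n, |χ n| ≤ 1) :
    Tendsto (fun t : ℝ ↦ ∑' m : ℕ, χ m * (1 / (Real.exp (m * t) + 1))) (𝓝[>] 0)
      (𝓝 (-(∑ r ∈ Finset.range N, χ r * r) / (2 * N))) := by
  rw [tendsto_iff_dist_tendsto_zero]
  have hlim : Tendsto (fun t : ℝ ↦ (∑ r ∈ Finset.range N, (r : ℝ)) * (1 / 2 - 1 / (Real.exp t + 1)))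
      (𝓝[>] 0) (𝓝 0) := by
    have : ContinuousAt (fun t : ℝ ↦ (∑ r ∈ Finset.range N, (r : ℝ)) *
        (1 / 2 - 1 / (Real.exp t + 1))) 0 := by
      have : Real.exp 0 + 1 ≠ 0 := by positivity
      fun_prop (disch := assumption)
    have h := this.tendsto
    norm_num at h
    norm_num
    exact h.mono_left nhdsWithin_le_nhds
  refine squeeze_zero' (.of_forall fun _ ↦ dist_nonneg) ?_ hlim
  filter_upwards [self_mem_nhdsWithin] with t ht
  have h := abs_tsum_mul_add_le hN hper hsum hχ (antitone_sub_one_div_exp_add_one ht)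
    (summable_one_div_exp_add_one ht)
  norm_num at h
  rw [Real.dist_eq]
  norm_num
  convert h using 2
  rw [neg_div, sub_neg_eq_add]
  congr 1
  field_simp

/-- Lambert series. -/
theorem summable_and_tsum_sum_divisors_mul_exp {f : ℕ → ℝ} (hf : ∀ n, |f n| ≤ 1) {t : ℝ}
    (ht : 0 < t) :
    Summable (fun m : ℕ ↦ f m * (1 / (Real.exp (m * t) - 1))) ∧
    ∑' n : ℕ, (∑ m ∈ n.divisors, f m) * Real.exp (-(t * n)) =
      ∑' m : ℕ, f m * (1 / (Real.exp (m * t) - 1)) := by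
  have hr : ‖Real.exp (-t)‖ < 1 := by simpa using ht
  have hs : Summable fun c : ℕ+ × ℕ+ ↦ f c.1 * Real.exp (-t) ^ (c.1 * c.2 : ℕ) := by
    refine .of_norm_bounded (summable_prod_mul_pow 0 hr).norm fun c ↦ ?_
    rw [norm_mul, norm_mul]
    gcongr
    simpa using hf c.1
  have hgeom (m : ℕ+) : ∑' k : ℕ+, f m * Real.exp (-t) ^ (m * k : ℕ) =
      f m * (1 / (Real.exp ((m : ℕ) * t) - 1)) := by
    have hm : 0 < ((m : ℕ) : ℝ) * t := mul_pos (by exact_mod_cast m.pos) ht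
    have hlt : Real.exp (-(m * t)) < 1 := by simpa using hm
    have e (k : ℕ+) : Real.exp (-t) ^ (m * k : ℕ) = Real.exp (-(m * t)) ^ (k : ℕ) := by
      rw [pow_mul, ← Real.exp_nat_mul]
      ring_nf
    simp only [e, tsum_mul_left]
    rw [tsum_pnat_eq_tsum_succ (f := fun k ↦ Real.exp (-((m : ℕ) * t)) ^ k)]
    simp only [pow_succ', tsum_mul_left]
    rw [tsum_geometric_of_lt_one (Real.exp_pos _).le hlt]
    have h1 : 1 - Real.exp (-((m : ℕ) * t)) ≠ 0 := by linarith
    have h2 : Real.exp ((m : ℕ) * t) - 1 ≠ 0 := by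
      have := Real.add_one_le_exp ((m : ℕ) * t)
      linarith
    congr 1
    rw [Real.exp_neg] at h1 ⊢
    field_simp
  have hpos (g : ℕ → ℝ) (h0 : g 0 = 0) : Function.support g ⊆ Set.range PNat.val := by
    intro n hn
    exact ⟨⟨n, Nat.pos_of_ne_zero fun h ↦ hn (h ▸ h0)⟩, rfl⟩
  constructor
  · refine (PNat.coe_injective.summable_iff fun n hn ↦ ?_).mp (hs.prod.congr hgeom)
    by_contra h
    exact hn (hpos (fun m : ℕ ↦ f m * (1 / (Real.exp (m * t) - 1))) (by simp) h)
  · rw [← PNat.coe_injective.tsum_eq (hpos _ (by simp)),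
      ← PNat.coe_injective.tsum_eq
        (hpos (fun m : ℕ ↦ f m * (1 / (Real.exp (m * t) - 1))) (by simp)),
      ← tsum_congr hgeom, ← hs.tsum_prod, ← sigmaAntidiagonalEquivProd.tsum_eq]
    refine (tsum_congr fun n : ℕ+ ↦ ?_).trans
      (sigmaAntidiagonalEquivProd.summable_iff.mpr hs).tsum_sigma.symm
    simp only [Function.comp_apply]
    rw [tsum_fintype]
    have e (x : Nat.divisorsAntidiagonal n) : f (sigmaAntidiagonalEquivProd ⟨n, x⟩).1 *
        Real.exp (-t) ^ ((sigmaAntidiagonalEquivProd ⟨n, x⟩).1 *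
          (sigmaAntidiagonalEquivProd ⟨n, x⟩).2 : ℕ) = f x.1.1 * Real.exp (-(t * n)) := by
      have hx : ((sigmaAntidiagonalEquivProd ⟨n, x⟩).1 *
          (sigmaAntidiagonalEquivProd ⟨n, x⟩).2 : ℕ) = n := divisorsAntidiagonalFactors_eq x
      rw [hx, ← Real.exp_nat_mul]
      congr 2
      ring
    rw [Finset.sum_congr rfl fun x _ ↦ e x, Finset.univ_eq_attach,
      Finset.sum_attach _ (fun x : ℕ × ℕ ↦ f x.1 * Real.exp (-(t * n))),
      Nat.sum_divisorsAntidiagonal (fun x _ ↦ f x * Real.exp (-(t * n))), Finset.sum_mul]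

open HurwitzZeta Real in
theorem abs_cosKernel_sub_one_le (a : ℝ) {x : ℝ} (hx : 0 < x) :
    |cosKernel a x - 1| ≤ cosKernel 0 x - 1 := by
  have h0 := hasSum_int_cosKernel₀ 0 hx
  have ha := hasSum_int_cosKernel₀ a hx
  have h0' : HasSum (fun n : ℤ ↦ if n = 0 then (0 : ℝ) else rexp (-π * n ^ 2 * x))
      (cosKernel 0 x - 1) := by
    rw [← Complex.hasSum_ofReal]
    push_cast
    convert h0 using 2 with n
    · split_ifs <;> simp
    · rfl
  have := tsum_of_norm_bounded h0' (f := fun n : ℤ ↦ if n = 0 then (0 : ℂ) else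
    Complex.exp (2 * π * Complex.I * a * n) * rexp (-π * n ^ 2 * x)) fun n ↦ by
      split_ifs
      · simp
      · have : 2 * π * Complex.I * a * n = (2 * π * a * n : ℝ) * Complex.I := by push_cast; ring
        rw [norm_mul, this, Complex.norm_exp_ofReal_mul_I, one_mul, Complex.norm_real,
          norm_of_nonneg (exp_pos _).le]
  rw [ha.tsum_eq] at this
  exact_mod_cast this

open HurwitzZeta Real in
theorem abs_evenKernel_sub_le (a : ℝ) {s : ℝ} (hs : 0 < s) :
    |evenKernel a s - 1 / √s| ≤ 1 / √s * (cosKernel 0 (1 / s) - 1) := by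
  rw [evenKernel_functional_equation, ← sqrt_eq_rpow, ← mul_sub_one, abs_mul,
    abs_of_pos (by positivity)]
  gcongr
  exact abs_cosKernel_sub_one_le a (by positivity)

open HurwitzZeta Real in
theorem tendsto_cosKernel_inv_sub_one_div {l : ℝ} (hl : 0 < l) :
    Tendsto (fun t : ℝ ↦ (cosKernel 0 (1 / (l * t)) - 1) / t) (𝓝[>] 0) (𝓝 0) := by
  obtain ⟨p, hp, hO⟩ := isBigO_atTop_cosKernel_sub 0
  have h1 : Tendsto (fun x : ℝ ↦ x * rexp (-p * x)) atTop (𝓝 0) := by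
    simpa using tendsto_rpow_mul_exp_neg_mul_atTop_nhds_zero 1 p hp
  have h2 : Tendsto (fun x : ℝ ↦ x * (cosKernel 0 x - 1)) atTop (𝓝 0) :=
    ((Asymptotics.isBigO_refl _ _).mul hO).trans_tendsto h1
  have h3 : Tendsto (fun t : ℝ ↦ 1 / (l * t)) (𝓝[>] 0) atTop := by
    have := (tendsto_inv_nhdsGT_zero (𝕜 := ℝ)).const_mul_atTop (inv_pos.mpr hl)
    exact this.congr fun t ↦ by rw [one_div, mul_inv]
  have h4 := (h2.comp h3).const_mul l
  rw [mul_zero] at h4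
  refine h4.congr fun t ↦ ?_
  simp only [Function.comp]
  field_simp

open HurwitzZeta Real in
theorem hasSum_exp_neg_mul_add_sq {A : ℝ} (hA : 0 < A) (b : ℝ) {t : ℝ} (ht : 0 < t) :
    HasSum (fun y : ℤ ↦ rexp (-(t * (A * (y + b) ^ 2)))) (evenKernel b (A / π * t)) := by
  refine (hasSum_int_evenKernel b (show 0 < A / π * t by positivity)).congr_fun fun n ↦ ?_
  congr 1
  field_simp

open HurwitzZeta Real in
theorem abs_tsum_exp_neg_form_sub_le {A C : ℝ} (hA : 0 < A) (hC : 0 < C) (b : ℝ) {t : ℝ}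
    (ht : 0 < t) :
    (Summable fun x : ℤ × ℤ ↦ rexp (-(t * (A * (x.2 + b * x.1) ^ 2 + C * x.1 ^ 2)))) ∧
    |∑' x : ℤ × ℤ, rexp (-(t * (A * (x.2 + b * x.1) ^ 2 + C * x.1 ^ 2))) - π / √(A * C) / t| ≤
      π / √(A * C) / t * ((1 + (cosKernel 0 (1 / (A / π * t)) - 1)) *
        (1 + (cosKernel 0 (1 / (C / π * t)) - 1)) - 1) := by
  set a := A / π * t with ha
  set c := C / π * t with hc
  have ha0 : 0 < a := by positivity
  have hc0 : 0 < c := by positivity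
  set E := cosKernel 0 (1 / a) - 1 with hE
  set F := cosKernel 0 (1 / c) - 1 with hF
  have hE0 : 0 ≤ E := (abs_nonneg _).trans (abs_cosKernel_sub_one_le 0 (by positivity))
  have hF0 : 0 ≤ F := (abs_nonneg _).trans (abs_cosKernel_sub_one_le 0 (by positivity))
  have hin : ∀ x : ℤ, HasSum
      (fun y : ℤ ↦ rexp (-(t * (A * (y + b * x) ^ 2 + C * x ^ 2))))
      (evenKernel (b * x : ℝ) a * rexp (-(t * (C * x ^ 2)))) := fun x ↦ by
    refine ((hasSum_exp_neg_mul_add_sq hA (b * x) ht).mul_right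
      (rexp (-(t * (C * x ^ 2))))).congr_fun fun y ↦ ?_
    rw [← exp_add]
    ring_nf
  have hC1 : HasSum (fun x : ℤ ↦ rexp (-(t * (C * x ^ 2)))) (evenKernel (0 : ℝ) c) := by
    simpa using hasSum_exp_neg_mul_add_sq hC 0 ht
  have hK : ∀ x : ℤ, |evenKernel (b * x : ℝ) a - 1 / √a| ≤ 1 / √a * E :=
    fun x ↦ abs_evenKernel_sub_le _ ha0
  have hd : ∀ x : ℤ, ‖evenKernel (b * x : ℝ) a * rexp (-(t * (C * x ^ 2))) -
      1 / √a * rexp (-(t * (C * x ^ 2)))‖ ≤ 1 / √a * E * rexp (-(t * (C * x ^ 2))) := fun x ↦ by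
    rw [← sub_mul, norm_mul, norm_of_nonneg (exp_pos _).le]
    gcongr
    exact hK x
  have hs1 : Summable fun x : ℤ ↦ evenKernel (b * x : ℝ) a * rexp (-(t * (C * x ^ 2))) := by
    have := ((hC1.summable.mul_left (1 / √a * E)).of_norm_bounded hd).add
      (hC1.summable.mul_left (1 / √a))
    simpa using this
  have hsum : Summable fun x : ℤ × ℤ ↦ rexp (-(t * (A * (x.2 + b * x.1) ^ 2 + C * x.1 ^ 2))) := by
    refine (summable_prod_of_nonneg fun _ ↦ (exp_pos _).le).mpr ⟨fun x ↦ (hin x).summable, ?_⟩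
    exact hs1.congr fun x ↦ ((hin x).tsum_eq).symm
  refine ⟨hsum, ?_⟩
  rw [hsum.tsum_prod, tsum_congr fun x ↦ (hin x).tsum_eq]
  have h1 := tsum_of_norm_bounded (hC1.mul_left (1 / √a * E)) hd
  rw [(hs1.hasSum.sub (hC1.mul_left (1 / √a))).tsum_eq, norm_eq_abs] at h1
  have h2 := abs_evenKernel_sub_le 0 hc0
  rw [← hF] at h2
  have h3 : π / √(A * C) / t = 1 / √a * (1 / √c) := by
    rw [one_div_mul_one_div, ← sqrt_mul ha0.le, ha, hc,
      show A / π * t * (C / π * t) = (A * C) * (t / π) ^ 2 by ring,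
      sqrt_mul (show 0 ≤ A * C by positivity), sqrt_sq (by positivity)]
    field_simp
  rw [h3]
  have hp : 0 < 1 / √a := by positivity
  generalize 1 / √a = u at *
  generalize 1 / √c = v at *
  generalize evenKernel ((0 : ℝ) : UnitAddCircle) c = w at *
  rw [abs_le] at h1 h2 ⊢
  have h4 : u * E * w ≤ u * E * (v + v * F) := by gcongr; linarith
  have h5 : u * (w - v) ≤ u * (v * F) := by gcongr; exact h2.2
  have h6 : u * (-(v * F)) ≤ u * (w - v) := by gcongr; exact h2.1
  constructor <;> nlinarith

open HurwitzZeta Real in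
/-- The constant term, as `t → 0`, of the theta function of a positive definite binary quadratic
form vanishes; the main term is removed by forming `Θ(t) - 2 Θ(2 t)`. -/
theorem tendsto_tsum_exp_neg_form_sub {A C : ℝ} (hA : 0 < A) (hC : 0 < C) (b : ℝ) :
    Tendsto (fun t : ℝ ↦
      ∑' x : ℤ × ℤ, rexp (-(t * (A * (x.2 + b * x.1) ^ 2 + C * x.1 ^ 2))) -
      2 * ∑' x : ℤ × ℤ, rexp (-(2 * t * (A * (x.2 + b * x.1) ^ 2 + C * x.1 ^ 2))))
      (𝓝[>] 0) (𝓝 0) := by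
  set Θ : ℝ → ℝ := fun t ↦
    ∑' x : ℤ × ℤ, rexp (-(t * (A * (x.2 + b * x.1) ^ 2 + C * x.1 ^ 2))) with hΘ
  have key : Tendsto (fun t ↦ Θ t - π / √(A * C) / t) (𝓝[>] 0) (𝓝 0) := by
    refine squeeze_zero_norm' (a := fun t ↦ π / √(A * C) *
      ((cosKernel 0 (1 / (A / π * t)) - 1) / t + (cosKernel 0 (1 / (C / π * t)) - 1) / t +
        (cosKernel 0 (1 / (A / π * t)) - 1) / t * ((cosKernel 0 (1 / (C / π * t)) - 1) / t) * t))
      ?_ ?_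
    · filter_upwards [self_mem_nhdsWithin] with t ht
      refine (abs_tsum_exp_neg_form_sub_le hA hC b ht).2.trans (le_of_eq ?_)
      have ht' : t ≠ 0 := ne_of_gt ht
      field_simp
      ring
    · have h1 := tendsto_cosKernel_inv_sub_one_div (show 0 < A / π by positivity)
      have h2 := tendsto_cosKernel_inv_sub_one_div (show 0 < C / π by positivity)
      have h3 : Tendsto (fun t : ℝ ↦ t) (𝓝[>] 0) (𝓝 0) := tendsto_id.mono_left nhdsWithin_le_nhds
      simpa using ((h1.add h2).add ((h1.mul h2).mul h3)).const_mul (π / √(A * C))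
  have h2 : Tendsto (fun t : ℝ ↦ 2 * t) (𝓝[>] 0) (𝓝[>] 0) := by
    refine tendsto_nhdsWithin_iff.mpr ⟨?_, ?_⟩
    · have : Tendsto (fun t : ℝ ↦ 2 * t) (𝓝 0) (𝓝 (2 * 0)) := tendsto_id.const_mul 2
      rw [mul_zero] at this
      exact this.mono_left nhdsWithin_le_nhds
    · filter_upwards [self_mem_nhdsWithin] with t ht
      exact mul_pos two_pos (Set.mem_Ioi.mp ht)
  have h3 := key.sub ((key.comp h2).const_mul 2)
  simp only [mul_zero, sub_zero] at h3
  refine h3.congr' ?_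
  filter_upwards [self_mem_nhdsWithin] with t ht
  have ht' : t ≠ 0 := ne_of_gt ht
  have e : π / √(A * C) / t - 2 * (π / √(A * C) / (2 * t)) = 0 := by
    field_simp
    ring
  simp only [Function.comp, mul_sub]
  linarith

section IdealCount

theorem Ideal.sup_mul_sup_eq_of_sup_eq_top {R : Type*} [CommRing R] {A B L : Ideal R}
    (htop : A ⊔ B = ⊤) (hL : A * B ≤ L) : (L ⊔ A) * (L ⊔ B) = L := by
  apply le_antisymm
  · rw [Ideal.mul_sup, Ideal.sup_mul L A B]
    exact sup_le Ideal.mul_le_right (sup_le Ideal.mul_le_left hL)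
  · calc L = L * (A ⊔ B) := by rw [htop, Ideal.mul_top]
      _ ≤ _ := by
        rw [Ideal.mul_sup]
        refine sup_le ?_ (Ideal.mul_mono le_sup_left le_sup_right)
        rw [mul_comm]
        exact Ideal.mul_mono le_sup_right le_sup_left

theorem Ideal.mul_sup_eq_of_sup_eq_top {R : Type*} [CommRing R] {A B I J : Ideal R}
    (htop : A ⊔ B = ⊤) (hA : A ≤ I) (hB : B ≤ J) : I * J ⊔ A = I := by
  refine le_antisymm (sup_le Ideal.mul_le_left hA) ?_
  calc I = I * (A ⊔ B) := by rw [htop, Ideal.mul_top]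
    _ ≤ _ := by
      rw [Ideal.mul_sup]
      exact sup_le (Ideal.mul_le_right.trans le_sup_right)
        ((Ideal.mul_mono_right hB).trans le_sup_left)

theorem Ideal.span_natCast_sup_span_natCast {R : Type*} [CommRing R] {m n : ℕ}
    (h : m.Coprime n) : Ideal.span {(m : R)} ⊔ Ideal.span {(n : R)} = ⊤ := by
  rw [← Ideal.isCoprime_iff_sup_eq, Ideal.isCoprime_span_singleton_iff]
  simpa using (Nat.isCoprime_iff_coprime.mpr h).map (Int.castRingHom R)

variable {R : Type*} [CommRing R] [IsDedekindDomain R] [Module.Free ℤ R]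

theorem Ideal.span_natCast_le_of_absNorm_eq {I : Ideal R} {n : ℕ} (h : Ideal.absNorm I = n) :
    Ideal.span {(n : R)} ≤ I :=
  h ▸ Ideal.span_singleton_absNorm_le I

theorem Ideal.coprime_absNorm_of_span_natCast_le [Module.Finite ℤ R] {I : Ideal R} {m n : ℕ}
    (h : m.Coprime n) (hI : Ideal.span {(m : R)} ≤ I) : (Ideal.absNorm I).Coprime n := by
  have := Ideal.absNorm_dvd_absNorm_of_le hI
  rw [Ideal.absNorm_span_natCast] at this
  exact (h.pow_left _).coprime_dvd_left this

/-- Ideals of norm `m * n`, for coprime `m` and `n`, factor uniquely. -/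
theorem Ideal.card_absNorm_eq_mul [Module.Finite ℤ R] {m n : ℕ} (h : m.Coprime n) :
    Nat.card {I : Ideal R // Ideal.absNorm I = m * n} =
      Nat.card {I : Ideal R // Ideal.absNorm I = m} *
        Nat.card {I : Ideal R // Ideal.absNorm I = n} := by
  have htop := Ideal.span_natCast_sup_span_natCast (R := R) h
  rw [← Nat.card_prod]
  let f : {I : Ideal R // Ideal.absNorm I = m} × {I : Ideal R // Ideal.absNorm I = n} →
      {I : Ideal R // Ideal.absNorm I = m * n} :=
    fun x ↦ ⟨x.1.1 * x.2.1, by rw [map_mul, x.1.2, x.2.2]⟩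
  refine (Nat.card_congr (Equiv.ofBijective f ⟨?_, ?_⟩)).symm
  · rintro ⟨⟨I, hI⟩, ⟨J, hJ⟩⟩ ⟨⟨I', hI'⟩, ⟨J', hJ'⟩⟩ h
    have h : I * J = I' * J' := congrArg Subtype.val h
    have h1 := Ideal.mul_sup_eq_of_sup_eq_top htop (Ideal.span_natCast_le_of_absNorm_eq hI)
      (Ideal.span_natCast_le_of_absNorm_eq hJ)
    rw [h, Ideal.mul_sup_eq_of_sup_eq_top htop (Ideal.span_natCast_le_of_absNorm_eq hI')
      (Ideal.span_natCast_le_of_absNorm_eq hJ')] at h1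
    rw [sup_comm] at htop
    have h2 := Ideal.mul_sup_eq_of_sup_eq_top htop (Ideal.span_natCast_le_of_absNorm_eq hJ)
      (Ideal.span_natCast_le_of_absNorm_eq hI)
    rw [mul_comm, h, mul_comm, Ideal.mul_sup_eq_of_sup_eq_top htop
      (Ideal.span_natCast_le_of_absNorm_eq hJ') (Ideal.span_natCast_le_of_absNorm_eq hI')] at h2
    subst h1 h2
    rfl
  · rintro ⟨L, hL⟩
    have hle : Ideal.span {(m : R)} * Ideal.span {(n : R)} ≤ L := by
      rw [Ideal.span_singleton_mul_span_singleton, ← Nat.cast_mul]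
      exact Ideal.span_natCast_le_of_absNorm_eq hL
    have h1 := Ideal.sup_mul_sup_eq_of_sup_eq_top htop hle
    set I := L ⊔ Ideal.span {(m : R)}
    set J := L ⊔ Ideal.span {(n : R)}
    have hN : Ideal.absNorm I * Ideal.absNorm J = m * n := by rw [← map_mul, h1, hL]
    have hI : Ideal.absNorm I ∣ m :=
      (Ideal.coprime_absNorm_of_span_natCast_le h (le_sup_right (a := L))).dvd_of_dvd_mul_right
        ⟨_, hN.symm⟩
    have hJ : Ideal.absNorm J ∣ n :=
      (Ideal.coprime_absNorm_of_span_natCast_le h.symm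
        (le_sup_right (a := L))).dvd_of_dvd_mul_left ⟨Ideal.absNorm I, by rw [← hN, mul_comm]⟩
    have hI' : m ∣ Ideal.absNorm I :=
      (h.coprime_dvd_right hJ).dvd_of_dvd_mul_right ⟨n, hN⟩
    have hJ' : n ∣ Ideal.absNorm J :=
      (h.symm.coprime_dvd_right hI).dvd_of_dvd_mul_left ⟨m, by rw [hN, mul_comm]⟩
    exact ⟨⟨⟨I, hI.antisymm hI'⟩, ⟨J, hJ.antisymm hJ'⟩⟩, Subtype.ext h1⟩

theorem Ideal.card_absNorm_eq_prime {p : ℕ} (hp : p.Prime) :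
    Nat.card {I : Ideal R // Ideal.absNorm I = p} = Nat.card (R →+* ZMod p) := by
  let f : (R →+* ZMod p) → {I : Ideal R // Ideal.absNorm I = p} := fun φ ↦ ⟨RingHom.ker φ, by
    rw [Ideal.absNorm_apply, Submodule.cardQuot_apply,
      Nat.card_congr (RingHom.quotientKerEquivOfSurjective (ZMod.ringHom_surjective φ)).toEquiv,
      Nat.card_zmod]⟩
  refine (Nat.card_congr (Equiv.ofBijective f ⟨fun φ ψ h ↦ ?_, fun ⟨I, hI⟩ ↦ ?_⟩)).symm
  · have h : RingHom.ker φ = RingHom.ker ψ := congrArg Subtype.val h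
    ext x
    obtain ⟨n, hn⟩ := ZMod.intCast_surjective (φ x)
    have h1 : x - n ∈ RingHom.ker φ := by rw [RingHom.mem_ker, map_sub, map_intCast, hn, sub_self]
    rw [h, RingHom.mem_ker, map_sub, map_intCast, hn, sub_eq_zero] at h1
    exact h1.symm
  · rw [Ideal.absNorm_apply, Submodule.cardQuot_apply] at hI
    have : Finite (R ⧸ I) := Nat.finite_of_card_ne_zero (by rw [hI]; exact hp.ne_zero)
    have : Fintype (R ⧸ I) := Fintype.ofFinite _
    rw [Nat.card_eq_fintype_card] at hI
    let e := ZMod.ringEquivOfPrime (R ⧸ I) hp hI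
    refine ⟨(e.symm : R ⧸ I →+* ZMod p).comp (Ideal.Quotient.mk I), Subtype.ext ?_⟩
    change RingHom.ker _ = I
    exact (RingHom.ker_equiv_comp _ e.symm).trans Ideal.mk_ker

theorem Ideal.mem_closure_of_absNorm_eq_prime_pow {p k : ℕ} (hp : p.Prime) {S : Set (Ideal R)}
    (hS : ∀ M : Ideal R, Prime M → M ∣ Ideal.span {(p : R)} → M ∈ S) {I : Ideal R}
    (hI : Ideal.absNorm I = p ^ k) : I ∈ Submonoid.closure S := by
  have hI0 : I ≠ ⊥ := fun h ↦ by
    rw [h, Ideal.absNorm_bot] at hI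
    exact pow_ne_zero k hp.ne_zero hI.symm
  rw [← Ideal.prod_normalizedFactors_eq_self hI0]
  refine Submonoid.multiset_prod_mem _ _ fun M hM ↦ Submonoid.subset_closure ?_
  have hMp := UniqueFactorizationMonoid.prime_of_normalized_factor M hM
  refine hS M hMp (hMp.dvd_of_dvd_pow (n := k) ?_)
  refine (UniqueFactorizationMonoid.dvd_of_mem_normalizedFactors hM).trans ?_
  rw [Ideal.span_singleton_pow, Ideal.dvd_iff_le, ← Nat.cast_pow]
  exact Ideal.span_natCast_le_of_absNorm_eq hI

theorem Ideal.eq_of_prime_of_dvd_of_absNorm_prime {p : ℕ} (hp : p.Prime) {M P : Ideal R}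
    (hM : Prime M) (hP : Ideal.absNorm P = p) (h : M ∣ P) : M = P := by
  have := Ideal.irreducible_of_irreducible_absNorm (I := P) (by rw [hP]; exact hp)
  exact associated_iff_eq.mp ((hM.irreducible.dvd_irreducible_iff_associated this).mp h)

variable [Module.Finite ℤ R]

theorem Ideal.card_absNorm_eq_prime_pow_trichotomy (h2 : Module.finrank ℤ R = 2) {p : ℕ}
    (hp : p.Prime) :
    (∀ k, Nat.card {I : Ideal R // Ideal.absNorm I = p ^ k} = k + 1) ∨
    (∀ k, Nat.card {I : Ideal R // Ideal.absNorm I = p ^ k} = 1) ∨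
    (∀ k, Nat.card {I : Ideal R // Ideal.absNorm I = p ^ k} = if Even k then 1 else 0) := by
  have hpN : Ideal.absNorm (Ideal.span {(p : R)}) = p ^ 2 := by
    rw [Ideal.absNorm_span_natCast, h2]
  by_cases hex : ∃ P : Ideal R, Ideal.absNorm P = p
  · obtain ⟨P, hP⟩ := hex
    have hPp : Prime P := UniqueFactorizationMonoid.irreducible_iff_prime.mp
      (Ideal.irreducible_of_irreducible_absNorm (by rw [hP]; exact hp))
    obtain ⟨Q, hPQ⟩ := Ideal.dvd_iff_le.mpr (Ideal.span_natCast_le_of_absNorm_eq hP)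
    have hQ : Ideal.absNorm Q = p := by
      rw [hPQ, map_mul, hP, pow_two] at hpN
      exact Nat.eq_of_mul_eq_mul_left hp.pos hpN
    have hQp : Prime Q := UniqueFactorizationMonoid.irreducible_iff_prime.mp
      (Ideal.irreducible_of_irreducible_absNorm (by rw [hQ]; exact hp))
    have hcl : ∀ {k : ℕ} {I : Ideal R}, Ideal.absNorm I = p ^ k → I ∈ Submonoid.closure {P, Q} :=
      Ideal.mem_closure_of_absNorm_eq_prime_pow hp fun M hM hMd ↦ by
        rw [hPQ] at hMd
        exact (hM.dvd_or_dvd hMd).imp (Ideal.eq_of_prime_of_dvd_of_absNorm_prime hp hM hP)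
          (Ideal.eq_of_prime_of_dvd_of_absNorm_prime hp hM hQ)
    have hpow : ∀ {k : ℕ} {I : Ideal R}, Ideal.absNorm I = p ^ k →
        ∃ i ≤ k, I = P ^ i * Q ^ (k - i) := fun {k I} hI ↦ by
      obtain ⟨i, j, rfl⟩ := (Submonoid.mem_closure_pair _ _ _).mp (hcl hI)
      rw [map_mul, map_pow, map_pow, hP, hQ, ← pow_add] at hI
      obtain rfl := Nat.pow_right_injective hp.two_le hI
      exact ⟨i, by lia, by rw [Nat.add_sub_cancel_left]⟩
    have hnorm : ∀ {k i : ℕ}, i ≤ k → Ideal.absNorm (P ^ i * Q ^ (k - i)) = p ^ k := fun hi ↦ by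
      rw [map_mul, map_pow, map_pow, hP, hQ, ← pow_add, Nat.add_sub_cancel' hi]
    by_cases hne : P = Q
    · refine Or.inr (Or.inl fun k ↦ ?_)
      subst hne
      rw [Nat.card_eq_one_iff_unique]
      refine ⟨⟨fun ⟨I, hI⟩ ⟨J, hJ⟩ ↦ Subtype.ext ?_⟩, ⟨⟨_, hnorm le_rfl⟩⟩⟩
      obtain ⟨i, hi, hi'⟩ := hpow hI
      obtain ⟨j, hj, hj'⟩ := hpow hJ
      change I = J
      rw [hi', hj', ← pow_add, ← pow_add, Nat.add_sub_cancel' hi, Nat.add_sub_cancel' hj]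
    · refine Or.inl fun k ↦ ?_
      let f : Fin (k + 1) → {I : Ideal R // Ideal.absNorm I = p ^ k} :=
        fun i ↦ ⟨P ^ (i : ℕ) * Q ^ (k - i), hnorm (by lia)⟩
      have key : ∀ i j : ℕ, i ≤ k → j ≤ k →
          P ^ i * Q ^ (k - i) = P ^ j * Q ^ (k - j) → ¬ i < j := by
        intro i j hi hj h hij
        obtain ⟨c, rfl⟩ := Nat.exists_eq_add_of_lt hij
        rw [add_assoc, pow_add, mul_assoc] at h
        have h3 := mul_left_cancel₀ (pow_ne_zero i hPp.ne_zero) h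
        have h4 : P ∣ Q ^ (k - i) := by
          rw [h3]
          exact (dvd_pow_self P (Nat.succ_ne_zero c)).mul_right _
        exact hne (Ideal.eq_of_prime_of_dvd_of_absNorm_prime hp hPp hQ (hPp.dvd_of_dvd_pow h4))
      rw [← Nat.card_congr (Equiv.ofBijective f ⟨fun i j h ↦ ?_, fun ⟨I, hI⟩ ↦ ?_⟩), Nat.card_fin]
      · have h : P ^ (i : ℕ) * Q ^ (k - i) = P ^ (j : ℕ) * Q ^ (k - j) := congrArg Subtype.val h
        have h5 := key i j (by lia) (by lia) h
        have h6 := key j i (by lia) (by lia) h.symm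
        exact Fin.ext (by lia)
      · obtain ⟨i, hi, rfl⟩ := hpow hI
        exact ⟨⟨i, by lia⟩, rfl⟩
  · refine Or.inr (Or.inr fun k ↦ ?_)
    have hcl : ∀ {k : ℕ} {I : Ideal R}, Ideal.absNorm I = p ^ k →
        I ∈ Submonoid.closure {Ideal.span {(p : R)}} :=
      Ideal.mem_closure_of_absNorm_eq_prime_pow hp fun M hM hMd ↦ by
        have h1 : Ideal.absNorm M ∣ p ^ 2 := hpN ▸ map_dvd Ideal.absNorm hMd
        obtain ⟨X, hX⟩ := hMd
        obtain ⟨i, hi, hMi⟩ := (Nat.dvd_prime_pow hp).mp h1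
        have hMX : Ideal.absNorm M * Ideal.absNorm X = p ^ 2 := by rw [← map_mul, ← hX, hpN]
        interval_cases i
        · rw [pow_zero, Ideal.absNorm_eq_one_iff] at hMi
          exact absurd (Ideal.isUnit_iff.mpr hMi) hM.not_isUnit
        · exact absurd ⟨M, by rw [hMi, pow_one]⟩ hex
        · rw [hMi] at hMX
          have hX1 : Ideal.absNorm X = 1 :=
            Nat.eq_of_mul_eq_mul_left (pow_pos hp.pos 2) (by rw [hMX, mul_one])
          rw [Ideal.absNorm_eq_one_iff] at hX1
          rw [hX1, Ideal.mul_top] at hX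
          exact hX.symm
    have hpow : ∀ {k : ℕ} {I : Ideal R}, Ideal.absNorm I = p ^ k →
        ∃ i, 2 * i = k ∧ I = Ideal.span {(p : R)} ^ i := fun {k I} hI ↦ by
      obtain ⟨i, rfl⟩ := Submonoid.mem_closure_singleton.mp (hcl hI)
      rw [map_pow, hpN, ← pow_mul] at hI
      exact ⟨i, Nat.pow_right_injective hp.two_le hI, rfl⟩
    split_ifs with hk
    · obtain ⟨c, rfl⟩ := hk.exists_two_nsmul
      rw [Nat.card_eq_one_iff_unique]
      refine ⟨⟨fun ⟨I, hI⟩ ⟨J, hJ⟩ ↦ Subtype.ext ?_⟩, ⟨⟨Ideal.span {(p : R)} ^ c, ?_⟩⟩⟩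
      · obtain ⟨i, hi, hi'⟩ := hpow hI
        obtain ⟨j, hj, hj'⟩ := hpow hJ
        change I = J
        rw [hi', hj', show i = j by lia]
      · rw [map_pow, hpN, ← pow_mul, smul_eq_mul]
    · rw [Nat.card_eq_zero]
      left
      refine ⟨fun ⟨I, hI⟩ ↦ hk ?_⟩
      obtain ⟨i, hi, -⟩ := hpow hI
      exact ⟨i, by lia⟩

theorem Ideal.card_absNorm_eq_prime_pow_s8 (h2 : Module.finrank ℤ R = 2) {p : ℕ} (hp : p.Prime)
    (k : ℕ) : (Nat.card {I : Ideal R // Ideal.absNorm I = p ^ k} : ℤ) =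
      ∑ j ∈ Finset.range (k + 1), ((Nat.card (R →+* ZMod p) : ℤ) - 1) ^ j := by
  rw [← Ideal.card_absNorm_eq_prime hp]
  rcases Ideal.card_absNorm_eq_prime_pow_trichotomy h2 hp with h | h | h
  all_goals
    have h1 := h 1
    rw [pow_one] at h1
    rw [h, h1]
  · simp
  · simp [Finset.sum_range_succ']
  · rcases Nat.even_or_odd k with hk | hk <;>
      simp [neg_one_geom_sum, Nat.even_add_one, hk, Nat.not_even_iff_odd]

end IdealCount

section KroneckerSymbol

variable {d : ℤ}

theorem kroneckerSym_of_odd (d : ℤ) {n : ℕ} (hn : Odd n) : kroneckerSym d n = jacobiSym d n := by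
  have : n.factorization 2 = 0 :=
    Nat.factorization_eq_zero_of_not_dvd fun h ↦
      (Nat.not_even_iff_odd.mpr hn) (even_iff_two_dvd.mpr h)
  simp [kroneckerSym, this]

theorem kroneckerSym_two (d : ℤ) :
    kroneckerSym d 2 = if d % 2 = 0 then 0 else if d % 8 = 1 ∨ d % 8 = 7 then 1 else -1 := by
  simp [kroneckerSym, Nat.prime_two.factorization_self]

theorem kroneckerSym_mul (d : ℤ) {m n : ℕ} (hm : m ≠ 0) (hn : n ≠ 0) :
    kroneckerSym d (m * n) = kroneckerSym d m * kroneckerSym d n := by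
  have h : m * n / 2 ^ (m * n).factorization 2 =
      (m / 2 ^ m.factorization 2) * (n / 2 ^ n.factorization 2) := Nat.ordCompl_mul m n 2
  rw [kroneckerSym, h, jacobiSym.mul_right' d (Nat.ordCompl_pos 2 hm).ne'
    (Nat.ordCompl_pos 2 hn).ne', Nat.factorization_mul hm hn, Finsupp.add_apply, pow_add,
    kroneckerSym, kroneckerSym]
  ring

theorem kroneckerSym_one (d : ℤ) : kroneckerSym d 1 = 1 := by
  simp [kroneckerSym]

theorem kroneckerSym_pow (d : ℤ) {m : ℕ} (hm : m ≠ 0) (k : ℕ) :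
    kroneckerSym d (m ^ k) = kroneckerSym d m ^ k := by
  induction k with
  | zero => simp [kroneckerSym_one]
  | succ k ih => rw [pow_succ, kroneckerSym_mul d (pow_ne_zero k hm) hm, ih, pow_succ]

theorem sum_divisors_kroneckerSym_mul (d : ℤ) {m n : ℕ} (h : m.Coprime n) :
    ∑ k ∈ (m * n).divisors, kroneckerSym d k =
      (∑ k ∈ m.divisors, kroneckerSym d k) * ∑ k ∈ n.divisors, kroneckerSym d k := by
  let f : ArithmeticFunction ℤ := ⟨fun n ↦ if n = 0 then 0 else kroneckerSym d n, by simp⟩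
  have hf : f.IsMultiplicative := by
    refine ArithmeticFunction.IsMultiplicative.iff_ne_zero.mpr
      ⟨by simp [f, kroneckerSym_one], fun hm hn _ ↦ ?_⟩
    simp [f, hm, hn, kroneckerSym_mul d hm hn]
  have key (n : ℕ) : (f * ArithmeticFunction.zeta) n = ∑ k ∈ n.divisors, kroneckerSym d k := by
    rw [ArithmeticFunction.coe_mul_zeta_apply]
    refine Finset.sum_congr rfl fun k hk ↦ ?_
    simp [f, (Nat.pos_of_mem_divisors hk).ne']
  rw [← key, ← key, ← key]
  exact (hf.mul ArithmeticFunction.isMultiplicative_zeta.natCast).map_mul_of_coprime h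

theorem abs_kroneckerSym_le_one (d : ℤ) (n : ℕ) : |kroneckerSym d n| ≤ 1 := by
  rw [kroneckerSym, abs_mul, abs_pow]
  refine mul_le_one₀ (pow_le_one₀ (abs_nonneg _) (by split_ifs <;> simp)) (abs_nonneg _) ?_
  rcases jacobiSym.trichotomy d (n / 2 ^ n.factorization 2) with h | h | h <;> simp [h]

theorem kroneckerSym_of_even (hd : d % 2 = 0) {n : ℕ} (hn : Even n) (h0 : n ≠ 0) :
    kroneckerSym d n = 0 := by
  have : n.factorization 2 ≠ 0 :=
    (Nat.prime_two.factorization_pos_of_dvd h0 (even_iff_two_dvd.mp hn)).ne'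
  simp [kroneckerSym, hd, this]

/-- The Kronecker symbol of a negative odd discriminant as a Jacobi symbol. -/
theorem kroneckerSym_eq_jacobiSym_natAbs (hd : d % 4 = 1) (hneg : d < 0) {n : ℕ} (hn : n ≠ 0) :
    kroneckerSym d n = jacobiSym n d.natAbs := by
  obtain ⟨N, rfl⟩ : ∃ N : ℕ, d = -N := ⟨d.natAbs, by lia⟩
  have hN : N % 4 = 3 := by lia
  have hNodd : Odd N := Nat.odd_iff.mpr (by lia)
  have h2 : (if (-N : ℤ) % 2 = 0 then 0 else if (-N : ℤ) % 8 = 1 ∨ (-N : ℤ) % 8 = 7 then 1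
      else -1 : ℤ) = jacobiSym 2 N := by
    rw [jacobiSym.at_two hNodd, ZMod.χ₈_nat_eq_if_mod_eight]
    split_ifs <;> lia
  have hodd {m : ℕ} (hm : Odd m) : jacobiSym (-N) m = jacobiSym m N := by
    rw [jacobiSym.neg _ hm]
    have hm2 := Nat.odd_iff.mp hm
    rcases (by lia : m % 4 = 1 ∨ m % 4 = 3) with h | h
    · rw [ZMod.χ₄_nat_one_mod_four h, one_mul, jacobiSym.quadratic_reciprocity_one_mod_four h hNodd]
    · rw [ZMod.χ₄_nat_three_mod_four h, jacobiSym.quadratic_reciprocity_three_mod_four hN h]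
      ring
  have hm : Odd (n / 2 ^ n.factorization 2) :=
    Nat.not_even_iff_odd.mp fun h ↦ Nat.not_dvd_ordCompl Nat.prime_two hn (even_iff_two_dvd.mp h)
  rw [kroneckerSym, h2, hodd hm, ← jacobiSym.pow_left, ← jacobiSym.mul_left, Int.natAbs_neg,
    Int.natAbs_natCast]
  congr 1
  exact_mod_cast Nat.ordProj_mul_ordCompl_eq_self n 2

theorem kroneckerSym_add_natAbs (hd : d % 4 = 0 ∨ d % 4 = 1) (hneg : d < 0) {n : ℕ} (hn : n ≠ 0) :
    kroneckerSym d (n + d.natAbs) = kroneckerSym d n := by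
  rcases hd with hd | hd
  · rcases Nat.even_or_odd n with h | h
    · rw [kroneckerSym_of_even (by lia) h hn,
        kroneckerSym_of_even (by lia) (h.add (Nat.even_iff.mpr (by lia))) (by lia)]
    · have h' : Odd (n + d.natAbs) := h.add_even (Nat.even_iff.mpr (by lia))
      have h4 : 4 * (d / 4).natAbs = d.natAbs := by lia
      rw [kroneckerSym_of_odd d h, kroneckerSym_of_odd d h',
        ← jacobiSym.div_four_left hd (Nat.odd_iff.mp h),
        ← jacobiSym.div_four_left hd (Nat.odd_iff.mp h'), jacobiSym.mod_right _ h',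
        jacobiSym.mod_right _ h, h4, Nat.add_mod_right]
  · rw [kroneckerSym_eq_jacobiSym_natAbs hd hneg hn,
      kroneckerSym_eq_jacobiSym_natAbs hd hneg (by lia)]
    exact jacobiSym.mod_left' (by rw [Nat.cast_add, Int.add_emod_right])

theorem kroneckerSym_natAbs (hd : d % 4 = 0 ∨ d % 4 = 1) (hneg : d < 0) :
    kroneckerSym d d.natAbs = 0 := by
  rcases hd with hd | hd
  · exact kroneckerSym_of_even (by lia) (Nat.even_iff.mpr (by lia)) (by lia)
  · rw [kroneckerSym_eq_jacobiSym_natAbs hd hneg (by lia), jacobiSym.mod_left, Int.emod_self,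
      jacobiSym.zero_left (by lia)]

theorem kroneckerSym_natAbs_sub_one (hd : d % 4 = 0 ∨ d % 4 = 1) (hneg : d < 0) :
    kroneckerSym d (d.natAbs - 1) = -1 := by
  rcases hd with hd | hd
  · have h : Odd (d.natAbs - 1) := Nat.odd_iff.mpr (by lia)
    have h1 : jacobiSym d (d.natAbs - 1) = jacobiSym (-1) (d.natAbs - 1) := by
      refine jacobiSym.mod_left' ?_
      rw [← Int.ModEq, Int.modEq_iff_dvd]
      exact ⟨1, by lia⟩
    rw [kroneckerSym_of_odd d h, h1, jacobiSym.at_neg_one h, ZMod.χ₄_nat_three_mod_four (by lia)]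
  · have h1 : jacobiSym (d.natAbs - 1 : ℕ) d.natAbs = jacobiSym (-1) d.natAbs := by
      refine jacobiSym.mod_left' ?_
      rw [← Int.ModEq, Int.modEq_iff_dvd]
      exact ⟨-1, by lia⟩
    rw [kroneckerSym_eq_jacobiSym_natAbs hd hneg (by lia), h1,
      jacobiSym.at_neg_one (Nat.odd_iff.mpr (by lia)), ZMod.χ₄_nat_three_mod_four (by lia)]

theorem kroneckerSym_natAbs_sub (hd : d % 4 = 0 ∨ d % 4 = 1) (hneg : d < 0) {r : ℕ} (h0 : 0 < r)
    (hr : r < d.natAbs) : kroneckerSym d (d.natAbs - r) = -kroneckerSym d r := by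
  have hadd (n k : ℕ) (hn : n ≠ 0) : kroneckerSym d (n + k * d.natAbs) = kroneckerSym d n := by
    induction k with
    | zero => simp
    | succ k ih => rw [add_mul, one_mul, ← add_assoc, kroneckerSym_add_natAbs hd hneg (by lia), ih]
  rw [← hadd _ (r - 1) (by lia), ← neg_one_mul, ← kroneckerSym_natAbs_sub_one hd hneg,
    ← kroneckerSym_mul d (by lia) h0.ne']
  congr 1
  obtain ⟨s, rfl⟩ := Nat.exists_eq_add_of_lt h0
  obtain ⟨t, ht⟩ := Nat.exists_eq_add_of_lt hr
  rw [ht]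
  have e1 : 0 + s + 1 + t + 1 - (0 + s + 1) = t + 1 := by lia
  have e2 : 0 + s + 1 + t + 1 - 1 = s + t + 1 := by lia
  have e3 : 0 + s + 1 - 1 = s := by lia
  rw [e1, e2, e3]
  ring

theorem sum_kroneckerSym_eq_zero (hd : d % 4 = 0 ∨ d % 4 = 1) (hneg : d < 0) :
    ∑ r ∈ Finset.range d.natAbs, kroneckerSym d (r + d.natAbs) = 0 := by
  obtain ⟨N, hN⟩ : ∃ N, d.natAbs = N + 1 := Nat.exists_eq_succ_of_ne_zero (by lia)
  rw [hN, Finset.sum_range_succ', ← hN, zero_add, kroneckerSym_natAbs hd hneg, add_zero]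
  have h1 : ∑ r ∈ Finset.range N, kroneckerSym d (r + 1 + d.natAbs) =
      ∑ r ∈ Finset.range N, kroneckerSym d (r + 1) :=
    Finset.sum_congr rfl fun r _ ↦ kroneckerSym_add_natAbs hd hneg (by lia)
  have h2 : ∑ r ∈ Finset.range N, kroneckerSym d (r + 1) =
      -∑ r ∈ Finset.range N, kroneckerSym d (r + 1) := by
    conv_lhs => rw [← Finset.sum_range_reflect]
    rw [← Finset.sum_neg_distrib]
    refine Finset.sum_congr rfl fun r hr ↦ ?_
    have hr' := Finset.mem_range.mp hr
    rw [← kroneckerSym_natAbs_sub hd hneg (by lia) (by lia)]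
    congr 1
    lia
  lia

/-- The number of roots of a quadratic polynomial over a finite prime field of odd
characteristic. -/
theorem ZMod.card_quadratic_roots {p : ℕ} [Fact p.Prime] (hp : p ≠ 2) (a b : ℤ) :
    (Nat.card {x : ZMod p // x * x = a • 1 + b • x} : ℤ) =
      jacobiSym (4 * a + b ^ 2) p + 1 := by
  have h2 : (2 : ZMod p) ≠ 0 := by
    have : Fact (2 < p) := ⟨lt_of_le_of_ne (Fact.out : p.Prime).two_le (Ne.symm hp)⟩
    exact ZMod.neg_one_ne_one.symm ∘ fun h ↦ by linear_combination h
  rw [← jacobiSym.legendreSym.to_jacobiSym, ← legendreSym.card_sqrts p hp,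
    ← Nat.card_eq_card_toFinset]
  norm_cast
  refine Nat.card_congr (Equiv.subtypeEquiv
    ((Equiv.mulLeft₀ 2 h2).trans (Equiv.subRight (b : ZMod p))) fun x ↦ ?_)
  have hx : Equiv.mulLeft₀ (2 : ZMod p) h2 x = 2 * x := rfl
  simp only [Equiv.trans_apply, hx, Equiv.subRight_apply, Set.mem_ofPred_eq, zsmul_eq_mul,
    mul_one]
  push_cast
  constructor
  · intro h
    linear_combination 4 * h
  · intro h
    apply mul_left_cancel₀ (mul_ne_zero h2 h2)
    linear_combination h

theorem ZMod.card_quadratic_roots_two (a b : ℤ) (hb : b = 0 ∨ b = 1) :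
    (Nat.card {x : ZMod 2 // x * x = a • 1 + b • x} : ℤ) =
      kroneckerSym (4 * a + b ^ 2) 2 + 1 := by
  have key : ∀ u v : ZMod 2, Fintype.card {x : ZMod 2 // x * x = u + v * x} =
    if v = 0 then 1 else if u = 0 then 2 else 0 := by decide
  simp only [zsmul_eq_mul, mul_one]
  rw [Nat.card_eq_fintype_card, key, kroneckerSym_two]
  rcases hb with rfl | rfl
  · have : (4 * a + 0 ^ 2) % 2 = 0 := by lia
    rw [if_pos this]
    simp
  · have h1 : (4 * a + 1 ^ 2) % 2 = 1 := by lia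
    have h2 : ((a : ℤ) : ZMod 2) = 0 ↔ ((4 * a + 1 ^ 2) % 8 = 1 ∨ (4 * a + 1 ^ 2) % 8 = 7) := by
      rw [ZMod.intCast_zmod_eq_zero_iff_dvd]
      lia
    simp only [h2, h1]
    split_ifs <;> simp_all

end KroneckerSymbol

section ImaginaryQuadratic

variable {K : Type*} [Field K] [NumberField K] {d : ℤ} {α : K}

theorem exists_algEquiv_quadraticAlgebra (hneg : d < 0) (hα : α ^ 2 = (d : K))
    (hdeg : Module.finrank ℚ K = 2) :
    ∃ e : QuadraticAlgebra ℚ (d : ℚ) 0 ≃ₐ[ℚ] K, ∀ z, e z = z.re + z.im * α := by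
  set f : QuadraticAlgebra ℚ (d : ℚ) 0 →ₐ[ℚ] K := QuadraticAlgebra.lift ⟨α, by
    rw [← pow_two, hα, Algebra.smul_def, Algebra.smul_def]; simp⟩ with hf
  have hfz : ∀ z, f z = z.re + z.im * α := fun z ↦ by
    simp [hf, QuadraticAlgebra.lift, Algebra.smul_def]
  have hinj : Function.Injective f := by
    rw [injective_iff_map_eq_zero]
    intro z hz
    rw [hfz] at hz
    have h1 : (z.re ^ 2 - d * z.im ^ 2 : ℚ) = 0 := by
      have : ((z.re ^ 2 - d * z.im ^ 2 : ℚ) : K) = 0 := by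
        push_cast
        rw [← hα]
        linear_combination (z.re - z.im * α : K) * hz
      exact_mod_cast this
    have hd : (d : ℚ) < 0 := by exact_mod_cast hneg
    have h2 : z.im = 0 := by
      by_contra h
      have : 0 < z.im ^ 2 := by positivity
      nlinarith [sq_nonneg z.re]
    rw [h2] at h1
    ext <;> simp_all
  have hsurj : Function.Surjective f := by
    have : Module.finrank ℚ (QuadraticAlgebra ℚ (d : ℚ) 0) = Module.finrank ℚ K := by
      rw [hdeg, QuadraticAlgebra.finrank_eq_two]
    exact (LinearMap.injective_iff_surjective_of_finrank_eq_finrank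
      (f := f.toLinearMap) this).mp hinj
  exact ⟨AlgEquiv.ofBijective f ⟨hinj, hsurj⟩, hfz⟩

theorem norm_add_mul_eq (hneg : d < 0) (hα : α ^ 2 = (d : K))
    (hdeg : Module.finrank ℚ K = 2) (p q : ℚ) :
    Algebra.norm ℚ (p + q * α : K) = p ^ 2 - d * q ^ 2 := by
  obtain ⟨e, he⟩ := exists_algEquiv_quadraticAlgebra hneg hα hdeg
  have h := he ⟨p, q⟩
  simp only at h
  rw [← h, Algebra.norm_eq_of_algEquiv, Algebra.norm_apply]
  have := QuadraticAlgebra.det_toLinearMap_eq_norm (⟨p, q⟩ : QuadraticAlgebra ℚ (d : ℚ) 0)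
  rw [QuadraticAlgebra.norm_def] at this
  simp only [zero_mul, add_zero] at this
  rw [show p ^ 2 - d * q ^ 2 = p * p - d * q * q by ring]
  exact this

theorem infinitePlace_sq_eq (hneg : d < 0) (hα : α ^ 2 = (d : K)) (w : InfinitePlace K) (p q : ℚ) :
    w (p + q * α : K) ^ 2 = p ^ 2 - d * q ^ 2 := by
  rw [← w.norm_embedding_eq, ← Complex.normSq_eq_norm_sq]
  have h1 : w.embedding α ^ 2 = d := by rw [← map_pow, hα, map_intCast]
  set z := w.embedding α
  have him : z.re = 0 ∧ z.im ^ 2 = -d := by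
    have hre := congrArg Complex.re h1
    have him := congrArg Complex.im h1
    simp [pow_two] at hre him
    have hd : (d : ℝ) < 0 := by exact_mod_cast hneg
    have : z.re = 0 := by
      rcases mul_eq_zero.mp (show z.re * z.im = 0 by linarith) with h | h
      · exact h
      · nlinarith [sq_nonneg z.re]
    refine ⟨this, ?_⟩
    rw [this] at hre
    linarith
  have hre0 : (w.embedding α).re = 0 := him.1
  have him0 : (w.embedding α).im ^ 2 = -d := him.2
  simp [Complex.normSq_apply, hre0]
  linear_combination (q : ℝ) ^ 2 * him0

theorem card_units_eq_torsionOrder (hneg : d < 0) (hα : α ^ 2 = (d : K))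
    (hdeg : Module.finrank ℚ K = 2) :
    Nat.card (𝓞 K)ˣ = Units.torsionOrder K := by
  have htop : Units.torsion K = ⊤ := by
    rw [eq_top_iff]
    intro u _
    rw [Units.mem_torsion]
    intro w
    obtain ⟨e, he⟩ := exists_algEquiv_quadraticAlgebra hneg hα hdeg
    obtain ⟨z, hz⟩ := e.surjective (u : K)
    have h1 := infinitePlace_sq_eq hneg hα w z.re z.im
    have h2 := norm_add_mul_eq hneg hα hdeg z.re z.im
    rw [← he, hz] at h1 h2
    have h3 := (NumberField.isUnit_iff_norm (x := (u : 𝓞 K))).mp u.isUnit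
    rw [RingOfIntegers.coe_norm, h2] at h3
    have hd : (d : ℚ) < 0 := by exact_mod_cast hneg
    rw [abs_of_nonneg (by nlinarith [sq_nonneg z.re, sq_nonneg z.im])] at h3
    have h4 : (z.re ^ 2 - d * z.im ^ 2 : ℝ) = 1 := by exact_mod_cast h3
    rw [h4] at h1
    exact (pow_eq_one_iff_of_nonneg (apply_nonneg w _) two_ne_zero).mp h1
  rw [Units.torsionOrder, htop]
  exact (Nat.card_congr Subgroup.topEquiv.toEquiv).symm

theorem exists_span_singleton_eq_mul {R : Type*} [CommRing R] [IsDedekindDomain R]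
    {I J : (Ideal R)⁰} (h : ClassGroup.mk0 I = (ClassGroup.mk0 J)⁻¹) :
    ∃ x : R, Ideal.span {x} = (J : Ideal R) * I := by
  have h : ClassGroup.mk0 (J * I) = 1 := by rw [map_mul, h, mul_inv_cancel]
  obtain ⟨x, hx⟩ := (ClassGroup.mk0_eq_one_iff (J * I).2).mp h
  exact ⟨x, hx.symm⟩

theorem mk0_eq_inv_of_span_singleton_eq_mul {R : Type*} [CommRing R] [IsDedekindDomain R]
    {I J : (Ideal R)⁰} {x : R} (h : Ideal.span {x} = (J : Ideal R) * I) :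
    ClassGroup.mk0 I = (ClassGroup.mk0 J)⁻¹ := by
  rw [eq_inv_iff_mul_eq_one, mul_comm, ← map_mul]
  exact (ClassGroup.mk0_eq_one_iff (J * I).2).mpr ⟨x, h.symm⟩

theorem exists_span_singleton_eq_mul_of_mem {R : Type*} [CommRing R] [IsDedekindDomain R]
    {J : (Ideal R)⁰} {x : R} (hxJ : x ∈ (J : Ideal R)) (hx0 : x ≠ 0) :
    ∃ I : (Ideal R)⁰, Ideal.span {x} = (J : Ideal R) * I := by
  obtain ⟨I, hI⟩ := Ideal.dvd_iff_le.mpr ((Ideal.span_singleton_le_iff_mem J.1).mpr hxJ)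
  have hI0 : I ≠ 0 := fun h ↦ by
    rw [h, mul_zero] at hI
    exact hx0 (Ideal.span_singleton_eq_bot.mp hI)
  exact ⟨⟨I, mem_nonZeroDivisors_of_ne_zero hI0⟩, hI⟩

/-- Nonzero elements of `J` correspond to pairs of an ideal in the class inverse to `J`
and a unit. -/
theorem exists_equiv_mk0_eq_prod_units {R : Type*} [CommRing R] [IsDedekindDomain R]
    (J : (Ideal R)⁰) :
    ∃ e : ({I : (Ideal R)⁰ // ClassGroup.mk0 I = (ClassGroup.mk0 J)⁻¹} × Rˣ) ≃
      {x : R // x ∈ (J : Ideal R) ∧ x ≠ 0},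
      ∀ y, Ideal.span {(e y : R)} = (J : Ideal R) * y.1.1 := by
  choose g hg using fun I : {I : (Ideal R)⁰ // ClassGroup.mk0 I = (ClassGroup.mk0 J)⁻¹} ↦
    exists_span_singleton_eq_mul I.2
  have hg0 : ∀ I, g I ≠ 0 := fun I h ↦ by
    have := hg I
    rw [h, Ideal.span_singleton_zero] at this
    exact mul_ne_zero (nonZeroDivisors.ne_zero J.2) (nonZeroDivisors.ne_zero I.1.2) this.symm
  have hgJ : ∀ I, g I ∈ (J : Ideal R) := fun I ↦ by
    rw [← Ideal.span_singleton_le_iff_mem (J : Ideal R), hg]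
    exact Ideal.mul_le_left
  have hF : ∀ y : {I : (Ideal R)⁰ // ClassGroup.mk0 I = (ClassGroup.mk0 J)⁻¹} × Rˣ,
      g y.1 * y.2 ∈ (J : Ideal R) ∧ g y.1 * y.2 ≠ 0 := fun y ↦
    ⟨Ideal.mul_mem_right _ _ (hgJ _), mul_ne_zero (hg0 _) y.2.ne_zero⟩
  refine ⟨Equiv.ofBijective (fun y ↦ ⟨g y.1 * y.2, hF y⟩) ⟨?_, ?_⟩, ?_⟩
  · rintro ⟨I, u⟩ ⟨I', u'⟩ h
    have h : g I * u = g I' * u' := congrArg Subtype.val h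
    have hs : Ideal.span {g I} = Ideal.span {g I'} := by
      rw [← Ideal.span_singleton_mul_right_unit u.isUnit, h,
        Ideal.span_singleton_mul_right_unit u'.isUnit]
    rw [hg, hg] at hs
    have hI : I = I' :=
      Subtype.ext (Subtype.ext (mul_left_cancel₀ (nonZeroDivisors.ne_zero J.2) hs))
    subst hI
    rw [Units.ext (mul_left_cancel₀ (hg0 I) h)]
  · rintro ⟨x, hxJ, hx0⟩
    obtain ⟨I, hI⟩ := exists_span_singleton_eq_mul_of_mem hxJ hx0
    have hcl := mk0_eq_inv_of_span_singleton_eq_mul hI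
    have := hg ⟨I, hcl⟩
    rw [← hI] at this
    obtain ⟨u, hu⟩ := Ideal.span_singleton_eq_span_singleton.mp this
    exact ⟨⟨⟨_, hcl⟩, u⟩, Subtype.ext hu⟩
  · intro y
    exact (Ideal.span_singleton_mul_right_unit y.2.isUnit _).trans (hg y.1)

theorem det_ne_zero_of_linearIndependent {p q : Fin 2 → ℚ}
    (h : ∀ m n : ℤ, m * p 0 + n * p 1 = 0 → m * q 0 + n * q 1 = 0 → m = 0 ∧ n = 0) :
    p 0 * q 1 - p 1 * q 0 ≠ 0 := by
  have hQ : ∀ a b : ℚ, a * p 0 + b * p 1 = 0 → a * q 0 + b * q 1 = 0 → a = 0 ∧ b = 0 := by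
    intro a b h1 h2
    have ha := Rat.mul_den_eq_num a
    have hb := Rat.mul_den_eq_num b
    have hda : (a.den : ℚ) ≠ 0 := by exact_mod_cast a.den_nz
    have hdb : (b.den : ℚ) ≠ 0 := by exact_mod_cast b.den_nz
    have := h (a.num * b.den) (b.num * a.den)
      (by push_cast; rw [← ha, ← hb]; linear_combination (a.den * b.den : ℚ) * h1)
      (by push_cast; rw [← ha, ← hb]; linear_combination (a.den * b.den : ℚ) * h2)
    simpa using this
  intro h0
  obtain ⟨hp1, hp0⟩ := hQ (p 1) (-p 0) (by ring) (by linear_combination -h0)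
  obtain ⟨hq1, hq0⟩ := hQ (q 1) (-q 0) (by linear_combination h0) (by ring)
  have := hQ 1 0 (by linarith) (by linarith)
  simp at this

theorem exists_equiv_absNorm_eq_form (hneg : d < 0) (hα : α ^ 2 = (d : K))
    (hdeg : Module.finrank ℚ K = 2) (J : Ideal (𝓞 K)) (hJ : J ≠ ⊥) :
    ∃ (e : ℤ × ℤ ≃ J) (A C b : ℝ), 0 < A ∧ 0 < C ∧ e 0 = 0 ∧
      ∀ x, (Ideal.absNorm (Ideal.span {(e x : 𝓞 K)}) : ℝ) =
        A * (x.2 + b * x.1) ^ 2 + C * x.1 ^ 2 := by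
  let B : Module.Basis (Fin 2) ℤ J := Ideal.selfBasis
    (Module.finBasisOfFinrankEq ℤ (𝓞 K) ((RingOfIntegers.rank K).trans hdeg)) J hJ
  obtain ⟨E, hE⟩ := exists_algEquiv_quadraticAlgebra hneg hα hdeg
  have hcoord : ∀ v : K, ∃ p q : ℚ, v = p + q * α := fun v ↦ by
    obtain ⟨z, rfl⟩ := E.surjective v
    exact ⟨_, _, hE z⟩
  choose p q hpq using fun i ↦ hcoord ((B i : 𝓞 K) : K)
  have hd : (d : ℝ) < 0 := by exact_mod_cast hneg
  let e : ℤ × ℤ ≃ J := (finTwoArrowEquiv ℤ).symm.trans B.equivFun.symm.toEquiv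
  have he : ∀ x : ℤ × ℤ, e x = x.1 • B 0 + x.2 • B 1 := fun x ↦ by
    simp [e, Module.Basis.equivFun_symm_apply, Fin.sum_univ_two]
  have hev : ∀ x : ℤ × ℤ, ((e x : 𝓞 K) : K) =
      ((x.1 * p 0 + x.2 * p 1 : ℚ) : K) + ((x.1 * q 0 + x.2 * q 1 : ℚ) : K) * α := fun x ↦ by
    have : ((e x : 𝓞 K) : K) = x.1 * ((B 0 : 𝓞 K) : K) + x.2 * ((B 1 : 𝓞 K) : K) := by
      rw [he]
      simp
    rw [this, hpq, hpq]
    push_cast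
    ring
  have he0 : e 0 = 0 := by simp [he]
  have hdet := det_ne_zero_of_linearIndependent (p := p) (q := q) fun m n h1 h2 ↦ by
    have h3 := hev (m, n)
    simp only [h1, h2] at h3
    have h4 : e (m, n) = e 0 := by
      rw [he0]
      apply Subtype.ext
      apply RingOfIntegers.coe_injective
      simpa using h3
    simpa using e.injective h4
  have hdet' : (p 0 * q 1 - p 1 * q 0 : ℝ) ^ 2 > 0 := by
    have : (p 0 * q 1 - p 1 * q 0 : ℝ) ≠ 0 := by exact_mod_cast hdet
    positivity
  have hnorm : ∀ x : ℤ × ℤ, (Ideal.absNorm (Ideal.span {(e x : 𝓞 K)}) : ℝ) =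
      (x.1 * p 0 + x.2 * p 1) ^ 2 - d * (x.1 * q 0 + x.2 * q 1) ^ 2 := fun x ↦ by
    have h1 := norm_add_mul_eq hneg hα hdeg (x.1 * p 0 + x.2 * p 1) (x.1 * q 0 + x.2 * q 1)
    rw [← hev, ← Algebra.coe_norm_int] at h1
    have h2 : ((Algebra.norm ℤ (e x : 𝓞 K) : ℤ) : ℝ) =
        (x.1 * p 0 + x.2 * p 1) ^ 2 - d * (x.1 * q 0 + x.2 * q 1) ^ 2 := by exact_mod_cast h1
    rw [Ideal.absNorm_span_singleton, Nat.cast_natAbs, Int.cast_abs, h2]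
    have h3 := sq_nonneg (x.1 * p 0 + x.2 * p 1 : ℝ)
    have h4 := sq_nonneg (x.1 * q 0 + x.2 * q 1 : ℝ)
    exact abs_of_nonneg (by nlinarith)
  have hA : 0 < (p 1 : ℝ) ^ 2 - d * q 1 ^ 2 := by
    have h1 : (p 1 : ℝ) ≠ 0 ∨ (q 1 : ℝ) ≠ 0 := by
      by_contra! h
      rw [h.1, h.2] at hdet'
      simp at hdet'
    rcases h1 with h | h
    · have : 0 < (p 1 : ℝ) ^ 2 := by positivity
      nlinarith [sq_nonneg (q 1 : ℝ)]
    · have : 0 < (q 1 : ℝ) ^ 2 := by positivity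
      nlinarith [sq_nonneg (p 1 : ℝ)]
  refine ⟨e, (p 1 : ℝ) ^ 2 - d * q 1 ^ 2,
    -d * (p 0 * q 1 - p 1 * q 0) ^ 2 / ((p 1 : ℝ) ^ 2 - d * q 1 ^ 2),
    (p 0 * p 1 - d * q 0 * q 1) / ((p 1 : ℝ) ^ 2 - d * q 1 ^ 2), hA,
    div_pos (mul_pos (neg_pos.mpr hd) hdet') hA, he0, fun x ↦ ?_⟩
  rw [hnorm]
  have := hA.ne'
  field_simp
  ring

theorem exists_equiv_prod_units_absNorm_eq_form (hneg : d < 0) (hα : α ^ 2 = (d : K))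
    (hdeg : Module.finrank ℚ K = 2) (c : ClassGroup (𝓞 K)) :
    ∃ (e : ({I : (Ideal (𝓞 K))⁰ // ClassGroup.mk0 I = c} × (𝓞 K)ˣ) ≃ {x : ℤ × ℤ // x ≠ 0})
      (A C b : ℝ), 0 < A ∧ 0 < C ∧ ∀ y, (Ideal.absNorm (y.1.1 : Ideal (𝓞 K)) : ℝ) =
        A * ((e y).1.2 + b * (e y).1.1) ^ 2 + C * (e y).1.1 ^ 2 := by
  obtain ⟨J, hJ⟩ := ClassGroup.mk0_surjective c⁻¹
  obtain rfl : c = (ClassGroup.mk0 J)⁻¹ := by rw [hJ, inv_inv]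
  have hJ0 : (J : Ideal (𝓞 K)) ≠ ⊥ := nonZeroDivisors.ne_zero J.2
  have hN : 0 < (Ideal.absNorm (J : Ideal (𝓞 K)) : ℝ) := by
    exact_mod_cast Nat.pos_of_ne_zero (Ideal.absNorm_eq_zero_iff.not.mpr hJ0)
  obtain ⟨e₁, he₁⟩ := exists_equiv_mk0_eq_prod_units J
  obtain ⟨e₂, A, C, b, hA, hC, he0, he₂⟩ := exists_equiv_absNorm_eq_form hneg hα hdeg J hJ0
  have hiff : ∀ x : ℤ × ℤ, x ≠ 0 ↔ e₂ x ≠ 0 := fun x ↦ by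
    rw [← he0, e₂.injective.ne_iff]
  let e₃ : {x : 𝓞 K // x ∈ (J : Ideal (𝓞 K)) ∧ x ≠ 0} ≃ {x : (J : Ideal (𝓞 K)) // x ≠ 0} :=
    { toFun := fun x ↦ ⟨⟨x, x.2.1⟩, fun h ↦ x.2.2 (congrArg Subtype.val h)⟩
      invFun := fun x ↦ ⟨x, x.1.2, fun h ↦ x.2 (Subtype.ext h)⟩
      left_inv := fun _ ↦ rfl
      right_inv := fun _ ↦ rfl }
  let e₄ : {x : ℤ × ℤ // x ≠ 0} ≃ {x : (J : Ideal (𝓞 K)) // x ≠ 0} := e₂.subtypeEquiv hiff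
  refine ⟨(e₁.trans e₃).trans e₄.symm, A / Ideal.absNorm (J : Ideal (𝓞 K)),
    C / Ideal.absNorm (J : Ideal (𝓞 K)), b, div_pos hA hN, div_pos hC hN, fun y ↦ ?_⟩
  set x := ((e₁.trans e₃).trans e₄.symm) y with hx
  have h1 : ((e₂ x.1 : (J : Ideal (𝓞 K))) : 𝓞 K) = e₁ y := by
    have : e₄ x = e₃ (e₁ y) := by rw [hx]; simp
    exact congrArg (fun z ↦ ((z : {x : (J : Ideal (𝓞 K)) // x ≠ 0}).1 : 𝓞 K)) this
  have h2 := he₂ x.1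
  rw [h1, he₁, map_mul] at h2
  push_cast at h2
  rw [div_mul_eq_mul_div, div_mul_eq_mul_div, ← add_div, ← h2, mul_div_cancel_left₀ _ hN.ne']

/-- The sum over the ideals in a fixed class, as a theta series without its constant term. -/
theorem tsum_mk0_eq_exp (hneg : d < 0) (hα : α ^ 2 = (d : K))
    (hdeg : Module.finrank ℚ K = 2) (c : ClassGroup (𝓞 K)) :
    ∃ A C b : ℝ, 0 < A ∧ 0 < C ∧ ∀ t : ℝ, 0 < t →
      Summable (fun I : {I : (Ideal (𝓞 K))⁰ // ClassGroup.mk0 I = c} ↦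
        Real.exp (-(t * Ideal.absNorm (I.1 : Ideal (𝓞 K))))) ∧
      Units.torsionOrder K * ∑' I : {I : (Ideal (𝓞 K))⁰ // ClassGroup.mk0 I = c},
        Real.exp (-(t * Ideal.absNorm (I.1 : Ideal (𝓞 K)))) =
      ∑' x : ℤ × ℤ, Real.exp (-(t * (A * (x.2 + b * x.1) ^ 2 + C * x.1 ^ 2))) - 1 := by
  obtain ⟨e, A, C, b, hA, hC, he⟩ := exists_equiv_prod_units_absNorm_eq_form hneg hα hdeg c
  refine ⟨A, C, b, hA, hC, fun t ht ↦ ?_⟩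
  set f : ℤ × ℤ → ℝ := fun x ↦ Real.exp (-(t * (A * (x.2 + b * x.1) ^ 2 + C * x.1 ^ 2))) with hf
  set g : {I : (Ideal (𝓞 K))⁰ // ClassGroup.mk0 I = c} → ℝ := fun I ↦
    Real.exp (-(t * Ideal.absNorm (I.1 : Ideal (𝓞 K)))) with hg
  have hfs : Summable f := (abs_tsum_exp_neg_form_sub_le hA hC b ht).1
  have hfe : ∀ y, f (e y) = g y.1 := fun y ↦ by
    simp only [hf, hg, he]
  have hps : Summable (fun y : {I : (Ideal (𝓞 K))⁰ // ClassGroup.mk0 I = c} × (𝓞 K)ˣ ↦ g y.1) := by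
    simp only [← hfe]
    exact (hfs.subtype _).comp_injective e.injective
  refine ⟨hps.comp_injective (i := fun I ↦ (I, 1)) fun I I' h ↦ (Prod.ext_iff.mp h).1, ?_⟩
  have h1 : ∑' y : {I : (Ideal (𝓞 K))⁰ // ClassGroup.mk0 I = c} × (𝓞 K)ˣ, g y.1 =
      Units.torsionOrder K * ∑' I, g I := by
    rw [hps.tsum_prod, ← tsum_mul_left]
    simp only [tsum_const, card_units_eq_torsionOrder hneg hα hdeg, nsmul_eq_mul]
  have h2 : ∑' y : {I : (Ideal (𝓞 K))⁰ // ClassGroup.mk0 I = c} × (𝓞 K)ˣ, g y.1 =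
      ∑' x : {x : ℤ × ℤ // x ≠ 0}, f x := by
    simp only [← hfe]
    exact e.tsum_eq (fun x : {x : ℤ × ℤ // x ≠ 0} ↦ f x)
  have h3 := hfs.tsum_subtype_add_tsum_subtype_compl ({0} : Set (ℤ × ℤ))
  have h4 : f 0 = 1 := by simp [hf]
  rw [tsum_singleton (0 : ℤ × ℤ) f, h4] at h3
  rw [← h1, h2, ← h3, add_sub_cancel_left]
  rfl

theorem tendsto_tsum_mk0_eq_exp_sub (hneg : d < 0) (hα : α ^ 2 = (d : K))
    (hdeg : Module.finrank ℚ K = 2) (c : ClassGroup (𝓞 K)) :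
    Tendsto (fun t : ℝ ↦ ∑' I : {I : (Ideal (𝓞 K))⁰ // ClassGroup.mk0 I = c},
        Real.exp (-(t * Ideal.absNorm (I.1 : Ideal (𝓞 K)))) -
      2 * ∑' I : {I : (Ideal (𝓞 K))⁰ // ClassGroup.mk0 I = c},
        Real.exp (-(2 * t * Ideal.absNorm (I.1 : Ideal (𝓞 K))))) (𝓝[>] 0)
      (𝓝 (1 / Units.torsionOrder K)) := by
  obtain ⟨A, C, b, hA, hC, h⟩ := tsum_mk0_eq_exp hneg hα hdeg c
  have hw : (Units.torsionOrder K : ℝ) ≠ 0 := by exact_mod_cast Units.torsionOrder_ne_zero K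
  have h1 := ((tendsto_tsum_exp_neg_form_sub hA hC b).add_const 1).div_const
    (Units.torsionOrder K : ℝ)
  rw [zero_add] at h1
  refine h1.congr' ?_
  filter_upwards [self_mem_nhdsWithin] with t (ht : 0 < t)
  rw [div_eq_iff hw]
  linear_combination 2 * (h (2 * t) (by positivity)).2 - (h t ht).2

theorem summable_exp_neg_absNorm (hneg : d < 0) (hα : α ^ 2 = (d : K))
    (hdeg : Module.finrank ℚ K = 2) {t : ℝ} (ht : 0 < t) :
    Summable (fun I : (Ideal (𝓞 K))⁰ ↦ Real.exp (-(t * Ideal.absNorm (I : Ideal (𝓞 K))))) := by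
  rw [← (Equiv.sigmaFiberEquiv (ClassGroup.mk0 (R := 𝓞 K))).summable_iff]
  refine (summable_sigma_of_nonneg fun _ ↦ (Real.exp_pos _).le).mpr ⟨fun c ↦ ?_, ?_⟩
  · obtain ⟨A, C, b, hA, hC, h⟩ := tsum_mk0_eq_exp hneg hα hdeg c
    exact (h t ht).1
  · exact Summable.of_finite

theorem tendsto_tsum_exp_neg_absNorm_sub (hneg : d < 0) (hα : α ^ 2 = (d : K))
    (hdeg : Module.finrank ℚ K = 2) :
    Tendsto (fun t : ℝ ↦ ∑' I : (Ideal (𝓞 K))⁰, Real.exp (-(t * Ideal.absNorm (I : Ideal (𝓞 K)))) -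
      2 * ∑' I : (Ideal (𝓞 K))⁰, Real.exp (-(2 * t * Ideal.absNorm (I : Ideal (𝓞 K))))) (𝓝[>] 0)
      (𝓝 (classNumber K / Units.torsionOrder K)) := by
  have h1 := tendsto_finsetSum (Finset.univ : Finset (ClassGroup (𝓞 K)))
    fun c _ ↦ tendsto_tsum_mk0_eq_exp_sub hneg hα hdeg c
  have h2 : ∀ t : ℝ, 0 < t → ∑' I : (Ideal (𝓞 K))⁰,
      Real.exp (-(t * Ideal.absNorm (I : Ideal (𝓞 K)))) =
      ∑ c : ClassGroup (𝓞 K), ∑' I : {I : (Ideal (𝓞 K))⁰ // ClassGroup.mk0 I = c},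
        Real.exp (-(t * Ideal.absNorm (I.1 : Ideal (𝓞 K)))) := fun t ht ↦ by
    have hs := summable_exp_neg_absNorm hneg hα hdeg ht
    rw [← (Equiv.sigmaFiberEquiv (ClassGroup.mk0 (R := 𝓞 K))).summable_iff] at hs
    rw [← (Equiv.sigmaFiberEquiv (ClassGroup.mk0 (R := 𝓞 K))).tsum_eq]
    exact hs.tsum_sigma.trans (tsum_fintype _)
  have h3 : ∑ _c : ClassGroup (𝓞 K), (1 / Units.torsionOrder K : ℝ) =
      classNumber K / Units.torsionOrder K := by
    rw [Finset.sum_const, nsmul_eq_mul, classNumber, Finset.card_univ]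
    ring
  rw [← h3]
  refine h1.congr' ?_
  filter_upwards [self_mem_nhdsWithin] with t (ht : 0 < t)
  rw [h2 t ht, h2 (2 * t) (by positivity), Finset.mul_sum, ← Finset.sum_sub_distrib]

theorem exists_int_eq_of_squarefree_mul_sq {m k : ℤ} (hm : Squarefree m) {r : ℚ}
    (h : m * r ^ 2 = k) : ∃ n : ℤ, r = n := by
  have hden : (r.den : ℚ) ≠ 0 := by exact_mod_cast r.den_nz
  have h1 : m * r.num ^ 2 = k * (r.den : ℤ) ^ 2 := by
    have : (m * r.num ^ 2 : ℚ) = k * (r.den : ℚ) ^ 2 := by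
      rw [← h, ← Rat.mul_den_eq_num r]
      ring
    exact_mod_cast this
  have hcop : IsCoprime ((r.den : ℤ) ^ 2) (r.num ^ 2) :=
    IsCoprime.pow (Int.isCoprime_iff_gcd_eq_one.mpr (by
      rw [Int.gcd_comm]; simpa [Int.gcd] using r.reduced))
  have h2 : (r.den : ℤ) * r.den ∣ m := by
    rw [← pow_two]
    exact hcop.dvd_of_dvd_mul_right ⟨k, by rw [h1]; ring⟩
  have h3 : r.den = 1 := by
    have := Int.isUnit_iff_natAbs_eq.mp (hm _ h2)
    simpa using this
  exact ⟨r.num, by rw [Rat.coe_int_num_of_den_eq_one h3]⟩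

theorem IsFundamentalDiscriminant.four_mul_add (hd : IsFundamentalDiscriminant d) :
    4 * ((d - d % 2) / 4) + (d % 2) ^ 2 = d := by
  rcases hd.2 with h | h
  · have : d % 2 = 1 := by lia
    rw [this]; lia
  · have : d % 2 = 0 := by lia
    rw [this]; lia

/-- An element of `ℚ(√d)` with integral trace and norm lies in `ℤ[(b + √d) / 2]`. -/
theorem IsFundamentalDiscriminant.exists_int_of_trace_norm (hd : IsFundamentalDiscriminant d)
    {p q : ℚ} {T M : ℤ} (hT : 2 * p = T) (hM : p ^ 2 - d * q ^ 2 = M) :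
    ∃ x y : ℤ, p = x + (d % 2 : ℤ) * y / 2 ∧ q = y / 2 := by
  rcases hd.2 with ⟨h4, hs⟩ | ⟨h4, hs, hm⟩
  · have h1 : (d : ℚ) * (2 * q) ^ 2 = (T ^ 2 - 4 * M : ℤ) := by
      push_cast
      rw [← hT, ← hM]
      ring
    obtain ⟨y, hy⟩ := exists_int_eq_of_squarefree_mul_sq hs h1
    rw [hy] at h1
    have h2 : d * y ^ 2 = T ^ 2 - 4 * M := by exact_mod_cast h1
    have hpar : T % 2 = y % 2 := by
      have h3 : (d * y ^ 2) % 2 = (T ^ 2 - 4 * M) % 2 := by rw [h2]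
      have hd2 : d % 2 = 1 := by lia
      rcases Int.emod_two_eq_zero_or_one y with hy2 | hy2 <;>
      rcases Int.emod_two_eq_zero_or_one T with hT2 | hT2 <;>
      simp [pow_two, Int.sub_emod, Int.mul_emod, hy2, hT2, hd2] at h3 ⊢
    have hd2 : d % 2 = 1 := by lia
    obtain ⟨x, hx⟩ : (2 : ℤ) ∣ T - y := by lia
    refine ⟨x, y, ?_, by linarith⟩
    have hx' : (T - y : ℚ) = 2 * x := by exact_mod_cast hx
    rw [hd2]
    push_cast
    linarith
  · obtain ⟨m, rfl⟩ : (4 : ℤ) ∣ d := by lia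
    have h40 : (4 * m) / 4 = m := by lia
    rw [h40] at hs hm
    have h1 : (m : ℚ) * (4 * q) ^ 2 = (T ^ 2 - 4 * M : ℤ) := by
      push_cast at hM ⊢
      rw [← hT, ← hM]
      ring
    obtain ⟨z, hz⟩ := exists_int_eq_of_squarefree_mul_sq hs h1
    rw [hz] at h1
    have h2 : m * z ^ 2 = T ^ 2 - 4 * M := by exact_mod_cast h1
    have hpar : T % 2 = 0 ∧ z % 2 = 0 := by
      have h3 : (m * z ^ 2) % 4 = (T ^ 2 - 4 * M) % 4 := by rw [h2]
      have hz4 : z % 4 = 0 ∨ z % 4 = 1 ∨ z % 4 = 2 ∨ z % 4 = 3 := by lia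
      have hT4 : T % 4 = 0 ∨ T % 4 = 1 ∨ T % 4 = 2 ∨ T % 4 = 3 := by lia
      rcases hm with hm | hm <;> rcases hz4 with h | h | h | h <;>
      rcases hT4 with h' | h' | h' | h' <;>
      simp [pow_two, Int.sub_emod, Int.mul_emod, h, h', hm] at h3 <;> lia
    obtain ⟨x, hx⟩ : (2 : ℤ) ∣ T := by lia
    obtain ⟨y, hy⟩ : (2 : ℤ) ∣ z := by lia
    have hd2 : (4 * m) % 2 = 0 := by lia
    refine ⟨x, y, ?_, ?_⟩
    · rw [hx] at hT
      push_cast at hT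
      rw [hd2]
      push_cast
      linarith
    · rw [hy] at hz
      push_cast at hz
      linarith

/-- The ring of integers of `ℚ(√d)` is `ℤ[(b + √d) / 2]`, where `b` is the parity of `d`. -/
theorem IsFundamentalDiscriminant.nonempty_ringEquiv (hd : IsFundamentalDiscriminant d)
    (hneg : d < 0) (hα : α ^ 2 = (d : K)) (hdeg : Module.finrank ℚ K = 2) :
    Nonempty (QuadraticAlgebra ℤ ((d - d % 2) / 4) (d % 2) ≃+* 𝓞 K) := by
  have h4 := hd.four_mul_add
  set a := (d - d % 2) / 4
  have hcoord := fun {p q : ℚ} {T M : ℤ} ↦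
    hd.exists_int_of_trace_norm (p := p) (q := q) (T := T) (M := M)
  set b := d % 2
  have h4K : (4 * a + b ^ 2 : K) = d := by exact_mod_cast h4
  have hω : ((b + α) / 2) * ((b + α) / 2) = a + b * ((b + α) / 2) := by
    field_simp
    linear_combination hα - h4K
  have hωint : IsIntegral ℤ ((b + α) / 2 : K) := by
    refine ⟨Polynomial.X ^ 2 - (Polynomial.C b * Polynomial.X + Polynomial.C a), ?_, ?_⟩
    · refine Polynomial.monic_X_pow_sub ?_
      exact (Polynomial.degree_linear_le).trans_lt (by norm_num)
    · simp only [Polynomial.eval₂_sub, Polynomial.eval₂_add, Polynomial.eval₂_mul,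
        Polynomial.eval₂_pow, Polynomial.eval₂_X, Polynomial.eval₂_C]
      simp only [algebraMap_int_eq, eq_intCast]
      linear_combination hω
  obtain ⟨ω, hωc⟩ : ∃ ω : 𝓞 K, (ω : K) = (b + α) / 2 := ⟨⟨_, hωint⟩, rfl⟩
  set f : QuadraticAlgebra ℤ a b →ₐ[ℤ] 𝓞 K := QuadraticAlgebra.lift ⟨ω, by
    apply RingOfIntegers.coe_injective
    simpa [hωc] using hω⟩ with hf
  have hfz : ∀ z, ((f z : 𝓞 K) : K) = z.re + z.im * ((b + α) / 2) := fun z ↦ by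
    simp [hf, QuadraticAlgebra.lift, hωc]
  obtain ⟨E, hE⟩ := exists_algEquiv_quadraticAlgebra hneg hα hdeg
  refine ⟨RingEquiv.ofBijective f ⟨?_, fun v ↦ ?_⟩⟩
  · rw [injective_iff_map_eq_zero]
    intro z hz
    have h1 := hfz z
    have h2 := hE ⟨z.re + b * z.im / 2, z.im / 2⟩
    rw [hz, RingOfIntegers.coe_eq_algebraMap, map_zero] at h1
    have h3 : E ⟨z.re + b * z.im / 2, z.im / 2⟩ = E 0 := by
      rw [h2, map_zero, h1]
      push_cast
      ring
    have h4 := E.injective h3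
    rw [QuadraticAlgebra.ext_iff] at h4
    simp only [QuadraticAlgebra.re_zero, QuadraticAlgebra.im_zero] at h4
    have him : (z.im : ℚ) = 0 := by linarith [h4.2]
    have hre : (z.re : ℚ) = 0 := by
      have := h4.1
      rw [him] at this
      linarith
    ext
    · exact_mod_cast hre
    · exact_mod_cast him
  · obtain ⟨z, hz⟩ := E.surjective (v : K)
    rw [hE] at hz
    have h1 := norm_add_mul_eq hneg hα hdeg z.re z.im
    rw [hz, ← Algebra.coe_norm_int] at h1
    have h2 := norm_add_mul_eq hneg hα hdeg (1 + z.re) z.im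
    rw [show (((1 + z.re : ℚ) : K) + z.im * α) = ((1 + v : 𝓞 K) : K) by
      push_cast; rw [add_assoc]; exact congrArg (1 + ·) hz, ← Algebra.coe_norm_int] at h2
    obtain ⟨x, y, hx, hy⟩ := hcoord (p := z.re) (q := z.im)
      (T := Algebra.norm ℤ (1 + v) - Algebra.norm ℤ v - 1) (M := Algebra.norm ℤ v)
      (by push_cast; rw [h1, h2]; ring) h1.symm
    refine ⟨⟨x, y⟩, ?_⟩
    apply RingOfIntegers.coe_injective
    change ((f ⟨x, y⟩ : 𝓞 K) : K) = v
    rw [hfz, ← hz, hx, hy]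
    push_cast
    ring

theorem IsFundamentalDiscriminant.card_ringHom_zmod (hd : IsFundamentalDiscriminant d)
    (hneg : d < 0) (hα : α ^ 2 = (d : K)) (hdeg : Module.finrank ℚ K = 2) {p : ℕ}
    (hp : p.Prime) :
    (Nat.card (𝓞 K →+* ZMod p) : ℤ) = kroneckerSym d p + 1 := by
  have := Fact.mk hp
  obtain ⟨e⟩ := hd.nonempty_ringEquiv hneg hα hdeg
  let f : (𝓞 K →+* ZMod p) ≃
      {x : ZMod p // x * x = ((d - d % 2) / 4) • 1 + (d % 2) • x} :=
    ((RingHom.equivIntAlgHom (𝓞 K) (ZMod p)).trans (AlgEquiv.arrowCongr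
      (AlgEquiv.ofRingEquiv (f := e.symm) fun n ↦ by simp) AlgEquiv.refl)).trans
      QuadraticAlgebra.lift.symm
  rw [Nat.card_congr f]
  rcases hp.eq_two_or_odd' with rfl | hodd
  · rw [ZMod.card_quadratic_roots_two _ _ (by lia), hd.four_mul_add]
  · rw [ZMod.card_quadratic_roots (by rintro rfl; exact absurd hodd (by decide)), hd.four_mul_add,
      kroneckerSym_of_odd d hodd]

theorem IsFundamentalDiscriminant.card_absNorm_eq (hd : IsFundamentalDiscriminant d)
    (hneg : d < 0) (hα : α ^ 2 = (d : K)) (hdeg : Module.finrank ℚ K = 2) {n : ℕ} (hn : n ≠ 0) :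
    (Nat.card {I : Ideal (𝓞 K) // Ideal.absNorm I = n} : ℤ) =
      ∑ m ∈ n.divisors, kroneckerSym d m := by
  have hpow {p : ℕ} (k : ℕ) (hp : p.Prime) :
      (Nat.card {I : Ideal (𝓞 K) // Ideal.absNorm I = p ^ k} : ℤ) =
        ∑ m ∈ (p ^ k).divisors, kroneckerSym d m := by
    rw [Ideal.card_absNorm_eq_prime_pow_s8 ((RingOfIntegers.rank K).trans hdeg) hp,
      hd.card_ringHom_zmod hneg hα hdeg hp, Nat.sum_divisors_prime_pow hp]
    exact Finset.sum_congr rfl fun j _ ↦ by rw [kroneckerSym_pow d hp.ne_zero, add_sub_cancel_right]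
  induction n using Nat.recOnPrimeCoprime with
  | zero => exact absurd rfl hn
  | prime_pow p k hp => exact hpow k hp
  | coprime a b ha hb hab iha ihb =>
    rw [Ideal.card_absNorm_eq_mul hab, Nat.cast_mul, iha (by lia), ihb (by lia),
      sum_divisors_kroneckerSym_mul d hab]

theorem IsFundamentalDiscriminant.tsum_exp_neg_absNorm (hd : IsFundamentalDiscriminant d)
    (hneg : d < 0) (hα : α ^ 2 = (d : K)) (hdeg : Module.finrank ℚ K = 2) {t : ℝ} (ht : 0 < t) :
    ∑' I : (Ideal (𝓞 K))⁰, Real.exp (-(t * Ideal.absNorm (I : Ideal (𝓞 K)))) =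
      ∑' n : ℕ, (∑ m ∈ n.divisors, (kroneckerSym d m : ℝ)) * Real.exp (-(t * n)) := by
  have hs := summable_exp_neg_absNorm hneg hα hdeg ht
  let e := Equiv.sigmaFiberEquiv fun I : (Ideal (𝓞 K))⁰ ↦ Ideal.absNorm (I : Ideal (𝓞 K))
  rw [← e.tsum_eq]
  refine (e.summable_iff.mpr hs).tsum_sigma.trans (tsum_congr fun n ↦ ?_)
  simp only [Function.comp_apply]
  have h1 (I : {I : (Ideal (𝓞 K))⁰ // Ideal.absNorm (I : Ideal (𝓞 K)) = n}) :
      Real.exp (-(t * Ideal.absNorm (e ⟨n, I⟩ : Ideal (𝓞 K)))) = Real.exp (-(t * n)) := by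
    congr 3
    exact_mod_cast I.2
  rw [tsum_congr h1, tsum_const, nsmul_eq_mul]
  congr 1
  rcases eq_or_ne n 0 with rfl | hn
  · have : IsEmpty {I : (Ideal (𝓞 K))⁰ // Ideal.absNorm (I : Ideal (𝓞 K)) = 0} :=
      ⟨fun I ↦ Ideal.absNorm_ne_zero_of_nonZeroDivisors I.1 I.2⟩
    simp
  · have h2 : Nat.card {I : (Ideal (𝓞 K))⁰ // Ideal.absNorm (I : Ideal (𝓞 K)) = n} =
        Nat.card {I : Ideal (𝓞 K) // Ideal.absNorm I = n} := by
      let φ : {I : (Ideal (𝓞 K))⁰ // Ideal.absNorm (I : Ideal (𝓞 K)) = n} →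
        {I : Ideal (𝓞 K) // Ideal.absNorm I = n} := fun I ↦ ⟨I.1, I.2⟩
      refine Nat.card_eq_of_bijective φ ⟨fun I J h ↦ ?_, fun I ↦ ?_⟩
      · have h' : (φ I).1 = (φ J).1 := by rw [h]
        exact Subtype.ext (Subtype.ext h')
      · refine ⟨⟨⟨I.1, mem_nonZeroDivisors_of_ne_zero fun h ↦ hn ?_⟩, I.2⟩, rfl⟩
        rw [← I.2, h]
        exact Ideal.absNorm_bot
    rw [h2]
    exact_mod_cast hd.card_absNorm_eq hneg hα hdeg hn

theorem IsFundamentalDiscriminant.tsum_exp_neg_absNorm_sub (hd : IsFundamentalDiscriminant d)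
    (hneg : d < 0) (hα : α ^ 2 = (d : K)) (hdeg : Module.finrank ℚ K = 2) {t : ℝ} (ht : 0 < t) :
    ∑' I : (Ideal (𝓞 K))⁰, Real.exp (-(t * Ideal.absNorm (I : Ideal (𝓞 K)))) -
      2 * ∑' I : (Ideal (𝓞 K))⁰, Real.exp (-(2 * t * Ideal.absNorm (I : Ideal (𝓞 K)))) =
    ∑' m : ℕ, (kroneckerSym d (m + d.natAbs) : ℝ) * (1 / (Real.exp (m * t) + 1)) := by
  have h4 : d % 4 = 0 ∨ d % 4 = 1 := by rcases hd.2 with h | h <;> simp [h.1]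
  set f : ℕ → ℝ := fun m ↦ kroneckerSym d (m + d.natAbs) with hfdef
  have hf (n : ℕ) : |f n| ≤ 1 := by
    simp only [hfdef]
    exact_mod_cast abs_kroneckerSym_le_one d (n + d.natAbs)
  have hf0 : f 0 = 0 := by simp only [hfdef, zero_add, kroneckerSym_natAbs h4 hneg, Int.cast_zero]
  have hsum (n : ℕ) : ∑ m ∈ n.divisors, (kroneckerSym d m : ℝ) = ∑ m ∈ n.divisors, f m :=
    Finset.sum_congr rfl fun m hm ↦ by
      simp only [hfdef, kroneckerSym_add_natAbs h4 hneg (Nat.pos_of_mem_divisors hm).ne']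
  obtain ⟨hs1, he1⟩ := summable_and_tsum_sum_divisors_mul_exp hf ht
  obtain ⟨hs2, he2⟩ := summable_and_tsum_sum_divisors_mul_exp hf (t := 2 * t) (by positivity)
  rw [hd.tsum_exp_neg_absNorm hneg hα hdeg ht,
    hd.tsum_exp_neg_absNorm hneg hα hdeg (t := 2 * t) (by positivity)]
  simp only [hsum]
  rw [he1, he2, ← tsum_mul_left, ← hs1.tsum_sub (hs2.mul_left 2)]
  refine tsum_congr fun m ↦ ?_
  change _ = f m * _
  rcases eq_or_ne m 0 with rfl | hm
  · rw [hf0]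
    ring
  · have hy : 1 < Real.exp (m * t) :=
      Real.one_lt_exp_iff.mpr (mul_pos (by exact_mod_cast Nat.pos_of_ne_zero hm) ht)
    have e : Real.exp (m * (2 * t)) = Real.exp (m * t) ^ 2 := by
      rw [← Real.exp_nat_mul]
      ring_nf
    rw [e]
    generalize Real.exp (m * t) = y at hy
    have h1 : y - 1 ≠ 0 := by linarith
    have h2 : y + 1 ≠ 0 := by linarith
    have h3 : y ^ 2 - 1 = (y - 1) * (y + 1) := by ring
    rw [h3]
    field_simp
    ring

end ImaginaryQuadratic

/-- Dirichlet's finite class number formula: for a fundamental discriminant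
`d < 0` and `K = ℚ(√d)`, one has `h_K = -(w_d / (2|d|)) ∑_{r=1}^{|d|-1} (d/r) r`, where
`w_d` is the number of roots of unity in `K` and `(d/·)` is the Kronecker symbol.
Stated as an identity in `ℤ` after clearing denominators. -/
theorem dirichlet_finite_class_number_formula {K : Type*} [Field K] [NumberField K]
    (d : ℤ) (hd : IsFundamentalDiscriminant d) (hneg : d < 0)
    (α : K) (hα : α ^ 2 = (d : K)) (hdeg : Module.finrank ℚ K = 2) :
    2 * (d.natAbs : ℤ) * (NumberField.classNumber K : ℤ) =
      -((NumberField.Units.torsionOrder K : ℕ) : ℤ) *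
        ∑ r ∈ Finset.Icc 1 (d.natAbs - 1), kroneckerSym d r * (r : ℤ) := by
  have h4 : d % 4 = 0 ∨ d % 4 = 1 := by rcases hd.2 with h | h <;> simp [h.1]
  have hlim := tendsto_tsum_exp_neg_absNorm_sub hneg hα hdeg
  have hlim' := tendsto_tsum_mul_one_div_exp_add_one (N := d.natAbs) (by lia)
    (χ := fun m ↦ (kroneckerSym d (m + d.natAbs) : ℝ))
    (fun m ↦ by simp only [kroneckerSym_add_natAbs h4 hneg (n := m + d.natAbs) (by lia)])
    (by exact_mod_cast sum_kroneckerSym_eq_zero h4 hneg)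
    (fun n ↦ by exact_mod_cast abs_kroneckerSym_le_one d _)
  have hev := Filter.eventually_of_mem (self_mem_nhdsWithin : Set.Ioi (0 : ℝ) ∈ 𝓝[>] 0)
    fun t ht ↦ hd.tsum_exp_neg_absNorm_sub hneg hα hdeg ht
  have heq := tendsto_nhds_unique (hlim.congr' hev) hlim'
  have hsum : ∑ r ∈ Finset.range d.natAbs, (kroneckerSym d (r + d.natAbs) : ℝ) * r =
      (∑ r ∈ Finset.Icc 1 (d.natAbs - 1), kroneckerSym d r * (r : ℤ) : ℤ) := by
    have hIcc : Finset.Icc 1 (d.natAbs - 1) = (Finset.range d.natAbs).erase 0 := by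
      ext r
      simp only [Finset.mem_Icc, Finset.mem_erase, Finset.mem_range]
      lia
    rw [hIcc, ← Finset.sum_erase (Finset.range d.natAbs) (a := 0) (by simp)]
    push_cast
    exact Finset.sum_congr rfl fun r hr ↦ by
      rw [kroneckerSym_add_natAbs h4 hneg (Finset.ne_of_mem_erase hr)]
  rw [hsum] at heq
  have hN : (d.natAbs : ℝ) ≠ 0 := by simpa using hneg.ne
  have hw : (Units.torsionOrder K : ℝ) ≠ 0 := by exact_mod_cast Units.torsionOrder_ne_zero K
  rw [div_eq_div_iff hw (by positivity)] at heq
  generalize d.natAbs = N at heq ⊢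
  rify
  push_cast at heq
  linear_combination heq
end
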